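/- arXiv:1809.00401 — 2 statements merged into one kernel-verified Lean document; each statement's English description precedes it below -/
import Mathlib

section
/- Every Darboux injection f : X → Y from a connected closed n-manifold X of dimension n ≥ 2 to a 2-variety Y is an open topological embedding: f is a homeomorphism onto its image and f(X) is open in Y. -/
/-- A topological space is *componnected* if it has a base of its topology such that
the complement of every basic set is a finite union of sets, each of which is
compact or connected. -/
def Componnected (Y : Type*) [TopologicalSpace Y] : Prop :=
  ∃ B : Set (Set Y), TopologicalSpace.IsTopologicalBasis B ∧
    ∀ b ∈ B, ∃ (k : ℕ) (C : Fin k → Set Y), bᶜ = ⋃ i, C i ∧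
      ∀ i, IsCompact (C i) ∨ IsConnected (C i)

/-- A *1-variety* is a Hausdorff space in which every point has a neighborhood
homeomorphic to `ℝ`. -/
def IsOneVariety (Y : Type*) [TopologicalSpace Y] : Prop :=
  T2Space Y ∧ ∀ y : Y, ∃ U ∈ nhds y, Nonempty (U ≃ₜ ℝ)

/-- A *2-variety* is a first-countable Hausdorff space `Y` each of whose connected
components is componnected such that for every connected set `C ⊆ Y` with more than
one point and every sequence in `Y` converging to a point of the closure of `C`,
there is a compact connected 1-variety `S ⊆ Y` separating `C` (i.e. `C \ S` is
disconnected) and containing infinitely many members of the sequence. -/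
def IsTwoVariety (Y : Type*) [TopologicalSpace Y] : Prop :=
  T2Space Y ∧ FirstCountableTopology Y ∧
    (∀ y : Y, Componnected (connectedComponent y)) ∧
    ∀ C : Set Y, IsPreconnected C → C.Nontrivial →
      ∀ (u : ℕ → Y) (y : Y), y ∈ closure C → Filter.Tendsto u Filter.atTop (nhds y) →
        ∃ S : Set Y, IsCompact S ∧ IsConnected S ∧ IsOneVariety S ∧
          ¬ IsPreconnected (C \ S) ∧ {n : ℕ | u n ∈ S}.Infinite

section

open Set Filter Topology Metric

/-- `HasContLogOn G A`: the function `G` has a continuous logarithm on the set `A`. -/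
def HasContLogOn {X : Type*} [TopologicalSpace X] (G : X → ℂ) (A : Set X) : Prop :=
  ∃ g : X → ℂ, ContinuousOn g A ∧ ∀ x ∈ A, Complex.exp (g x) = G x

section Log

variable {X : Type*} [TopologicalSpace X]

theorem HasContLogOn.mono {G : X → ℂ} {A B : Set X} (h : HasContLogOn G B) (hAB : A ⊆ B) :
    HasContLogOn G A := by
  obtain ⟨g, hg, hgG⟩ := h
  exact ⟨g, hg.mono hAB, fun x hx => hgG x (hAB hx)⟩

theorem HasContLogOn.congr {F G : X → ℂ} {A : Set X} (h : HasContLogOn G A)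
    (hFG : ∀ x ∈ A, F x = G x) : HasContLogOn F A := by
  obtain ⟨g, hg, hgG⟩ := h
  exact ⟨g, hg, fun x hx => (hgG x hx).trans (hFG x hx).symm⟩

theorem HasContLogOn.mul {F G : X → ℂ} {A : Set X} (hF : HasContLogOn F A)
    (hG : HasContLogOn G A) : HasContLogOn (fun x => F x * G x) A := by
  obtain ⟨f, hf, hfF⟩ := hF
  obtain ⟨g, hg, hgG⟩ := hG
  exact ⟨fun x => f x + g x, hf.add hg, fun x hx => by
    rw [Complex.exp_add, hfF x hx, hgG x hx]⟩

theorem HasContLogOn.div {F G : X → ℂ} {A : Set X} (hF : HasContLogOn F A)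
    (hG : HasContLogOn G A) : HasContLogOn (fun x => F x / G x) A := by
  obtain ⟨f, hf, hfF⟩ := hF
  obtain ⟨g, hg, hgG⟩ := hG
  exact ⟨fun x => f x - g x, hf.sub hg, fun x hx => by
    rw [Complex.exp_sub, hfF x hx, hgG x hx]⟩

theorem HasContLogOn.comp {Z : Type*} [TopologicalSpace Z] {G : X → ℂ} {A : Set X}
    (h : HasContLogOn G A) {u : Z → X} {B : Set Z} (hu : ContinuousOn u B) (hBA : MapsTo u B A) :
    HasContLogOn (fun z => G (u z)) B := by
  obtain ⟨g, hg, hgG⟩ := h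
  exact ⟨fun z => g (u z), hg.comp hu hBA, fun z hz => hgG _ (hBA hz)⟩

theorem hasContLogOn_of_norm_sub_one_lt {G : X → ℂ} {A : Set X} (hG : ContinuousOn G A)
    (h : ∀ x ∈ A, ‖G x - 1‖ < 1) : HasContLogOn G A := by
  have hs : ∀ x ∈ A, G x ∈ Complex.slitPlane := fun x hx => by
    have := Complex.mem_slitPlane_of_norm_lt_one (h x hx)
    simpa using this
  exact ⟨fun x => Complex.log (G x), hG.clog hs, fun x hx =>
    Complex.exp_log (Complex.slitPlane_ne_zero (hs x hx))⟩

theorem hasContLogOn_univ_of_ne_zero {G : ℂ → ℂ} (hG : Continuous G) (h0 : ∀ z, G z ≠ 0) :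
    HasContLogOn G univ := by
  have hU : IsSimplyConnected (univ : Set ℂ) := by
    have := (convex_univ : Convex ℝ (univ : Set ℂ)).contractibleSpace univ_nonempty
    exact (inferInstance : SimplyConnectedSpace (univ : Set ℂ))
  obtain ⟨g, hg, hgG⟩ := Complex.exists_continuousOn_eqOn_exp_comp hU isOpen_univ hG.continuousOn
    (by rintro ⟨z, -, hz⟩; exact h0 z hz)
  exact ⟨g, hg, fun x hx => hgG hx⟩

/-- The identity has no continuous logarithm on a circle. -/
theorem not_hasContLogOn_sphere {r : ℝ} (hr : 0 < r) (a : ℂ) :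
    ¬ HasContLogOn (fun z : ℂ => z - a) (sphere a r) := by
  rintro ⟨g, hg, hgG⟩
  have hmem : ∀ t : ℝ, circleMap a r t ∈ sphere a r := fun t =>
    circleMap_mem_sphere a hr.le t
  let k : ℝ → ℂ := fun t => g (circleMap a r t) - t * Complex.I
  have hk : Continuous k :=
    (hg.comp_continuous (continuous_circleMap a r) hmem).sub (by fun_prop)
  have hexp : ∀ t, Complex.exp (k t) = r := fun t => by
    have h1 := hgG _ (hmem t)
    simp only [k, Complex.exp_sub, h1]
    simp [circleMap]
  let F : ℝ → ℂ := fun t => (k t - k 0) / (2 * Real.pi * Complex.I)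
  have hF : ∀ t, ∃ n : ℤ, F t = n := fun t => by
    obtain ⟨n, hn⟩ := Complex.exp_eq_exp_iff_exists_int.1 ((hexp t).trans (hexp 0).symm)
    refine ⟨n, ?_⟩
    simp only [F, hn]
    have := Complex.two_pi_I_ne_zero
    field_simp
    ring
  have hFc : Continuous fun t => (F t).re := by
    simp only [F]; fun_prop
  choose n hn using hF
  have h2 : ∀ t, (F t).re = n t := fun t => by rw [hn]; simp
  have hF0 : F 0 = 0 := by simp [F]
  have hF2 : F (2 * Real.pi) = -1 := by
    simp only [F, k]
    have e1 : circleMap a r (2 * Real.pi) = circleMap a r 0 := by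
      simp [circleMap]
    rw [e1]
    have := Complex.two_pi_I_ne_zero
    push_cast
    field_simp
    ring
  have hiv : (-(1 / 2) : ℝ) ∈ range fun t => (F t).re :=
    mem_range_of_exists_le_of_exists_ge hFc ⟨2 * Real.pi, by rw [hF2]; norm_num⟩
      ⟨0, by rw [hF0]; norm_num⟩
  obtain ⟨t, ht⟩ := hiv
  simp only [h2] at ht
  have : (2 * n t : ℝ) = -1 := by rw [ht]; norm_num
  have h3 : (2 * n t : ℤ) = -1 := by exact_mod_cast this
  omega

/-- A continuous nonvanishing function on a closed disk has a continuous logarithm. -/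
theorem hasContLogOn_closedBall {G : ℂ → ℂ} {r : ℝ} (hr : 0 < r)
    (hG : ContinuousOn G (closedBall 0 r)) (h0 : ∀ z ∈ closedBall (0 : ℂ) r, G z ≠ 0) :
    HasContLogOn G (closedBall 0 r) := by
  let ρ : ℂ → ℂ := fun z => ((r / max r ‖z‖ : ℝ) : ℂ) * z
  have hpos : ∀ z : ℂ, 0 < max r ‖z‖ := fun z => lt_max_of_lt_left hr
  have hρ : Continuous ρ := by
    have : Continuous fun z : ℂ => r / max r ‖z‖ :=
      continuous_const.div (by fun_prop) fun z => (hpos z).ne'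
    fun_prop
  have hmem : ∀ z, ρ z ∈ closedBall (0 : ℂ) r := fun z => by
    rw [mem_closedBall_zero_iff, norm_mul, Complex.norm_real, Real.norm_of_nonneg
      (div_nonneg hr.le (hpos z).le), div_mul_eq_mul_div, div_le_iff₀ (hpos z)]
    exact mul_le_mul_of_nonneg_left (le_max_right _ _) hr.le
  have hlog := hasContLogOn_univ_of_ne_zero (hG.comp_continuous hρ hmem) fun z => h0 _ (hmem z)
  refine (hlog.mono (subset_univ _)).congr fun z hz => ?_
  have : ρ z = z := by
    rw [mem_closedBall_zero_iff] at hz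
    simp [ρ, max_eq_left hz, hr.ne']
  simp [this]

/-- A nonvanishing function on the punctured plane which is constant near infinity has a
continuous logarithm. -/
theorem hasContLogOn_compl_singleton {F : ℂ → ℂ} {c : ℂ} {R : ℝ}
    (hF : ContinuousOn F {c}ᶜ) (h0 : ∀ z ≠ c, F z ≠ 0) (h1 : ∀ z, R ≤ ‖z‖ → F z = 1) :
    HasContLogOn F {c}ᶜ := by
  classical
  let H : ℂ → ℂ := fun w => if w = 0 then 1 else F (c + w⁻¹)
  have hne : ∀ w : ℂ, w ≠ 0 → c + w⁻¹ ≠ c := fun w hw => by simpa using hw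
  have hH : Continuous H := by
    rw [continuous_iff_continuousAt]
    intro w
    by_cases hw : w = 0
    · subst hw
      have hev : ∀ᶠ w in 𝓝 (0 : ℂ), H w = 1 := by
        have hδ : (0 : ℝ) < 1 / (|R| + ‖c‖ + 1) := by positivity
        filter_upwards [ball_mem_nhds (0 : ℂ) hδ] with w hw
        by_cases hw0 : w = 0
        · simp [H, hw0]
        · simp only [H, hw0, if_false]
          apply h1
          rw [mem_ball_zero_iff, lt_div_iff₀ (by positivity)] at hw
          have hwp : 0 < ‖w‖ := norm_pos_iff.2 hw0
          have h2 : |R| + ‖c‖ + 1 < ‖w⁻¹‖ := by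
            rw [norm_inv, ← one_div, lt_div_iff₀ hwp]
            linarith
          have h3 : ‖w⁻¹‖ ≤ ‖c + w⁻¹‖ + ‖c‖ := by
            have := norm_sub_le (c + w⁻¹) c
            simpa using this
          linarith [le_abs_self R]
      exact (continuousAt_const (y := (1 : ℂ))).congr (hev.mono fun w hw => hw.symm)
    · have h2 : ContinuousAt (fun w : ℂ => F (c + w⁻¹)) w := by
        have h3 : ContinuousAt F (c + w⁻¹) :=
          hF.continuousAt (isOpen_compl_singleton.mem_nhds (hne w hw))
        have h4 : ContinuousAt (fun w : ℂ => c + w⁻¹) w :=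
          continuousAt_const.add (continuousAt_inv₀ hw)
        exact ContinuousAt.comp (f := fun w : ℂ => c + w⁻¹) h3 h4
      refine h2.congr ?_
      filter_upwards [isOpen_compl_singleton.mem_nhds hw] with v hv
      have hv0 : v ≠ 0 := hv
      simp only [H, if_neg hv0]
  have hH0 : ∀ w, H w ≠ 0 := fun w => by
    by_cases hw : w = 0
    · simp [H, hw]
    · simp only [H, hw, if_false]
      exact h0 _ (hne w hw)
  have hlog := hasContLogOn_univ_of_ne_zero hH hH0
  have hu : ContinuousOn (fun z : ℂ => (z - c)⁻¹) {c}ᶜ :=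
    (continuousOn_id.sub continuousOn_const).inv₀ fun z hz => sub_ne_zero.2 hz
  refine (hlog.comp hu (mapsTo_univ _ _)).congr fun z hz => ?_
  simp [H, sub_ne_zero.2 hz]

/-- Pasting of functions along two closed sets. -/
theorem continuousOn_ite_of_isClosed {Y : Type*} [TopologicalSpace Y] {A B S : Set X}
    [∀ x, Decidable (x ∈ A)] (hA : IsClosed A) (hB : IsClosed B) (hAB : A ∪ B = univ)
    {F₁ F₂ : X → Y} (h₁ : ContinuousOn F₁ (A ∩ S)) (h₂ : ContinuousOn F₂ (B ∩ S))
    (h : ∀ x ∈ A, x ∈ B → x ∈ S → F₁ x = F₂ x) :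
    ContinuousOn (fun x => if x ∈ A then F₁ x else F₂ x) S := by
  intro x hx
  have hS : S = (A ∩ S) ∪ (B ∩ S) := by rw [← union_inter_distrib_right, hAB, univ_inter]
  have k₁ : ∀ y ∈ A ∩ S, (if y ∈ A then F₁ y else F₂ y) = F₁ y := fun y hy => by simp [hy.1]
  have k₂ : ∀ y ∈ B ∩ S, (if y ∈ A then F₁ y else F₂ y) = F₂ y := fun y hy => by
    split_ifs with hyA
    · exact h y hyA hy.1 hy.2
    · rfl
  have aux : ∀ {C : Set X} {F : X → Y}, IsClosed C → ContinuousOn F (C ∩ S) →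
      (∀ y ∈ C ∩ S, (if y ∈ A then F₁ y else F₂ y) = F y) →
      ContinuousWithinAt (fun x => if x ∈ A then F₁ x else F₂ x) (C ∩ S) x := by
    intro C F hC hF hk
    by_cases hxC : x ∈ C
    · exact (hF x ⟨hxC, hx⟩).congr hk (hk x ⟨hxC, hx⟩)
    · have : 𝓝[C ∩ S] x = ⊥ := by
        rw [← notMem_closure_iff_nhdsWithin_eq_bot]
        exact fun hc => hxC (hC.closure_subset_iff.2 inter_subset_left hc)
      rw [ContinuousWithinAt, this]
      exact tendsto_bot
  rw [hS]
  exact (aux hA h₁ k₁).union (aux hB h₂ k₂)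

/-- A continuous logarithm on a closed set `A` extends to a continuous function that vanishes
outside a given neighborhood of `A`. -/
theorem HasContLogOn.exists_extension [NormalSpace X] {G : X → ℂ} {A O : Set X}
    (h : HasContLogOn G A) (hA : IsClosed A) (hO : IsOpen O) (hAO : A ⊆ O) :
    ∃ Λ : X → ℂ, Continuous Λ ∧ (∀ x ∈ A, Complex.exp (Λ x) = G x) ∧ ∀ x ∉ O, Λ x = 0 := by
  classical
  obtain ⟨g, hg, hgG⟩ := h
  have hdis : ∀ x ∈ A, x ∉ Oᶜ := fun x hx hx' => hx' (hAO hx)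
  have hcont : ContinuousOn (fun x => if x ∈ A then g x else 0) (A ∪ Oᶜ) := by
    have h₁ : ContinuousOn (fun x => if x ∈ A then g x else 0) A :=
      hg.congr fun x hx => if_pos hx
    have h₂ : ContinuousOn (fun x => if x ∈ A then g x else 0) Oᶜ :=
      (continuousOn_const (c := (0 : ℂ))).congr fun x hx => if_neg fun hxA => hdis x hxA hx
    exact h₁.union_of_isClosed h₂ hA hO.isClosed_compl
  obtain ⟨Λ, hΛ⟩ := ContinuousMap.exists_restrict_eq (hA.union hO.isClosed_compl)
    ⟨_, continuousOn_iff_continuous_domRestrict.1 hcont⟩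
  have hval : ∀ x ∈ A ∪ Oᶜ, Λ x = if x ∈ A then g x else 0 := fun x hx =>
    congrArg (fun k => k ⟨x, hx⟩) hΛ
  refine ⟨Λ, Λ.continuous, fun x hx => ?_, fun x hx => ?_⟩
  · rw [hval x (Or.inl hx), if_pos hx, hgG x hx]
  · rw [hval x (Or.inr hx), if_neg fun hxA => hdis x hxA hx]

end Log

theorem Topology.IsOpenEmbedding.continuousOn_invFun {Z X : Type*} [TopologicalSpace Z] [Nonempty Z]
    [TopologicalSpace X] {φ : Z → X} (hφ : IsOpenEmbedding φ) :
    ContinuousOn (Function.invFun φ) (range φ) := by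
  rintro _ ⟨z, rfl⟩
  refine ContinuousAt.continuousWithinAt ?_
  rw [ContinuousAt, ← hφ.map_nhds_eq, Function.leftInverse_invFun hφ.injective z, tendsto_map'_iff,
    (Function.leftInverse_invFun hφ.injective).comp_eq_id]
  exact tendsto_id

/-- An open set `O` is residue free if a nonvanishing function with a single puncture in `O`
which equals `1` outside `O` has a continuous logarithm near the puncture. -/
def ResidueFree {X : Type*} [TopologicalSpace X] (O : Set X) : Prop :=
  ∀ q ∈ O, ∀ G : X → ℂ, ContinuousOn G {q}ᶜ → (∀ x, x ≠ q → G x ≠ 0) → (∀ x ∉ O, G x = 1) →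
    ∃ Q ∈ 𝓝 q, HasContLogOn G (Q \ {q})

/-- A set is locally residue free if it has a residue free open neighborhood. -/
def LocResidueFree {X : Type*} [TopologicalSpace X] (K : Set X) : Prop :=
  ∃ O : Set X, IsOpen O ∧ K ⊆ O ∧ ResidueFree O

section Residue

variable {X : Type*} [TopologicalSpace X]

theorem residueFree_image_ball {φ : ℂ → X} (hφ : IsOpenEmbedding φ) (r : ℝ) :
    ResidueFree (φ '' ball 0 r) := by
  rintro _ ⟨c, hc, rfl⟩ G hG h0 h1
  have hlog : HasContLogOn (fun z => G (φ z)) {c}ᶜ := by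
    refine hasContLogOn_compl_singleton (R := r) ?_ (fun z hz => h0 _ (hφ.injective.ne hz)) ?_
    · exact hG.comp hφ.continuous.continuousOn fun z hz => hφ.injective.ne hz
    · intro z hz
      apply h1
      rw [hφ.injective.mem_set_image, mem_ball_zero_iff]
      exact not_lt.2 hz
  refine ⟨range φ, hφ.isOpen_range.mem_nhds (mem_range_self c), ?_⟩
  have := hlog.comp (u := Function.invFun φ) (B := range φ \ {φ c})
    (hφ.continuousOn_invFun.mono sdiff_subset) ?_
  · refine this.congr ?_
    rintro _ ⟨⟨z, rfl⟩, -⟩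
    simp only [Function.leftInverse_invFun hφ.injective z]
  · rintro _ ⟨⟨z, rfl⟩, hz⟩
    rw [Function.leftInverse_invFun hφ.injective z]
    rintro rfl
    exact hz rfl

theorem locResidueFree_singleton {φ : ℂ → X} (hφ : IsOpenEmbedding φ) :
    LocResidueFree {φ 0} :=
  ⟨φ '' ball 0 1, hφ.isOpenMap _ isOpen_ball, by
    rw [singleton_subset_iff]; exact mem_image_of_mem _ (mem_ball_self one_pos),
    residueFree_image_ball hφ 1⟩

theorem isClosed_image_closedBall [T2Space X] {φ : ℂ → X} (hφ : IsOpenEmbedding φ) (r : ℝ) :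
    IsClosed (φ '' closedBall 0 r) :=
  ((isCompact_closedBall _ _).image hφ.continuous).isClosed

theorem mem_image_sphere_of_mem_of_notMem {X : Type*} {φ : ℂ → X} {r : ℝ} {x : X}
    (h : x ∈ φ '' closedBall 0 r) (h' : x ∈ (φ '' ball 0 r)ᶜ) : x ∈ φ '' sphere 0 r := by
  obtain ⟨z, hz, rfl⟩ := h
  refine ⟨z, ?_, rfl⟩
  rw [mem_sphere_zero_iff_norm]
  refine le_antisymm (mem_closedBall_zero_iff.1 hz) (not_lt.1 fun hlt => h' ⟨z, ?_, rfl⟩)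
  exact mem_ball_zero_iff.2 hlt

theorem image_closedBall_union_compl {X : Type*} (φ : ℂ → X) (r : ℝ) :
    φ '' closedBall 0 r ∪ (φ '' ball 0 r)ᶜ = univ :=
  eq_univ_of_forall fun x => by
    by_cases hx : x ∈ φ '' ball 0 r
    · exact Or.inl (image_mono ball_subset_closedBall hx)
    · exact Or.inr hx

/-- A nonvanishing function outside a disk which is `1` off a residue free set containing the disk
has a continuous logarithm on the boundary of the disk. -/
theorem ResidueFree.hasContLogOn_image_sphere [T2Space X] {O : Set X} (hO : ResidueFree O)
    {φ : ℂ → X} (hφ : IsOpenEmbedding φ) {r : ℝ} (hr : 0 < r) (hrO : φ '' closedBall 0 r ⊆ O)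
    {H : X → ℂ} (hH : ContinuousOn H (φ '' ball 0 r)ᶜ) (h0 : ∀ x ∉ φ '' ball 0 r, H x ≠ 0)
    (h1 : ∀ x ∉ O, H x = 1) : HasContLogOn H (φ '' sphere 0 r) := by
  classical
  have hχ : ∀ z, Function.invFun φ (φ z) = z := Function.leftInverse_invFun hφ.injective
  set χ := Function.invFun φ
  have hχc : ContinuousOn χ (range φ) := hφ.continuousOn_invFun
  let ret : ℂ → X := fun z => φ (((r / ‖z‖ : ℝ) : ℂ) * z)
  have hret : ContinuousOn ret {0}ᶜ := by
    refine hφ.continuous.comp_continuousOn ?_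
    have : ContinuousOn (fun z : ℂ => r / ‖z‖) {0}ᶜ :=
      continuousOn_const.div continuous_norm.continuousOn fun z hz => norm_ne_zero_iff.2 hz
    exact (Complex.continuous_ofReal.comp_continuousOn this).mul continuousOn_id
  have hret' : ∀ z ≠ 0, ret z ∈ φ '' sphere 0 r := fun z hz => by
    refine ⟨_, ?_, rfl⟩
    rw [mem_sphere_zero_iff_norm, norm_mul, Complex.norm_real, Real.norm_of_nonneg (by positivity),
      div_mul_cancel₀ _ (norm_ne_zero_iff.2 hz)]
  have hsph : φ '' sphere 0 r ⊆ (φ '' ball 0 r)ᶜ := by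
    rintro _ ⟨z, hz, rfl⟩
    rw [mem_compl_iff, hφ.injective.mem_set_image, mem_ball_zero_iff]
    exact not_lt.2 (mem_sphere_zero_iff_norm.1 hz).ge
  let G : X → ℂ := fun x => if x ∈ φ '' closedBall 0 r then H (ret (χ x)) else H x
  have hne : ∀ x ∈ φ '' closedBall 0 r, x ≠ φ 0 → χ x ≠ 0 := by
    rintro _ ⟨z, -, rfl⟩ hz
    rw [hχ]
    rintro rfl
    exact hz rfl
  have hG : ContinuousOn G {φ 0}ᶜ := by
    refine continuousOn_ite_of_isClosed (isClosed_image_closedBall hφ r)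
      (hφ.isOpenMap _ isOpen_ball).isClosed_compl (image_closedBall_union_compl φ r) ?_
      (hH.mono inter_subset_left) ?_
    · have e1 : ContinuousOn (fun x => ret (χ x)) (φ '' closedBall 0 r ∩ {φ 0}ᶜ) :=
        hret.comp (hχc.mono (inter_subset_left.trans (image_subset_range _ _)))
          fun x hx => hne x hx.1 hx.2
      exact hH.comp e1 fun x hx => hsph (hret' _ (hne x hx.1 hx.2))
    · intro x hx hx' _
      obtain ⟨z, hz, rfl⟩ := mem_image_sphere_of_mem_of_notMem hx hx'
      rw [mem_sphere_zero_iff_norm] at hz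
      simp [ret, hχ, hz, hr.ne']
  have hG0 : ∀ x, x ≠ φ 0 → G x ≠ 0 := fun x hx => by
    simp only [G]
    split_ifs with h
    · exact h0 _ (hsph (hret' _ (hne x h hx)))
    · exact h0 x fun h2 => h (image_mono ball_subset_closedBall h2)
  have hG1 : ∀ x ∉ O, G x = 1 := fun x hx => by
    simp only [G]
    rw [if_neg fun h => hx (hrO h), h1 x hx]
  obtain ⟨Q, hQ, hlog⟩ := hO (φ 0) (hrO (mem_image_of_mem _ (mem_closedBall_self hr.le))) G hG hG0 hG1
  obtain ⟨δ, hδ, hδQ⟩ := Metric.mem_nhds_iff.1 (hφ.continuous.continuousAt.preimage_mem_nhds hQ)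
  set ε := min (δ / 2) r
  have hε0 : 0 < ε := lt_min (half_pos hδ) hr
  have hnorm : ∀ z ∈ sphere (0 : ℂ) r, ‖((ε / r : ℝ) : ℂ) * z‖ = ε := fun z hz => by
    rw [mem_sphere_zero_iff_norm] at hz
    rw [norm_mul, Complex.norm_real, Real.norm_of_nonneg (by positivity), hz,
      div_mul_cancel₀ _ hr.ne']
  have := hlog.comp (u := fun x => φ (((ε / r : ℝ) : ℂ) * χ x)) (B := φ '' sphere 0 r) ?_ ?_
  · refine this.congr ?_
    rintro _ ⟨z, hz, rfl⟩
    simp only [hχ, G]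
    rw [if_pos (mem_image_of_mem _ (mem_closedBall_zero_iff.2 ((hnorm z hz).trans_le
      (min_le_right _ _))))]
    simp only [ret, hnorm z hz]
    rw [← mul_assoc, ← Complex.ofReal_mul, div_mul_div_cancel₀ hε0.ne', div_self hr.ne']
    simp
  · exact hφ.continuous.comp_continuousOn (continuousOn_const.mul
      (hχc.mono (image_subset_range _ _)))
  · rintro _ ⟨z, hz, rfl⟩
    simp only [hχ]
    refine ⟨hδQ ?_, fun h => ?_⟩
    · rw [mem_ball_zero_iff, hnorm z hz]
      exact (min_le_left _ _).trans_lt (half_lt_self hδ)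
    · have := hnorm z hz
      rw [hφ.injective h, norm_zero] at this
      exact hε0.ne this

theorem hasContLogOn_image_closedBall {φ : ℂ → X} (hφ : IsOpenEmbedding φ) {r : ℝ}
    (hr : 0 < r) {G : X → ℂ} (hG : ContinuousOn G (φ '' closedBall 0 r))
    (h0 : ∀ x ∈ φ '' closedBall 0 r, G x ≠ 0) : HasContLogOn G (φ '' closedBall 0 r) := by
  have hlog : HasContLogOn (fun z => G (φ z)) (closedBall 0 r) :=
    hasContLogOn_closedBall hr (hG.comp hφ.continuous.continuousOn (mapsTo_image _ _))
      fun z hz => h0 _ (mem_image_of_mem _ hz)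
  have hχ : ∀ z, Function.invFun φ (φ z) = z := Function.leftInverse_invFun hφ.injective
  refine (hlog.comp (u := Function.invFun φ)
    (hφ.continuousOn_invFun.mono (image_subset_range _ _)) ?_).congr ?_
  · rintro _ ⟨z, hz, rfl⟩
    rwa [hχ]
  · rintro _ ⟨z, hz, rfl⟩
    simp only [hχ]

theorem continuousOn_ite_one {G : X → ℂ} {P₁ P₂ S T : Set X} [∀ x, Decidable (x ∈ P₁)]
    (hP₁ : IsOpen P₁) (hP₂ : IsOpen P₂) (hP : Disjoint P₁ P₂)
    (hG : ContinuousOn G T) (hT : P₁ᶜ ∩ S ⊆ T) (h1 : ∀ x ∈ S, x ∉ P₁ → x ∉ P₂ → G x = 1) :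
    ContinuousOn (fun x => if x ∈ P₁ then 1 else G x) S := by
  have hcover : P₁ᶜ ∪ P₂ᶜ = univ := by rw [← compl_inter, hP.inter_eq, compl_empty]
  refine (continuousOn_ite_of_isClosed hP₁.isClosed_compl hP₂.isClosed_compl hcover (hG.mono hT)
    (continuousOn_const (c := (1 : ℂ))) fun x hx hx' hxS => h1 x hxS hx hx').congr fun x _ => ?_
  by_cases hx : x ∈ P₁ <;> simp [hx]

theorem ite_one_mul_ite_one {X : Type*} {G : X → ℂ} {P₁ P₂ : Set X} [∀ x, Decidable (x ∈ P₁)]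
    [∀ x, Decidable (x ∈ P₂)] (hP : Disjoint P₁ P₂) {x : X} (h1 : x ∉ P₁ → x ∉ P₂ → G x = 1) :
    (if x ∈ P₂ then 1 else G x) * (if x ∈ P₁ then 1 else G x) = G x := by
  by_cases h₁ : x ∈ P₁
  · simp [h₁, disjoint_left.1 hP h₁]
  · by_cases h₂ : x ∈ P₂
    · simp [h₁, h₂]
    · simp [h₁, h₂, h1 h₁ h₂]

theorem exists_hasContLogOn_of_mem_left [T2Space X] [NormalSpace X] {O₁ O₂ P₁ P₂ : Set X}
    (hO₁ : ResidueFree O₁) (hO₂ : ResidueFree O₂) (hP₁ : IsOpen P₁) (hP₂ : IsOpen P₂)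
    (hP : Disjoint P₁ P₂) (hPO₁ : P₁ ⊆ O₁) (hPO₂ : P₂ ⊆ O₂) {φ : ℂ → X} (hφ : IsOpenEmbedding φ)
    {r : ℝ} (hr : 0 < r) (hr₁ : φ '' closedBall 0 r ⊆ O₁) (hr₂ : φ '' closedBall 0 r ⊆ O₂)
    {q : X} (hq : q ∈ P₁) (hqr : q ∉ φ '' closedBall 0 r) {G : X → ℂ} (hG : ContinuousOn G {q}ᶜ)
    (h0 : ∀ x, x ≠ q → G x ≠ 0) (h1 : ∀ x, x ∉ P₁ → x ∉ P₂ → x ∉ φ '' ball 0 r → G x = 1) :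
    ∃ Q ∈ 𝓝 q, HasContLogOn G (Q \ {q}) := by
  classical
  have hclosed := isClosed_image_closedBall hφ r
  have hopen : IsOpen (φ '' ball 0 r) := hφ.isOpenMap _ isOpen_ball
  have hsub : φ '' ball 0 r ⊆ φ '' closedBall 0 r := image_mono ball_subset_closedBall
  have hsphere : φ '' sphere 0 r ⊆ φ '' closedBall 0 r := image_mono sphere_subset_closedBall
  have hsph : φ '' sphere 0 r ⊆ (φ '' ball 0 r)ᶜ := by
    rintro _ ⟨z, hz, rfl⟩
    rw [mem_compl_iff, hφ.injective.mem_set_image, mem_ball_zero_iff]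
    exact not_lt.2 (mem_sphere_zero_iff_norm.1 hz).ge
  have hβq : ∀ x ∈ φ '' closedBall 0 r, x ≠ q := fun x hx h => hqr (h ▸ hx)
  have hG₂ : HasContLogOn (fun x => if x ∈ P₁ then 1 else G x) (φ '' sphere 0 r) := by
    refine hO₂.hasContLogOn_image_sphere hφ hr hr₂ ?_ ?_ ?_
    · refine continuousOn_ite_one hP₁ hP₂ hP hG ?_ fun x hx h h' => h1 x h h' hx
      rintro x ⟨hx, -⟩ rfl
      exact hx hq
    · intro x _
      split_ifs with h
      · exact one_ne_zero
      · exact h0 x fun hxq => h (hxq ▸ hq)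
    · intro x hx
      split_ifs with h
      · rfl
      · exact h1 x h (fun h2 => hx (hPO₂ h2)) fun h2 => hx (hr₂ (hsub h2))
  have hGβ : HasContLogOn G (φ '' closedBall 0 r) :=
    hasContLogOn_image_closedBall hφ hr (hG.mono hβq) fun x hx => h0 x (hβq x hx)
  have hG₁ : HasContLogOn (fun x => if x ∈ P₂ then 1 else G x) (φ '' sphere 0 r) := by
    refine ((hGβ.mono hsphere).div hG₂).congr fun x hx => ?_
    have hmul := ite_one_mul_ite_one (G := G) hP (x := x) fun h h' => h1 x h h' (hsph hx)
    have hne : (if x ∈ P₁ then 1 else G x) ≠ 0 := by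
      split_ifs with h
      · exact one_ne_zero
      · exact h0 x fun hxq => h (hxq ▸ hq)
    exact eq_div_of_mul_eq hne hmul
  obtain ⟨Λ, hΛ, hΛG, -⟩ := hG₁.exists_extension
    (((isCompact_sphere _ _).image hφ.continuous).isClosed) isOpen_univ (subset_univ _)
  obtain ⟨Q, hQ, hlog⟩ := hO₁ q (hPO₁ hq) (fun x => if x ∈ φ '' closedBall 0 r then
      Complex.exp (Λ x) else if x ∈ P₂ then 1 else G x) (by
    refine continuousOn_ite_of_isClosed hclosed hopen.isClosed_compl
      (image_closedBall_union_compl φ r) (Complex.continuous_exp.comp hΛ).continuousOn ?_ ?_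
    · refine continuousOn_ite_one hP₂ hP₁ hP.symm hG ?_ fun x hx h h' => h1 x h' h hx.1
      exact inter_subset_right.trans inter_subset_right
    · intro x hx hx' _
      exact hΛG x (mem_image_sphere_of_mem_of_notMem hx hx')) (by
    intro x hx
    split_ifs
    · exact Complex.exp_ne_zero _
    · exact one_ne_zero
    · exact h0 x hx) (by
    intro x hx
    rw [if_neg fun h => hx (hr₁ h)]
    split_ifs with h
    · rfl
    · exact h1 x (fun h2 => hx (hPO₁ h2)) h fun h2 => hx (hr₁ (hsub h2)))
  refine ⟨Q ∩ (P₁ ∩ (φ '' closedBall 0 r)ᶜ), inter_mem hQ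
    ((hP₁.inter hclosed.isOpen_compl).mem_nhds ⟨hq, hqr⟩), ?_⟩
  refine (hlog.mono (sdiff_subset_sdiff_left inter_subset_left)).congr fun x hx => ?_
  rw [if_neg hx.1.2.2, if_neg (disjoint_left.1 hP hx.1.2.1)]

theorem exists_hasContLogOn_of_mem_ball [T2Space X] [NormalSpace X] {O₀ O₁ O₂ P₁ P₂ : Set X}
    (hO₀o : IsOpen O₀) (hO₀ : ResidueFree O₀) (hO₁ : ResidueFree O₁) (hO₂ : ResidueFree O₂)
    (hP₁ : IsOpen P₁) (hP₂ : IsOpen P₂)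
    (hP : Disjoint P₁ P₂) (hPO₁ : P₁ ⊆ O₁) (hPO₂ : P₂ ⊆ O₂) {φ : ℂ → X} (hφ : IsOpenEmbedding φ)
    {r : ℝ} (hr : 0 < r) (hr₀ : φ '' closedBall 0 r ⊆ O₀)
    (hr₁ : φ '' closedBall 0 r ⊆ O₁) (hr₂ : φ '' closedBall 0 r ⊆ O₂)
    {q : X} (hq : q ∈ φ '' ball 0 r) {G : X → ℂ} (hG : ContinuousOn G {q}ᶜ)
    (h0 : ∀ x, x ≠ q → G x ≠ 0) (h1 : ∀ x, x ∉ P₁ → x ∉ P₂ → x ∉ φ '' ball 0 r → G x = 1) :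
    ∃ Q ∈ 𝓝 q, HasContLogOn G (Q \ {q}) := by
  classical
  have hclosed := isClosed_image_closedBall hφ r
  have hopen : IsOpen (φ '' ball 0 r) := hφ.isOpenMap _ isOpen_ball
  have hsub : φ '' ball 0 r ⊆ φ '' closedBall 0 r := image_mono ball_subset_closedBall
  have hsphere : φ '' sphere 0 r ⊆ φ '' closedBall 0 r := image_mono sphere_subset_closedBall
  have hsph : φ '' sphere 0 r ⊆ (φ '' ball 0 r)ᶜ := by
    rintro _ ⟨z, hz, rfl⟩
    rw [mem_compl_iff, hφ.injective.mem_set_image, mem_ball_zero_iff]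
    exact not_lt.2 (mem_sphere_zero_iff_norm.1 hz).ge
  have hβq : ∀ x ∉ φ '' ball 0 r, x ≠ q := fun x hx h => hx (h ▸ hq)
  have key : ∀ {P P' O : Set X}, IsOpen P → IsOpen P' → Disjoint P P' → P' ⊆ O → ResidueFree O →
      φ '' closedBall 0 r ⊆ O → (∀ x, x ∉ P → x ∉ P' → x ∉ φ '' ball 0 r → G x = 1) →
      HasContLogOn (fun x => if x ∈ P then 1 else G x) (φ '' sphere 0 r) := by
    intro P P' O hPo hPo' hPP hPO hO hrO h1
    refine hO.hasContLogOn_image_sphere hφ hr hrO ?_ ?_ ?_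
    · exact continuousOn_ite_one hPo hPo' hPP hG (fun x hx => hβq x hx.2)
        fun x hx h h' => h1 x h h' hx
    · intro x hx
      split_ifs with h
      · exact one_ne_zero
      · exact h0 x (hβq x hx)
    · intro x hx
      split_ifs with h
      · rfl
      · exact h1 x h (fun h2 => hx (hPO h2)) fun h2 => hx (hrO (hsub h2))
  have hlogG : HasContLogOn G (φ '' sphere 0 r) := by
    refine ((key hP₂ hP₁ hP.symm hPO₁ hO₁ hr₁ fun x h h' h2 => h1 x h' h h2).mul
      (key hP₁ hP₂ hP hPO₂ hO₂ hr₂ h1)).congr fun x hx => ?_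
    exact (ite_one_mul_ite_one (G := G) hP (x := x) fun h h' => h1 x h h' (hsph hx)).symm
  obtain ⟨Λ, hΛ, hΛG, hΛ0⟩ := hlogG.exists_extension
    (((isCompact_sphere _ _).image hφ.continuous).isClosed) hO₀o (hsphere.trans hr₀)
  obtain ⟨Q, hQ, hlog⟩ := hO₀ q (hr₀ (hsub hq)) (fun x => if x ∈ φ '' closedBall 0 r then
      G x else Complex.exp (Λ x)) (by
    refine continuousOn_ite_of_isClosed hclosed hopen.isClosed_compl
      (image_closedBall_union_compl φ r) (hG.mono inter_subset_right)
      (Complex.continuous_exp.comp hΛ).continuousOn ?_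
    · intro x hx hx' _
      exact (hΛG x (mem_image_sphere_of_mem_of_notMem hx hx')).symm) (by
    intro x hx
    split_ifs
    · exact h0 x hx
    · exact Complex.exp_ne_zero _) (by
    intro x hx
    rw [if_neg fun h => hx (hr₀ h), hΛ0 x hx, Complex.exp_zero])
  refine ⟨Q ∩ φ '' ball 0 r, inter_mem hQ (hopen.mem_nhds hq), ?_⟩
  refine (hlog.mono (sdiff_subset_sdiff_left inter_subset_left)).congr fun x hx => ?_
  rw [if_pos (hsub hx.1.2)]

/-- The union of two closed locally residue free sets meeting in a single point is locally
residue free. -/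
theorem LocResidueFree.union [T2Space X] [NormalSpace X] {K₁ K₂ : Set X} (hK₁ : IsClosed K₁)
    (hK₂ : IsClosed K₂) {φ : ℂ → X} (hφ : IsOpenEmbedding φ) (hK : K₁ ∩ K₂ = {φ 0})
    (h₁ : LocResidueFree K₁) (h₂ : LocResidueFree K₂) : LocResidueFree (K₁ ∪ K₂) := by
  obtain ⟨O₀, hO₀o, hO₀p, hO₀⟩ := locResidueFree_singleton hφ
  obtain ⟨O₁, hO₁o, hKO₁, hO₁⟩ := h₁
  obtain ⟨O₂, hO₂o, hKO₂, hO₂⟩ := h₂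
  have hp : φ 0 ∈ K₁ ∩ K₂ := hK ▸ mem_singleton _
  have hnhd : φ ⁻¹' (O₀ ∩ (O₁ ∩ O₂)) ∈ 𝓝 (0 : ℂ) :=
    hφ.continuous.continuousAt.preimage_mem_nhds ((hO₀o.inter (hO₁o.inter hO₂o)).mem_nhds
      ⟨hO₀p rfl, hKO₁ hp.1, hKO₂ hp.2⟩)
  obtain ⟨ρ, hρ, hρO⟩ := Metric.mem_nhds_iff.1 hnhd
  set r₁ := ρ / 2 with hr₁
  have hr₁0 : 0 < r₁ := half_pos hρ
  have hballo : IsOpen (φ '' ball 0 r₁) := hφ.isOpenMap _ isOpen_ball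
  have hdisj : Disjoint (K₁ \ φ '' ball 0 r₁) (K₂ \ φ '' ball 0 r₁) := by
    rw [disjoint_left]
    intro x hx hx'
    have : x ∈ ({φ 0} : Set X) := hK ▸ ⟨hx.1, hx'.1⟩
    rw [mem_singleton_iff] at this
    exact hx.2 (this ▸ mem_image_of_mem _ (mem_ball_self hr₁0))
  obtain ⟨P₁, P₂, hP₁, hP₂, hKP₁, hKP₂, hP⟩ := normal_separation
    (hK₁.sdiff hballo) (hK₂.sdiff hballo) hdisj
  refine ⟨(P₁ ∩ O₁) ∪ (P₂ ∩ O₂) ∪ φ '' ball 0 r₁,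
    ((hP₁.inter hO₁o).union (hP₂.inter hO₂o)).union hballo, ?_, ?_⟩
  · rintro x (hx | hx) <;> by_cases hxb : x ∈ φ '' ball 0 r₁
    · exact Or.inr hxb
    · exact Or.inl (Or.inl ⟨hKP₁ ⟨hx, hxb⟩, hKO₁ hx⟩)
    · exact Or.inr hxb
    · exact Or.inl (Or.inr ⟨hKP₂ ⟨hx, hxb⟩, hKO₂ hx⟩)
  · intro q hq G hG h0 h1
    obtain ⟨r, hr₁r, hrρ, hqr⟩ : ∃ r, r₁ ≤ r ∧ r < ρ ∧ q ∉ φ '' sphere 0 r := by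
      by_cases hqs : q ∈ φ '' sphere 0 r₁
      · refine ⟨ρ * (3 / 4), by linarith, by linarith, ?_⟩
        rintro ⟨z, hz, rfl⟩
        rw [hφ.injective.mem_set_image] at hqs
        rw [mem_sphere_zero_iff_norm] at hz hqs
        linarith
      · exact ⟨r₁, le_rfl, half_lt_self hρ, hqs⟩
    have hr0 : 0 < r := hr₁0.trans_le hr₁r
    have hcb : φ '' closedBall 0 r ⊆ O₀ ∩ (O₁ ∩ O₂) :=
      image_subset_iff.2 ((closedBall_subset_ball hrρ).trans hρO)
    have hb : φ '' ball 0 r₁ ⊆ φ '' ball 0 r := image_mono (ball_subset_ball hr₁r)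
    have hdis : Disjoint (P₁ ∩ O₁) (P₂ ∩ O₂) := hP.mono inter_subset_left inter_subset_left
    have h1' : ∀ x, x ∉ P₁ ∩ O₁ → x ∉ P₂ ∩ O₂ → x ∉ φ '' ball 0 r → G x = 1 := by
      intro x h h' h2
      apply h1
      rintro ((hx | hx) | hx)
      · exact h hx
      · exact h' hx
      · exact h2 (hb hx)
    by_cases hqb : q ∈ φ '' ball 0 r
    · exact exists_hasContLogOn_of_mem_ball hO₀o hO₀ hO₁ hO₂ (hP₁.inter hO₁o) (hP₂.inter hO₂o) hdis
        inter_subset_right inter_subset_right hφ hr0 (hcb.trans inter_subset_left)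
        (hcb.trans (inter_subset_right.trans inter_subset_left))
        (hcb.trans (inter_subset_right.trans inter_subset_right)) hqb hG h0 h1'
    · have hqc : q ∉ φ '' closedBall 0 r := fun h =>
        hqr (mem_image_sphere_of_mem_of_notMem h hqb)
      rcases hq with (hq | hq) | hq
      · exact exists_hasContLogOn_of_mem_left hO₁ hO₂ (hP₁.inter hO₁o) (hP₂.inter hO₂o) hdis
          inter_subset_right inter_subset_right hφ hr0
          (hcb.trans (inter_subset_right.trans inter_subset_left))
          (hcb.trans (inter_subset_right.trans inter_subset_right)) hq hqc hG h0 h1'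
      · exact exists_hasContLogOn_of_mem_left hO₂ hO₁ (hP₂.inter hO₂o) (hP₁.inter hO₁o) hdis.symm
          inter_subset_right inter_subset_right hφ hr0
          (hcb.trans (inter_subset_right.trans inter_subset_right))
          (hcb.trans (inter_subset_right.trans inter_subset_left)) hq hqc hG h0
          fun x h h' => h1' x h' h
      · exact absurd (hb hq) hqb

end Residue

section LogUnion

variable {X : Type*} [TopologicalSpace X]

theorem hasContLogOn_singleton {h : X → ℂ} {x : X} (hx : h x ≠ 0) : HasContLogOn h {x} :=
  ⟨fun _ => Complex.log (h x), continuousOn_const, fun y hy => by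
    rw [mem_singleton_iff.1 hy, Complex.exp_log hx]⟩

/-- Continuous logarithms on two closed sets with at most one common point can be pasted. -/
theorem HasContLogOn.union {h : X → ℂ} {K₁ K₂ : Set X} (hK₁ : IsClosed K₁) (hK₂ : IsClosed K₂)
    (hK : (K₁ ∩ K₂).Subsingleton) (h₁ : HasContLogOn h K₁) (h₂ : HasContLogOn h K₂) :
    HasContLogOn h (K₁ ∪ K₂) := by
  classical
  obtain ⟨g₁, hg₁, hgh₁⟩ := h₁
  obtain ⟨g₂, hg₂, hgh₂⟩ := h₂
  obtain ⟨c, hc, hc1⟩ : ∃ c : ℂ, (∀ p ∈ K₁ ∩ K₂, g₁ p = g₂ p + c) ∧ Complex.exp c = 1 := by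
    rcases hK.eq_empty_or_singleton with hK | ⟨p, hp⟩
    · exact ⟨0, by simp [hK], Complex.exp_zero⟩
    · have hpm : p ∈ K₁ ∩ K₂ := hp ▸ mem_singleton p
      refine ⟨g₁ p - g₂ p, fun q hq => ?_, ?_⟩
      · rw [hp, mem_singleton_iff] at hq
        rw [hq]
        ring
      · rw [Complex.exp_sub, hgh₁ p hpm.1, hgh₂ p hpm.2, div_self]
        rw [← hgh₁ p hpm.1]
        exact Complex.exp_ne_zero _
  refine ⟨fun x => if x ∈ K₁ then g₁ x else g₂ x + c, ?_, ?_⟩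
  · have k₁ : ContinuousOn (fun x => if x ∈ K₁ then g₁ x else g₂ x + c) K₁ :=
      hg₁.congr fun x hx => if_pos hx
    have k₂ : ContinuousOn (fun x => if x ∈ K₁ then g₁ x else g₂ x + c) K₂ := by
      refine (hg₂.add (continuousOn_const (c := c))).congr fun x hx => ?_
      split_ifs with hx'
      · exact hc x ⟨hx', hx⟩
      · rfl
    exact k₁.union_of_isClosed k₂ hK₁ hK₂
  · intro x hx
    dsimp only
    split_ifs with hxK
    · exact hgh₁ x hxK
    · rw [Complex.exp_add, hc1, mul_one, hgh₂ x (hx.resolve_left hxK)]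

/-- A continuous logarithm on a closed subset exists on a neighborhood. -/
theorem HasContLogOn.exists_isOpen [NormalSpace X] {h : X → ℂ} {K L : Set X} (hK : IsClosed K)
    (hL : ContinuousOn h L) (hlog : HasContLogOn h K) :
    ∃ O, IsOpen O ∧ K ∩ L ⊆ O ∧ HasContLogOn h (O ∩ L) := by
  obtain ⟨Λ, hΛ, hΛh, -⟩ := hlog.exists_extension hK isOpen_univ (subset_univ _)
  have hF : ContinuousOn (fun x => h x * Complex.exp (-Λ x)) L :=
    hL.mul (Complex.continuous_exp.comp hΛ.neg).continuousOn
  obtain ⟨O, hO, hOL⟩ := continuousOn_iff'.1 hF (ball 1 1) isOpen_ball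
  refine ⟨O, hO, fun x hx => ?_, ?_⟩
  · have : x ∈ (fun x => h x * Complex.exp (-Λ x)) ⁻¹' ball 1 1 ∩ L := by
      refine ⟨?_, hx.2⟩
      rw [mem_preimage, ← hΛh x hx.1, ← Complex.exp_add, add_neg_cancel, Complex.exp_zero]
      exact mem_ball_self one_pos
    rw [hOL] at this
    exact this.1
  · have h1 : HasContLogOn (fun x => h x * Complex.exp (-Λ x)) (O ∩ L) := by
      refine hasContLogOn_of_norm_sub_one_lt (hF.mono inter_subset_right) fun x hx => ?_
      rw [← hOL] at hx
      exact mem_ball_iff_norm.1 hx.1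
    have h2 : HasContLogOn (fun x => Complex.exp (Λ x)) (O ∩ L) :=
      ⟨Λ, hΛ.continuousOn, fun _ _ => rfl⟩
    refine (h1.mul h2).congr fun x _ => ?_
    rw [mul_assoc, ← Complex.exp_add, neg_add_cancel, Complex.exp_zero, mul_one]

/-- Neighborhoods of components of a compact set contain relatively clopen neighborhoods. -/
theorem exists_isClosed_of_connectedComponentIn_subset [T2Space X] {L O : Set X} (hL : IsCompact L)
    {e : X} (he : e ∈ L) (hO : IsOpen O) (heO : connectedComponentIn L e ⊆ O) :
    ∃ N, IsClosed N ∧ IsClosed (L \ N) ∧ connectedComponentIn L e ⊆ N ∧ N ⊆ O ∩ L := by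
  have : CompactSpace L := isCompact_iff_compactSpace.1 hL
  rw [connectedComponentIn_eq_image he] at heO ⊢
  have hdir : Directed (· ⊇ ·) fun s : { s : Set L // IsClopen s ∧ (⟨e, he⟩ : L) ∈ s } =>
      (s : Set L) := by
    intro s t
    exact ⟨⟨s ∩ t, s.2.1.inter t.2.1, s.2.2, t.2.2⟩, inter_subset_left, inter_subset_right⟩
  have : Nonempty { s : Set L // IsClopen s ∧ (⟨e, he⟩ : L) ∈ s } := ⟨⟨univ, isClopen_univ, trivial⟩⟩
  obtain ⟨⟨N, hN, heN⟩, hNO⟩ := exists_subset_nhds_of_isCompact hdir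
    (fun s => s.2.1.1.isCompact) (U := Subtype.val ⁻¹' O) (by
      intro x hx
      rw [← connectedComponent_eq_iInter_isClopen] at hx
      exact (hO.preimage continuous_subtype_val).mem_nhds (heO (mem_image_of_mem _ hx)))
  have hLc := hL.isClosed
  refine ⟨Subtype.val '' N, hLc.isClosedMap_subtype_val _ hN.1, ?_,
    image_mono (hN.connectedComponent_subset heN), ?_⟩
  · have : L \ Subtype.val '' N = Subtype.val '' Nᶜ := by
      ext x
      constructor
      · rintro ⟨hx, hx'⟩
        exact ⟨⟨x, hx⟩, fun h => hx' ⟨_, h, rfl⟩, rfl⟩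
      · rintro ⟨y, hy, rfl⟩
        refine ⟨y.2, ?_⟩
        rintro ⟨z, hz, hzy⟩
        exact hy (Subtype.ext hzy ▸ hz)
    rw [this]
    exact hLc.isClosedMap_subtype_val _ hN.2.isClosed_compl
  · rintro _ ⟨x, hx, rfl⟩
    exact ⟨hNO hx, x.2⟩

theorem isClosed_connectedComponentIn {L : Set X} (hL : IsClosed L) (e : X) :
    IsClosed (connectedComponentIn L e) := by
  by_cases he : e ∈ L
  · rw [connectedComponentIn_eq_image he]
    exact hL.isClosedMap_subtype_val _ isClosed_connectedComponent
  · rw [connectedComponentIn_eq_empty he]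
    exact isClosed_empty

/-- A function with a continuous logarithm on every component of a compact set has a continuous
logarithm on the whole set. -/
theorem hasContLogOn_of_connectedComponentIn [T2Space X] [NormalSpace X] {L : Set X}
    (hL : IsCompact L) {h : X → ℂ} (hh : ContinuousOn h L)
    (hlog : ∀ e ∈ L, HasContLogOn h (connectedComponentIn L e)) : HasContLogOn h L := by
  suffices ∃ T, IsClosed T ∧ IsClosed (L \ T) ∧ L ∩ L ⊆ T ∧ T ⊆ L ∧ HasContLogOn h T by
    obtain ⟨T, -, -, hLT, -, hT⟩ := this
    exact hT.mono (by rwa [inter_self] at hLT)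
  refine hL.induction_on (p := fun s => ∃ T, IsClosed T ∧ IsClosed (L \ T) ∧ s ∩ L ⊆ T ∧ T ⊆ L ∧
    HasContLogOn h T) ?_ ?_ ?_ ?_
  · exact ⟨∅, isClosed_empty, by simpa using hL.isClosed, by simp, empty_subset _,
      ⟨fun _ => 0, continuousOn_const, by simp⟩⟩
  · rintro s t hst ⟨T, h1, h2, h3, h4⟩
    exact ⟨T, h1, h2, (inter_subset_inter_left _ hst).trans h3, h4⟩
  · rintro s t ⟨T, h1, h2, h3, h4, h5⟩ ⟨T', h1', h2', h3', h4', h5'⟩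
    have hsd : T' ∩ (L \ T) = T' \ T := by
      rw [← inter_sdiff_assoc, inter_eq_left.2 h4']
    refine ⟨T ∪ T' ∩ (L \ T), h1.union (h1'.inter h2), ?_, ?_, ?_, ?_⟩
    · rw [hsd, union_sdiff_self, ← sdiff_inter_sdiff]
      exact h2.inter h2'
    · rw [hsd, union_sdiff_self, union_inter_distrib_right]
      exact union_subset_union h3 h3'
    · exact union_subset h4 (inter_subset_left.trans h4')
    · refine h5.union h1 (h1'.inter h2) ?_ (h5'.mono inter_subset_left)
      rintro x ⟨hx, -, -, hx'⟩
      exact absurd hx hx'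
  · intro e he
    obtain ⟨O, hO, hKO, hOlog⟩ := (hlog e he).exists_isOpen
      (isClosed_connectedComponentIn hL.isClosed e) hh
    rw [inter_eq_left.2 (connectedComponentIn_subset L e)] at hKO
    obtain ⟨N, hN, hLN, heN, hNO⟩ := exists_isClosed_of_connectedComponentIn_subset hL he hO hKO
    refine ⟨N, ?_, N, hN, hLN, inter_subset_left, hNO.trans inter_subset_right, hOlog.mono hNO⟩
    refine mem_nhdsWithin.2 ⟨(L \ N)ᶜ, hLN.isOpen_compl,
      fun h => h.2 (heN (mem_connectedComponentIn he)), fun x hx => ?_⟩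
    by_contra hxN
    exact hx.1 ⟨hx.2, hxN⟩

end LogUnion

section Minimal

variable {X : Type*} [TopologicalSpace X]

theorem isPreconnected_left_of_inter_eq_singleton {K₁ K₂ : Set X} (hK₁ : IsClosed K₁)
    (hK₂ : IsClosed K₂) {x : X} (hx : K₁ ∩ K₂ = {x}) (hK : IsPreconnected (K₁ ∪ K₂)) :
    IsPreconnected K₁ := by
  have hxm : x ∈ K₁ ∩ K₂ := hx ▸ mem_singleton x
  have key : ∀ u v, IsClosed u → IsClosed v → K₁ ⊆ u ∪ v → Disjoint u v → x ∈ u → K₁ ⊆ u := by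
    intro u v hu hv huv hd hxu y hy
    rcases huv hy with h | h
    · exact h
    exfalso
    have := (isPreconnected_iff_subset_of_fully_disjoint_closed (hK₁.union hK₂)).1 hK
      ((u ∩ K₁) ∪ K₂) (v ∩ K₁) ((hu.inter hK₁).union hK₂) (hv.inter hK₁) (by
        rintro z (hz | hz)
        · rcases huv hz with h' | h'
          · exact Or.inl (Or.inl ⟨h', hz⟩)
          · exact Or.inr ⟨h', hz⟩
        · exact Or.inl (Or.inr hz)) (by
        rw [disjoint_left]
        rintro z (hz | hz) hz'
        · exact disjoint_left.1 hd hz.1 hz'.1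
        · have hzx : z ∈ ({x} : Set X) := hx ▸ ⟨hz'.2, hz⟩
          rw [mem_singleton_iff] at hzx
          exact disjoint_left.1 hd hxu (hzx ▸ hz'.1))
    rcases this with h1 | h1
    · rcases h1 (Or.inl hy) with h2 | h2
      · exact disjoint_left.1 hd h2.1 h
      · have hzx : y ∈ ({x} : Set X) := hx ▸ ⟨hy, h2⟩
        rw [mem_singleton_iff] at hzx
        exact disjoint_left.1 hd hxu (hzx ▸ h)
    · exact disjoint_left.1 hd hxu (h1 (Or.inl hxm.1)).1
  rw [isPreconnected_iff_subset_of_fully_disjoint_closed hK₁]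
  intro u v hu hv huv hd
  rcases huv hxm.1 with h | h
  · exact Or.inl (key u v hu hv huv hd h)
  · exact Or.inr (key v u hv hu (union_comm u v ▸ huv) hd.symm h)

theorem IsChain.directedOn_superset {α : Type*} {c : Set (Set α)} (hc : IsChain (· ⊆ ·) c) :
    DirectedOn (· ⊇ ·) c := fun s hs t ht =>
  (hc.total hs ht).elim (fun h => ⟨s, hs, Subset.rfl, h⟩) fun h => ⟨t, ht, h, Subset.rfl⟩

theorem isPreconnected_sInter_of_isChain [CompactSpace X] [T2Space X] {c : Set (Set X)}
    (hc : IsChain (· ⊆ ·) c) (hne : c.Nonempty) (hcl : ∀ s ∈ c, IsClosed s)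
    (hconn : ∀ s ∈ c, IsPreconnected s) : IsPreconnected (⋂₀ c) := by
  rw [isPreconnected_iff_subset_of_fully_disjoint_closed (isClosed_sInter hcl)]
  intro u v hu hv huv hd
  obtain ⟨U, V, hU, hV, huU, hvV, hUV⟩ := normal_separation hu hv hd
  have : Nonempty c := hne.to_subtype
  obtain ⟨⟨s, hs⟩, hsUV⟩ := exists_subset_nhds_of_isCompact (V := fun s : c => (s : Set X))
    hc.directedOn_superset.directed_val (fun s => (hcl s s.2).isCompact)
    (U := U ∪ V) (by
      intro x hx
      rw [← sInter_eq_iInter] at hx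
      exact (hU.union hV).mem_nhds (union_subset_union huU hvV (huv hx)))
  rcases (isPreconnected_iff_subset_of_disjoint.1 (hconn s hs)) U V hU hV hsUV
    (by rw [hUV.inter_eq, inter_empty]) with h | h
  · left
    intro x hx
    exact (huv hx).resolve_right fun hxv => disjoint_left.1 hUV (h (hx s hs)) (hvV hxv)
  · right
    intro x hx
    exact (huv hx).resolve_left fun hxv => disjoint_left.1 hUV (huU hxv) (h (hx s hs))

/-- A continuum failing a property which holds for points, is preserved under gluing along a point,
and is open, contains a nondegenerate continuum without cut points failing the property. -/
theorem exists_minimal_continuum [CompactSpace X] [T2Space X] {Q : Set X → Prop} {K₀ : Set X}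
    (hK₀ : IsClosed K₀) (hK₀c : IsConnected K₀) (hQ₀ : ¬ Q K₀)
    (hpt : ∀ x ∈ K₀, Q {x})
    (hjoin : ∀ K₁ K₂ : Set X, ∀ p, K₁ ⊆ K₀ → K₂ ⊆ K₀ → IsClosed K₁ → IsClosed K₂ →
      K₁ ∩ K₂ = {p} → Q K₁ → Q K₂ → Q (K₁ ∪ K₂))
    (hopen : ∀ K ⊆ K₀, IsClosed K → Q K → ∃ O, IsOpen O ∧ K ⊆ O ∧ ∀ K' ⊆ K₀, K' ⊆ O → Q K') :
    ∃ K ⊆ K₀, IsClosed K ∧ IsConnected K ∧ K.Nontrivial ∧ ∀ x ∈ K, IsPreconnected (K \ {x}) := by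
  obtain ⟨K, hKK₀, hmin⟩ := zorn_superset_nonempty
    {K | K ⊆ K₀ ∧ IsClosed K ∧ IsConnected K ∧ ¬ Q K} (by
      intro c hcS hc hne
      have hcl : ∀ s ∈ c, IsClosed s := fun s hs => (hcS hs).2.1
      have hsub : ⋂₀ c ⊆ K₀ := by
        obtain ⟨s, hs⟩ := hne
        exact (sInter_subset_of_mem hs).trans (hcS hs).1
      have : Nonempty c := hne.to_subtype
      refine ⟨⋂₀ c, ⟨hsub, isClosed_sInter hcl, ⟨?_, ?_⟩, fun hQ => ?_⟩,
        fun s hs => sInter_subset_of_mem hs⟩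
      · exact IsCompact.nonempty_sInter_of_directed_nonempty_isCompact_isClosed
          hc.directedOn_superset (fun s hs => (hcS hs).2.2.1.nonempty)
          (fun s hs => (hcl s hs).isCompact) hcl
      · exact isPreconnected_sInter_of_isChain hc hne hcl fun s hs => (hcS hs).2.2.1.isPreconnected
      · obtain ⟨O, hO, hIsub, hOQ⟩ := hopen _ hsub (isClosed_sInter hcl) hQ
        obtain ⟨⟨s, hs⟩, hsO⟩ := exists_subset_nhds_of_isCompact (V := fun s : c => (s : Set X))
          hc.directedOn_superset.directed_val
          (fun s => (hcl s s.2).isCompact) (U := O) (by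
            intro x hx
            rw [← sInter_eq_iInter] at hx
            exact hO.mem_nhds (hIsub hx))
        exact (hcS hs).2.2.2 (hOQ s (hcS hs).1 hsO))
    K₀ ⟨Subset.rfl, hK₀, hK₀c, hQ₀⟩
  obtain ⟨-, hKcl, hKconn, hKQ⟩ := hmin.prop
  refine ⟨K, hKK₀, hKcl, hKconn, ?_, fun x hx => ?_⟩
  · by_contra hnt
    rw [not_nontrivial_iff] at hnt
    obtain ⟨y, hy⟩ := hKconn.nonempty
    rw [hnt.eq_singleton_of_mem hy] at hKQ
    exact hKQ (hpt y (hKK₀ hy))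
  · by_contra hcut
    simp only [IsPreconnected, not_forall] at hcut
    obtain ⟨U, V, hU, hV, hUV, hKU, hKV, hne⟩ := hcut
    have hpiece : ∀ {U V : Set X}, IsOpen U → IsOpen V → K \ {x} ⊆ U ∪ V →
        ¬ (K \ {x} ∩ (U ∩ V)).Nonempty → (K \ {x} ∩ V).Nonempty →
        IsClosed (K \ (V \ {x})) ∧ K \ (V \ {x}) ⊆ K ∧
        K \ (U \ {x}) ∩ (K \ (V \ {x})) = {x} ∧ K \ (U \ {x}) ∪ (K \ (V \ {x})) = K ∧
        ¬ K ⊆ K \ (V \ {x}) := by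
      intro U V hU hV hUV hne ⟨v, hvK, hvV⟩
      refine ⟨hKcl.sdiff (hV.sdiff isClosed_singleton), sdiff_subset, ?_, ?_, ?_⟩
      · ext y
        constructor
        · rintro ⟨⟨hy, hyU⟩, -, hyV⟩
          by_contra hyx
          rcases hUV ⟨hy, hyx⟩ with h | h
          · exact hyU ⟨h, hyx⟩
          · exact hyV ⟨h, hyx⟩
        · rintro rfl
          exact ⟨⟨hx, fun h => h.2 rfl⟩, hx, fun h => h.2 rfl⟩
      · refine Subset.antisymm (union_subset sdiff_subset sdiff_subset) fun y hy => ?_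
        by_cases hyU : y ∈ U \ {x}
        · refine Or.inr ⟨hy, fun hyV => hne ⟨y, ⟨hy, hyV.2⟩, hyU.1, hyV.1⟩⟩
        · exact Or.inl ⟨hy, hyU⟩
      · intro h
        exact (h hvK.1).2 ⟨hvV, hvK.2⟩
    obtain ⟨c2, s2, i2, u2, n2⟩ := hpiece hU hV hUV hne hKV
    obtain ⟨c1, s1, i1, u1, n1⟩ := hpiece hV hU (union_comm U V ▸ hUV)
      (by rwa [inter_comm V U]) hKU
    have hq : ∀ {A B : Set X}, IsClosed A → IsClosed B → A ∩ B = {x} → A ∪ B = K → A ⊆ K →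
        ¬ K ⊆ A → Q A := by
      intro A B hA hB hi hu hs hn
      by_contra hQA
      have hxA : x ∈ A ∩ B := hi ▸ mem_singleton x
      exact hn (hmin.le_of_le ⟨hs.trans hKK₀, hA, ⟨⟨x, hxA.1⟩,
        isPreconnected_left_of_inter_eq_singleton hA hB hi (hu ▸ hKconn.isPreconnected)⟩, hQA⟩ hs)
    have h1 := hq c1 c2 i2 u2 s1 n1
    have h2 := hq c2 c1 i1 u1 s2 n2
    exact hKQ (u2 ▸ hjoin _ _ x (s1.trans hKK₀) (s2.trans hKK₀) c1 c2 i2 h1 h2)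

end Minimal

/-- A neighborhood homeomorphic to an inner product space contains the image of an open embedding
centered at the given point. -/
theorem exists_isOpenEmbedding_of_homeomorph {T E : Type*} [TopologicalSpace T]
    [NormedAddCommGroup E] [InnerProductSpace ℝ E] {y : T} {U : Set T} (hU : U ∈ 𝓝 y)
    (e : U ≃ₜ E) : ∃ ψ : E → T, IsOpenEmbedding ψ ∧ ψ 0 = y := by
  have hyU : y ∈ U := mem_of_mem_nhds hU
  have hopen : IsOpen (e.symm ⁻¹' (Subtype.val ⁻¹' interior U)) :=
    (isOpen_interior.preimage continuous_subtype_val).preimage e.symm.continuous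
  obtain ⟨δ, hδ, hball⟩ := Metric.isOpen_iff.1 hopen (e ⟨y, hyU⟩) (by
    simpa using mem_interior_iff_mem_nhds.2 hU)
  have hj : IsOpenEmbedding (OpenPartialHomeomorph.univBall (e ⟨y, hyU⟩) δ) :=
    OpenPartialHomeomorph.isOpenEmbedding _ (OpenPartialHomeomorph.univBall_source _ _)
  have hjball : ∀ w : E, OpenPartialHomeomorph.univBall (e ⟨y, hyU⟩) δ w ∈ ball (e ⟨y, hyU⟩) δ := by
    intro w
    rw [← OpenPartialHomeomorph.univBall_target _ hδ]
    exact OpenPartialHomeomorph.map_source _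
      (by rw [OpenPartialHomeomorph.univBall_source]; trivial)
  refine ⟨fun w => (e.symm (OpenPartialHomeomorph.univBall (e ⟨y, hyU⟩) δ w) : T), ?_, ?_⟩
  · refine .of_continuous_injective_isOpenMap ?_ ?_ ?_
    · exact continuous_subtype_val.comp (e.symm.continuous.comp hj.continuous)
    · exact Subtype.val_injective.comp (e.symm.injective.comp hj.injective)
    · intro W hW
      have h1 : IsOpen (e.symm '' (OpenPartialHomeomorph.univBall (e ⟨y, hyU⟩) δ '' W)) :=
        e.symm.isOpenMap _ (hj.isOpenMap _ hW)
      obtain ⟨O, hO, hOW⟩ := isOpen_induced_iff.1 h1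
      have h2 : (fun w => (e.symm (OpenPartialHomeomorph.univBall (e ⟨y, hyU⟩) δ w) : T)) '' W =
          O ∩ interior U := by
        ext t
        constructor
        · rintro ⟨w, hw, rfl⟩
          refine ⟨?_, hball (hjball w)⟩
          have : e.symm (OpenPartialHomeomorph.univBall (e ⟨y, hyU⟩) δ w) ∈ Subtype.val ⁻¹' O := by
            rw [hOW]
            exact mem_image_of_mem _ (mem_image_of_mem _ hw)
          exact this
        · rintro ⟨htO, htU⟩
          have : (⟨t, interior_subset htU⟩ : U) ∈ Subtype.val ⁻¹' O := htO
          rw [hOW] at this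
          obtain ⟨_, ⟨w, hw, rfl⟩, hwt⟩ := this
          exact ⟨w, hw, congrArg Subtype.val hwt⟩
      rw [h2]
      exact hO.inter isOpen_interior
  · simp [OpenPartialHomeomorph.univBall_apply_zero]

section OneDim

variable {T : Type*} [TopologicalSpace T] [T2Space T]

/-- A connected set missing the endpoints of an arc is either inside the arc or disjoint from it. -/
theorem IsPreconnected.subset_image_Ioo_or_disjoint {R : Set T} (hR : IsPreconnected R) {ψ : ℝ → T}
    (hψ : IsOpenEmbedding ψ) {c d : ℝ} (hc : ψ c ∉ R) (hd : ψ d ∉ R) :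
    R ⊆ ψ '' Ioo c d ∨ Disjoint R (ψ '' Icc c d) := by
  have hcl : IsClosed (ψ '' Icc c d) := (isCompact_Icc.image hψ.continuous).isClosed
  have hcover : R ⊆ ψ '' Ioo c d ∪ (ψ '' Icc c d)ᶜ := by
    intro t ht
    by_cases h : t ∈ ψ '' Icc c d
    · obtain ⟨s, hs, rfl⟩ := h
      refine Or.inl ⟨s, ⟨lt_of_le_of_ne hs.1 ?_, lt_of_le_of_ne hs.2 ?_⟩, rfl⟩
      · rintro rfl
        exact hc ht
      · rintro rfl
        exact hd ht
    · exact Or.inr h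
  rcases isPreconnected_iff_subset_of_disjoint.1 hR _ _ (hψ.isOpenMap _ isOpen_Ioo)
    hcl.isOpen_compl hcover (by
      rw [eq_empty_iff_forall_notMem]
      rintro x ⟨-, hx, hx'⟩
      exact hx' (image_mono Ioo_subset_Icc_self hx)) with h | h
  · exact Or.inl h
  · exact Or.inr (disjoint_left.2 fun x hx hx' => h hx hx')

theorem surjective_of_isPreconnected_compl_singleton {K : Type*} [TopologicalSpace K]
    [ConnectedSpace K] [Nontrivial K] (hcut : ∀ x : K, IsPreconnected ({x}ᶜ : Set K))
    [ConnectedSpace T] (hT : ∀ t : T, ∃ ψ : ℝ → T, IsOpenEmbedding ψ ∧ ψ 0 = t) {k : K → T}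
    (hk : Function.Injective k) (hdar : ∀ C : Set K, IsPreconnected C → IsPreconnected (k '' C)) :
    Function.Surjective k := by
  have hRt : ∀ t, IsPreconnected (range k \ {t}) := by
    intro t
    by_cases ht : t ∈ range k
    · obtain ⟨x, rfl⟩ := ht
      have := hdar _ (hcut x)
      rwa [image_compl_eq_range_sdiff_image hk, image_singleton] at this
    · rw [sdiff_singleton_eq_self ht, ← image_univ]
      exact hdar _ isPreconnected_univ
  have hR : IsPreconnected (range k) := by
    rw [← image_univ]
    exact hdar _ isPreconnected_univ
  by_contra hns
  have hRne : range k ≠ univ := fun h => hns (range_eq_univ.1 h)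
  have hfr : (frontier (range k)).Nonempty := by
    rw [nonempty_iff_ne_empty]
    intro h
    rcases isClopen_iff.1 (isClopen_iff_frontier_eq_empty.2 h) with h | h
    · exact (range_nonempty k).ne_empty h
    · exact hRne h
  obtain ⟨t₀, ht₀⟩ := hfr
  obtain ⟨ψ, hψ, hψ0⟩ := hT t₀
  have ht₀n : range ψ ∈ 𝓝 t₀ := hψ.isOpen_range.mem_nhds ⟨0, hψ0⟩
  rw [frontier_eq_closure_inter_closure] at ht₀
  obtain ⟨_, ⟨c₀, rfl⟩, hc₀⟩ := mem_closure_iff_nhds.1 ht₀.1 _ ht₀n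
  obtain ⟨_, ⟨c, rfl⟩, hc⟩ := mem_closure_iff_nhds.1 ht₀.2 _ ht₀n
  have hright : ∀ s t, c < s → s < t → ψ s ∈ range k → ψ t ∈ range k → False := by
    intro s t hcs hst hs ht
    have hne : ∀ u, u ≠ (s + t) / 2 → ψ u ∈ range k → ψ u ∈ range k \ {ψ ((s + t) / 2)} :=
      fun u hu hm => ⟨hm, fun h => hu (hψ.injective h)⟩
    rcases (hRt (ψ ((s + t) / 2))).subset_image_Ioo_or_disjoint hψ (c := c) (d := (s + t) / 2)
      (fun h => hc h.1) (fun h => h.2 rfl) with h | h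
    · have := h (hne t (by linarith) ht)
      rw [hψ.injective.mem_set_image] at this
      linarith [this.2]
    · exact disjoint_left.1 h (hne s (by linarith) hs)
        (mem_image_of_mem _ ⟨hcs.le, by linarith⟩)
  have hleft : ∀ s t, s < c → t < s → ψ s ∈ range k → ψ t ∈ range k → False := by
    intro s t hcs hst hs ht
    have hne : ∀ u, u ≠ (s + t) / 2 → ψ u ∈ range k → ψ u ∈ range k \ {ψ ((s + t) / 2)} :=
      fun u hu hm => ⟨hm, fun h => hu (hψ.injective h)⟩
    rcases (hRt (ψ ((s + t) / 2))).subset_image_Ioo_or_disjoint hψ (c := (s + t) / 2) (d := c)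
      (fun h => h.2 rfl) (fun h => hc h.1) with h | h
    · have := h (hne t (by linarith) ht)
      rw [hψ.injective.mem_set_image] at this
      linarith [this.1]
    · exact disjoint_left.1 h (hne s (by linarith) hs)
        (mem_image_of_mem _ ⟨by linarith, hcs.le⟩)
  have hfin : (ψ ⁻¹' range k).Finite := by
    have h1 : (ψ ⁻¹' range k ∩ Ioi c).Subsingleton := by
      rintro s ⟨hs, hcs⟩ t ⟨ht, hct⟩
      rcases lt_trichotomy s t with h | h | h
      · exact (hright s t hcs h hs ht).elim
      · exact h
      · exact (hright t s hct h ht hs).elim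
    have h2 : (ψ ⁻¹' range k ∩ Iio c).Subsingleton := by
      rintro s ⟨hs, hcs⟩ t ⟨ht, hct⟩
      rcases lt_trichotomy s t with h | h | h
      · exact (hleft t s hct h ht hs).elim
      · exact h
      · exact (hleft s t hcs h hs ht).elim
    refine (h1.finite.union h2.finite).subset fun s hs => ?_
    rcases lt_trichotomy s c with h | h | h
    · exact Or.inr ⟨hs, h⟩
    · exact absurd (h ▸ hs) hc
    · exact Or.inl ⟨hs, h⟩
  have hfin' : (range k ∩ range ψ).Finite := by
    rw [← image_preimage_eq_inter_range]
    exact hfin.image ψ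
  have hsub : range k ⊆ range k ∩ range ψ := by
    by_contra hns
    obtain ⟨z, hz, hz'⟩ := not_subset.1 hns
    obtain ⟨w, hw, hw1, hw2⟩ := hR (range ψ) (range k ∩ range ψ)ᶜ hψ.isOpen_range
      hfin'.isClosed.isOpen_compl (fun x hx => by
        by_cases h : x ∈ range ψ
        · exact Or.inl h
        · exact Or.inr fun h' => h h'.2) ⟨_, hc₀, mem_range_self _⟩ ⟨z, hz, hz'⟩
    exact hw2 ⟨hw, hw1⟩
  refine hR.infinite_of_nontrivial ?_ (hfin'.subset hsub)
  obtain ⟨a, b, hab⟩ := exists_pair_ne K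
  exact ⟨_, mem_range_self a, _, mem_range_self b, hk.ne hab⟩

theorem isPreconnected_compl_of_isOpen {K : Type*} [TopologicalSpace K] [T1Space K]
    [ConnectedSpace K] (hcut : ∀ x : K, IsPreconnected ({x}ᶜ : Set K)) {P Q : Set K} (hP : IsOpen P)
    (hQ : IsOpen Q) (hPQ : Disjoint P Q) (hPne : P.Nonempty) {x₁ x₂ : K} (hx : x₁ ≠ x₂)
    (hun : P ∪ Q = {x₁, x₂}ᶜ) : IsPreconnected Qᶜ := by
  have hx₁ : x₁ ∉ P ∪ Q := by rw [hun]; simp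
  have hx₂ : x₂ ∉ P ∪ Q := by rw [hun]; simp
  have hcov : ∀ y, y ∉ P → y ∉ Q → y = x₁ ∨ y = x₂ := by
    intro y h1 h2
    by_contra h
    have : y ∈ ({x₁, x₂}ᶜ : Set K) := by simpa using h
    rw [← hun] at this
    exact this.elim h1 h2
  have hsame : ∀ u v, IsClosed u → IsClosed v → Qᶜ ⊆ u ∪ v → Disjoint u v → x₁ ∈ u → x₂ ∈ u →
      Qᶜ ⊆ u := by
    intro u v hu hv huv hd h1 h2 y hy
    refine (huv hy).resolve_right fun hyv => ?_
    have := (isPreconnected_iff_subset_of_fully_disjoint_closed isClosed_univ).1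
      (isPreconnected_univ (α := K)) (v ∩ Qᶜ) (u ∪ Pᶜ) (hv.inter hQ.isClosed_compl)
      (hu.union hP.isClosed_compl) (by
        intro z _
        by_cases hzQ : z ∈ Q
        · exact Or.inr (Or.inr (disjoint_right.1 hPQ hzQ))
        · rcases huv hzQ with h | h
          · exact Or.inr (Or.inl h)
          · exact Or.inl ⟨h, hzQ⟩) (by
        rw [disjoint_left]
        rintro z ⟨hzv, hzQ⟩ (hz | hz)
        · exact disjoint_left.1 hd hz hzv
        · rcases hcov z hz hzQ with rfl | rfl
          · exact disjoint_left.1 hd h1 hzv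
          · exact disjoint_left.1 hd h2 hzv)
    rcases this with h | h
    · exact disjoint_left.1 hd h1 (h (mem_univ x₁)).1
    · rcases h (mem_univ y) with h' | h'
      · exact disjoint_left.1 hd h' hyv
      · rcases hcov y h' hy with rfl | rfl
        · exact disjoint_left.1 hd h1 hyv
        · exact disjoint_left.1 hd h2 hyv
  have hdiff : ∀ (u v : Set K) (a b : K), IsClosed u → IsClosed v → Qᶜ ⊆ u ∪ v → Disjoint u v →
      a ≠ b → a ∉ P → b ∈ v → b ∉ P → (∀ y, y ∉ P → y ∉ Q → y = a ∨ y = b) → P ⊆ v := by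
    intro u v a b hu hv huv hd hab haP hbv hbP hcov y hy
    by_contra hyv
    obtain ⟨w, hwa, ⟨hwP, hwv⟩, hw⟩ := hcut a (P \ v) (u ∩ Qᶜ)ᶜ (hP.sdiff hv)
      (hu.inter hQ.isClosed_compl).isOpen_compl (by
        intro z hza
        by_cases hz : z ∈ P \ v
        · exact Or.inl hz
        · refine Or.inr fun hz' => ?_
          by_cases hzP : z ∈ P
          · exact hz ⟨hzP, disjoint_left.1 hd hz'.1⟩
          · rcases hcov z hzP hz'.2 with rfl | rfl
            · exact hza rfl
            · exact disjoint_left.1 hd hz'.1 hbv)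
      ⟨y, fun h => haP (h ▸ hy), hy, hyv⟩
      ⟨b, fun h => hab (mem_singleton_iff.1 h).symm, fun h => disjoint_left.1 hd h.1 hbv⟩
    have hwQ := disjoint_left.1 hPQ hwP
    exact hw ⟨(huv hwQ).resolve_right hwv, hwQ⟩
  rw [isPreconnected_iff_subset_of_fully_disjoint_closed hQ.isClosed_compl]
  intro u v hu hv huv hd
  have hx₁P : x₁ ∉ P := fun h => hx₁ (Or.inl h)
  have hx₂P : x₂ ∉ P := fun h => hx₂ (Or.inl h)
  have huv' : Qᶜ ⊆ v ∪ u := union_comm u v ▸ huv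
  have hcov' : ∀ y, y ∉ P → y ∉ Q → y = x₂ ∨ y = x₁ := fun y h h' => (hcov y h h').symm
  obtain ⟨p, hp⟩ := hPne
  rcases huv (fun h => hx₁ (Or.inr h)) with h1 | h1 <;>
    rcases huv (fun h => hx₂ (Or.inr h)) with h2 | h2
  · exact Or.inl (hsame u v hu hv huv hd h1 h2)
  · exact (disjoint_left.1 hd (hdiff v u x₂ x₁ hv hu huv' hd.symm hx.symm hx₂P h1 hx₁P hcov' hp)
      (hdiff u v x₁ x₂ hu hv huv hd hx hx₁P h2 hx₂P hcov hp)).elim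
  · exact (disjoint_left.1 hd (hdiff v u x₁ x₂ hv hu huv' hd.symm hx hx₁P h2 hx₂P hcov hp)
      (hdiff u v x₂ x₁ hu hv huv hd hx.symm hx₂P h1 hx₁P hcov' hp)).elim
  · exact Or.inr (hsame v u hv hu huv' hd.symm h1 h2)

theorem continuous_of_isPreconnected_compl_singleton {K : Type*} [TopologicalSpace K] [T1Space K]
    [ConnectedSpace K] (hcut : ∀ x : K, IsPreconnected ({x}ᶜ : Set K))
    (hT : ∀ t : T, ∃ ψ : ℝ → T, IsOpenEmbedding ψ ∧ ψ 0 = t) {k : K → T}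
    (hk : Function.Bijective k) (hdar : ∀ C : Set K, IsPreconnected C → IsPreconnected (k '' C)) :
    Continuous k := by
  rw [continuous_iff_continuousAt]
  intro x
  obtain ⟨ψ, hψ, hψ0⟩ := hT (k x)
  rw [ContinuousAt, ← hψ0, ← hψ.map_nhds_eq, tendsto_def]
  intro s hs
  obtain ⟨ε, hε, hεs⟩ := Metric.mem_nhds_iff.1 (mem_map.1 hs)
  rw [Real.ball_eq_Ioo, zero_sub, zero_add] at hεs
  obtain ⟨x₁, hx₁⟩ := hk.2 (ψ (-ε))
  obtain ⟨x₂, hx₂⟩ := hk.2 (ψ ε)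
  have hne : x₁ ≠ x₂ := fun h => by
    have := hψ.injective (hx₁.symm.trans ((congrArg k h).trans hx₂))
    linarith
  have himg : ∀ A : Set K, ∀ t, (∀ y ∈ A, k y ≠ t) → t ∉ k '' A := by
    rintro A t h ⟨y, hy, rfl⟩
    exact h y hy rfl
  have hsep : ¬ IsPreconnected ({x₁, x₂}ᶜ : Set K) := by
    intro hpre
    have hxm : x ∈ ({x₁, x₂}ᶜ : Set K) := by
      rintro (rfl | rfl)
      · have := hψ.injective (hψ0.trans hx₁); linarith
      · have := hψ.injective (hψ0.trans hx₂); linarith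
    obtain ⟨x₃, hx₃⟩ := hk.2 (ψ (2 * ε))
    have hx₃m : x₃ ∈ ({x₁, x₂}ᶜ : Set K) := by
      rintro (rfl | rfl)
      · have := hψ.injective (hx₁.symm.trans hx₃); linarith
      · have := hψ.injective (hx₂.symm.trans hx₃); linarith
    rcases (hdar _ hpre).subset_image_Ioo_or_disjoint hψ (c := -ε) (d := ε)
      (himg _ _ fun y hy h => hy (Or.inl (hk.1 (h.trans hx₁.symm))))
      (himg _ _ fun y hy h => hy (Or.inr (hk.1 (h.trans hx₂.symm)))) with h | h
    · have := h (mem_image_of_mem _ hx₃m)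
      rw [hx₃, hψ.injective.mem_set_image] at this
      linarith [this.2]
    · refine disjoint_left.1 h (mem_image_of_mem _ hxm) ?_
      rw [← hψ0]
      exact mem_image_of_mem _ ⟨by linarith, hε.le⟩
  obtain ⟨P, Q, hP, hQ, hPQ, hPne, hQne, hun, hxP⟩ : ∃ P Q : Set K, IsOpen P ∧ IsOpen Q ∧
      Disjoint P Q ∧ P.Nonempty ∧ Q.Nonempty ∧ P ∪ Q = {x₁, x₂}ᶜ ∧ x ∈ P := by
    simp only [IsPreconnected, not_forall] at hsep
    obtain ⟨U, V, hU, hV, hUV, hKU, hKV, hne'⟩ := hsep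
    have hc : IsOpen ({x₁, x₂}ᶜ : Set K) := (toFinite _).isClosed.isOpen_compl
    have hd : Disjoint ({x₁, x₂}ᶜ ∩ U) ({x₁, x₂}ᶜ ∩ V) := by
      rw [disjoint_left]
      exact fun y h h' => hne' ⟨y, h.1, h.2, h'.2⟩
    have hu : {x₁, x₂}ᶜ ∩ U ∪ {x₁, x₂}ᶜ ∩ V = ({x₁, x₂}ᶜ : Set K) := by
      rw [← inter_union_distrib_left, inter_eq_left]
      exact hUV
    have hxm : x ∈ ({x₁, x₂}ᶜ : Set K) := by
      rintro (rfl | rfl)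
      · have := hψ.injective (hψ0.trans hx₁); linarith
      · have := hψ.injective (hψ0.trans hx₂); linarith
    rcases hUV hxm with h | h
    · exact ⟨_, _, hc.inter hU, hc.inter hV, hd, hKU, hKV, hu, hxm, h⟩
    · exact ⟨_, _, hc.inter hV, hc.inter hU, hd.symm, hKV, hKU, union_comm _ _ ▸ hu, hxm, h⟩
  have hx₁n : x₁ ∉ P ∪ Q := by rw [hun]; simp
  have hx₂n : x₂ ∉ P ∪ Q := by rw [hun]; simp
  have hR₁ := hdar _ (isPreconnected_compl_of_isOpen hcut hP hQ hPQ hPne hne hun)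
  have hR₂ := hdar _ (isPreconnected_compl_of_isOpen hcut hQ hP hPQ.symm hQne hne
    (union_comm P Q ▸ hun))
  have hm₁ : ψ (-ε) ∈ k '' Pᶜ := ⟨x₁, fun h => hx₁n (Or.inl h), hx₁⟩
  have hm₂ : ψ ε ∈ k '' Pᶜ := ⟨x₂, fun h => hx₂n (Or.inl h), hx₂⟩
  have hm0 : ψ 0 ∉ k '' Pᶜ := by
    rw [hψ0]
    rintro ⟨y, hy, hyx⟩
    exact hy (hk.1 hyx ▸ hxP)
  have hout : ∀ d, ε < |d| → ψ d ∈ k '' Pᶜ := by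
    intro d hd
    by_contra hdR
    rcases lt_abs.1 hd with h | h
    · rcases hR₂.subset_image_Ioo_or_disjoint hψ hm0 hdR with h' | h'
      · have := h' hm₁
        rw [hψ.injective.mem_set_image] at this
        linarith [this.1]
      · exact disjoint_left.1 h' hm₂ (mem_image_of_mem _ ⟨hε.le, h.le⟩)
    · rcases hR₂.subset_image_Ioo_or_disjoint hψ hdR hm0 with h' | h'
      · have := h' hm₂
        rw [hψ.injective.mem_set_image] at this
        linarith [this.2]
      · exact disjoint_left.1 h' hm₁ (mem_image_of_mem _ ⟨by linarith, by linarith⟩)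
  have hnot : ∀ d, ε < |d| → ψ d ∉ k '' Qᶜ := by
    rintro d hd ⟨y, hy, hyd⟩
    obtain ⟨z, hz, hzd⟩ := hout d hd
    have hyz : y = z := hk.1 (hyd.trans hzd.symm)
    subst hyz
    have hyu : y ∉ P ∪ Q := fun h => h.elim hz hy
    rw [hun, notMem_compl_iff] at hyu
    rcases hyu with rfl | rfl
    · rw [← hψ.injective (hx₁.symm.trans hyd), abs_neg, abs_of_pos hε] at hd
      exact lt_irrefl _ hd
    · rw [← hψ.injective (hx₂.symm.trans hyd), abs_of_pos hε] at hd
      exact lt_irrefl _ hd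
  have hxQ : x ∈ Qᶜ := disjoint_left.1 hPQ hxP
  have hsub : k '' Qᶜ ⊆ ψ '' Ioo (-(2 * ε)) (2 * ε) := by
    refine (hR₁.subset_image_Ioo_or_disjoint hψ (hnot _ ?_) (hnot _ ?_)).resolve_right fun h => ?_
    · rw [abs_neg, abs_of_pos (by linarith)]; linarith
    · rw [abs_of_pos (by linarith)]; linarith
    · refine disjoint_left.1 h (mem_image_of_mem _ hxQ) ?_
      rw [← hψ0]
      exact mem_image_of_mem _ ⟨by linarith, by linarith⟩
  filter_upwards [hP.mem_nhds hxP] with y hy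
  have hyQ : y ∈ Qᶜ := disjoint_left.1 hPQ hy
  obtain ⟨d, -, hd⟩ := hsub (mem_image_of_mem _ hyQ)
  have hdε : |d| ≤ ε := not_lt.1 fun h => hnot d h ⟨y, hyQ, hd.symm⟩
  rw [mem_preimage, ← hd]
  apply hεs
  rw [abs_le] at hdε
  refine ⟨lt_of_le_of_ne hdε.1 ?_, lt_of_le_of_ne hdε.2 ?_⟩
  · rintro rfl
    exact hx₁n (Or.inl (hk.1 (hx₁.trans hd) ▸ hy))
  · rintro rfl
    exact hx₂n (Or.inl (hk.1 (hx₂.trans hd) ▸ hy))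

end OneDim

/-- No point of a compact surface lies on the common boundary of two disjoint open sets if the
complement of their union carries no obstruction. -/
theorem false_of_mem_closure_of_mem_closure {X : Type*} [TopologicalSpace X] [CompactSpace X]
    [T2Space X] {φ : ℂ → X} (hφ : IsOpenEmbedding φ) {U V : Set X} (hU : IsOpen U) (hV : IsOpen V)
    (hUV : Disjoint U V) (heL : φ 0 ∈ (U ∪ V)ᶜ) (heU : φ 0 ∈ closure U) (heV : φ 0 ∈ closure V)
    (hres : LocResidueFree (connectedComponentIn (U ∪ V)ᶜ (φ 0)))
    (hlog : ∀ h : X → ℂ, ContinuousOn h (U ∪ V)ᶜ → (∀ x ∈ (U ∪ V)ᶜ, h x ≠ 0) →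
      HasContLogOn h (U ∪ V)ᶜ) : False := by
  classical
  obtain ⟨O, hOo, hKO, hO⟩ := hres
  have hLc : IsClosed (U ∪ V)ᶜ := (hU.union hV).isClosed_compl
  set L := (U ∪ V)ᶜ
  obtain ⟨N, hN, hLN, heN, hNO⟩ :=
    exists_isClosed_of_connectedComponentIn_subset hLc.isCompact heL hOo hKO
  have hO'o : IsOpen (O ∩ (L \ N)ᶜ) := hOo.inter hLN.isOpen_compl
  set O' := O ∩ (L \ N)ᶜ with hO'
  have hNO' : N ⊆ O' := fun x hx => ⟨(hNO hx).1, fun h => h.2 hx⟩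
  have heO' : φ 0 ∈ O' := hNO' (heN (mem_connectedComponentIn heL))
  have hχ : ∀ z, Function.invFun φ (φ z) = z := Function.leftInverse_invFun hφ.injective
  have hχc := hφ.continuousOn_invFun
  set χ := Function.invFun φ
  obtain ⟨δ, hδ, hδO⟩ := Metric.mem_nhds_iff.1
    (hφ.continuous.continuousAt.preimage_mem_nhds (hO'o.mem_nhds heO'))
  set ρ := δ / 2
  have hρ : 0 < ρ := half_pos hδ
  have hβO : φ '' closedBall 0 ρ ⊆ O' :=
    image_subset_iff.2 ((closedBall_subset_ball (half_lt_self hδ)).trans hδO)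
  have hsub : φ '' ball 0 ρ ⊆ φ '' closedBall 0 ρ := image_mono ball_subset_closedBall
  have hsphere : φ '' sphere 0 ρ ⊆ φ '' closedBall 0 ρ := image_mono sphere_subset_closedBall
  have hnhd : φ '' ball 0 (ρ / 4) ∈ 𝓝 (φ 0) :=
    (hφ.isOpenMap _ isOpen_ball).mem_nhds (mem_image_of_mem _ (mem_ball_self (by positivity)))
  obtain ⟨_, ⟨α, hα, rfl⟩, haU⟩ := mem_closure_iff_nhds.1 heU _ hnhd
  obtain ⟨_, ⟨γ, hγ, rfl⟩, hbV⟩ := mem_closure_iff_nhds.1 heV _ hnhd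
  rw [mem_ball_zero_iff] at hα hγ
  have hne : φ α ≠ φ γ := fun h => disjoint_left.1 hUV haU (h ▸ hbV)
  have hαγ : α ≠ γ := fun h => hne (congrArg φ h)
  let F : ℂ → ℂ := fun z => (z - α) / (z - γ)
  have hF : ContinuousOn F {γ}ᶜ :=
    (continuousOn_id.sub continuousOn_const).div (continuousOn_id.sub continuousOn_const)
      fun z hz => sub_ne_zero.2 hz
  have hFsphere : HasContLogOn (fun x => F (χ x)) (φ '' sphere 0 ρ) := by
    have hγs : ∀ z ∈ sphere (0 : ℂ) ρ, 3 / 4 * ρ ≤ ‖z - γ‖ := fun z hz => by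
      rw [mem_sphere_zero_iff_norm] at hz
      have := norm_sub_norm_le z γ
      linarith
    have h1 : HasContLogOn F (sphere 0 ρ) := by
      refine hasContLogOn_of_norm_sub_one_lt (hF.mono fun z hz h => ?_) fun z hz => ?_
      · rw [mem_singleton_iff] at h
        have := hγs z hz
        rw [h, sub_self, norm_zero] at this
        linarith
      · have h2 := hγs z hz
        have h3 : z - γ ≠ 0 := norm_pos_iff.1 (by linarith)
        have h4 : F z - 1 = (γ - α) / (z - γ) := by
          simp only [F]
          field_simp
          ring
        rw [h4, norm_div, div_lt_one (by linarith)]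
        have := norm_sub_le γ α
        linarith
    refine h1.comp (hχc.mono (image_subset_range _ _)) ?_
    rintro _ ⟨z, hz, rfl⟩
    rwa [hχ]
  obtain ⟨Λ, hΛ, hΛF, hΛ0⟩ := hFsphere.exists_extension
    (((isCompact_sphere _ _).image hφ.continuous).isClosed) hO'o (hsphere.trans hβO)
  let h : X → ℂ := fun x => if x ∈ φ '' closedBall 0 ρ then F (χ x) else Complex.exp (Λ x)
  have hhc : ContinuousOn h {φ γ}ᶜ := by
    refine continuousOn_ite_of_isClosed (isClosed_image_closedBall hφ ρ)
      (hφ.isOpenMap _ isOpen_ball).isClosed_compl (image_closedBall_union_compl φ ρ) ?_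
      (Complex.continuous_exp.comp hΛ).continuousOn ?_
    · refine hF.comp (hχc.mono (inter_subset_left.trans (image_subset_range _ _))) ?_
      rintro _ ⟨⟨z, -, rfl⟩, hz⟩
      rw [hχ]
      rintro rfl
      exact hz rfl
    · exact fun x hx hx' _ => (hΛF x (mem_image_sphere_of_mem_of_notMem hx hx')).symm
  have hh0 : ∀ x, x ≠ φ α → x ≠ φ γ → h x ≠ 0 := by
    intro x hxα hxγ
    simp only [h]
    split_ifs with hx
    · obtain ⟨z, -, rfl⟩ := hx
      rw [hχ]
      exact div_ne_zero (sub_ne_zero.2 fun h => hxα (h ▸ rfl)) (sub_ne_zero.2 fun h => hxγ (h ▸ rfl))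
    · exact Complex.exp_ne_zero _
  have hh1 : ∀ x ∉ O', h x = 1 := fun x hx => by
    simp only [h]
    rw [if_neg fun h' => hx (hβO h'), hΛ0 x hx, Complex.exp_zero]
  have hLα : ∀ x ∈ L, x ≠ φ α := by
    rintro _ hx rfl
    exact hx (Or.inl haU)
  have hLγ : ∀ x ∈ L, x ≠ φ γ := by
    rintro _ hx rfl
    exact hx (Or.inr hbV)
  have hhlog : HasContLogOn h N :=
    (hlog h (hhc.mono hLγ) fun x hx => hh0 x (hLα x hx) (hLγ x hx)).mono
      (hNO.trans inter_subset_right)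
  obtain ⟨Φ, hΦ, hΦh, hΦ0⟩ := hhlog.exists_extension hN hO'o hNO'
  have hexp : Continuous fun x => Complex.exp (-Φ x) := Complex.continuous_exp.comp hΦ.neg
  obtain ⟨Q, hQ, g, hg, hgG⟩ := hO (φ α)
    (hβO (mem_image_of_mem _ (mem_closedBall_zero_iff.2 (by linarith)))).1
    (fun x => if x ∈ V then 1 else h x * Complex.exp (-Φ x)) (by
      refine continuousOn_ite_one hV hU hUV.symm (hhc.mul hexp.continuousOn) ?_ ?_
      · rintro x ⟨hx, -⟩ rfl
        exact hx hbV
      · intro x _ hxV hxU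
        have hxL : x ∈ L := fun hx => hx.elim hxU hxV
        by_cases hxN : x ∈ N
        · rw [← hΦh x hxN, ← Complex.exp_add, add_neg_cancel, Complex.exp_zero]
        · have hxO : x ∉ O' := fun hx => hx.2 ⟨hxL, hxN⟩
          rw [hh1 x hxO, hΦ0 x hxO, neg_zero, Complex.exp_zero, mul_one]) (by
      intro x hx
      split_ifs with hxV
      · exact one_ne_zero
      · exact mul_ne_zero (hh0 x hx fun hxγ => hxV (hxγ ▸ hbV)) (Complex.exp_ne_zero _)) (by
      intro x hx
      have hxO : x ∉ O' := fun h => hx h.1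
      split_ifs with hxV
      · rfl
      · rw [hh1 x hxO, hΦ0 x hxO, neg_zero, Complex.exp_zero, mul_one])
  have hnear : φ ⁻¹' (Q ∩ (U ∩ φ '' ball 0 ρ)) ∈ 𝓝 α :=
    hφ.continuous.continuousAt.preimage_mem_nhds (inter_mem hQ
      ((hU.inter (hφ.isOpenMap _ isOpen_ball)).mem_nhds
        ⟨haU, mem_image_of_mem _ (mem_ball_zero_iff.2 (by linarith))⟩))
  obtain ⟨η, hη, hηQ⟩ := Metric.mem_nhds_iff.1 hnear
  have hd : 0 < ‖α - γ‖ := norm_pos_iff.2 (sub_ne_zero.2 hαγ)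
  set s := min (η / 2) (‖α - γ‖ / 2)
  have hs : 0 < s := lt_min (half_pos hη) (half_pos hd)
  have hsη : s < η := (min_le_left _ _).trans_lt (half_lt_self hη)
  have hsd : s < ‖α - γ‖ := (min_le_right _ _).trans_lt (half_lt_self hd)
  refine not_hasContLogOn_sphere hs α ?_
  have hzα : ∀ z ∈ sphere α s, z ≠ α := by
    rintro z hz rfl
    rw [mem_sphere, dist_self] at hz
    exact hs.ne hz
  have hzm : ∀ z ∈ sphere α s, z ∈ φ ⁻¹' (Q ∩ (U ∩ φ '' ball 0 ρ)) := fun z hz =>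
    hηQ (sphere_subset_closedBall.trans (closedBall_subset_ball hsη) hz)
  have hl1 : HasContLogOn (fun z => F z * Complex.exp (-Φ (φ z))) (sphere α s) := by
    refine ⟨fun z => g (φ z), hg.comp hφ.continuous.continuousOn fun z hz =>
      ⟨(hzm z hz).1, fun h => hzα z hz (hφ.injective h)⟩, fun z hz => ?_⟩
    have := hzm z hz
    rw [hgG _ ⟨this.1, fun h => hzα z hz (hφ.injective h)⟩]
    dsimp only
    rw [if_neg (disjoint_left.1 hUV this.2.1)]
    simp only [h]
    rw [if_pos (hsub this.2.2), hχ]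
  have hl2 : HasContLogOn (fun z => Complex.exp (Φ (φ z))) (sphere α s) :=
    ⟨fun z => Φ (φ z), (hΦ.comp hφ.continuous).continuousOn, fun _ _ => rfl⟩
  have hl3 : HasContLogOn (fun z : ℂ => (z - γ) / (α - γ)) (sphere α s) := by
    refine hasContLogOn_of_norm_sub_one_lt (by fun_prop) fun z hz => ?_
    have h2 : α - γ ≠ 0 := sub_ne_zero.2 hαγ
    have h3 : (z - γ) / (α - γ) - 1 = (z - α) / (α - γ) := by
      field_simp
      ring
    rw [h3, norm_div, div_lt_one hd, mem_sphere_iff_norm.1 hz]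
    exact hsd
  have hl4 : HasContLogOn (fun _ : ℂ => α - γ) (sphere α s) :=
    ⟨fun _ => Complex.log (α - γ), continuousOn_const, fun _ _ =>
      Complex.exp_log (sub_ne_zero.2 hαγ)⟩
  refine ((hl1.mul hl2).mul (hl3.mul hl4)).congr fun z hz => ?_
  have h2 : α - γ ≠ 0 := sub_ne_zero.2 hαγ
  have h3 : z - γ ≠ 0 := by
    rw [sub_ne_zero]
    rintro rfl
    rw [mem_sphere', dist_eq_norm] at hz
    exact hsd.ne' hz
  rw [mul_assoc (F z), ← Complex.exp_add, neg_add_cancel, Complex.exp_zero, mul_one,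
    div_mul_cancel₀ _ h2]
  exact (div_mul_cancel₀ _ h3).symm

/-- A nondegenerate continuum without cut points cannot be mapped injectively into a compact
connected 1-variety by a Darboux map unless it is mapped onto, and then the map is continuous. -/
theorem image_eq_and_continuousOn_of_mapsTo {X Y : Type*} [TopologicalSpace X] [T2Space X]
    [TopologicalSpace Y] {f : X → Y} (hinj : Function.Injective f)
    (hdar : ∀ C : Set X, IsPreconnected C → IsPreconnected (f '' C)) {S : Set Y}
    (hS : IsConnected S) (hS1 : IsOneVariety S) {K : Set X} (hK : IsConnected K)
    (hKn : K.Nontrivial) (hcut : ∀ x ∈ K, IsPreconnected (K \ {x})) (hKS : MapsTo f K S) :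
    f '' K = S ∧ ContinuousOn f K := by
  have := hS1.1
  have : ConnectedSpace K := isConnected_iff_connectedSpace.1 hK
  have : ConnectedSpace S := isConnected_iff_connectedSpace.1 hS
  have : Nontrivial K := hKn.coe_sort
  have hcharts : ∀ t : S, ∃ ψ : ℝ → S, IsOpenEmbedding ψ ∧ ψ 0 = t := fun t => by
    obtain ⟨U, hU, ⟨e⟩⟩ := hS1.2 t
    exact exists_isOpenEmbedding_of_homeomorph hU e
  have hk : Function.Injective (hKS.restrict f K S) := hKS.restrict_inj.2 hinj.injOn
  have hkcut : ∀ x : K, IsPreconnected ({x}ᶜ : Set K) := fun x => by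
    rw [← IsInducing.subtypeVal.isPreconnected_image]
    convert hcut x x.2 using 1
    ext y
    constructor
    · rintro ⟨z, hz, rfl⟩
      exact ⟨z.2, fun h => hz (Subtype.ext h)⟩
    · rintro ⟨hy, hyx⟩
      exact ⟨⟨y, hy⟩, fun h => hyx (congrArg Subtype.val h), rfl⟩
  have hkdar : ∀ C : Set K, IsPreconnected C → IsPreconnected (hKS.restrict f K S '' C) := by
    intro C hC
    rw [← IsInducing.subtypeVal.isPreconnected_image]
    have := hdar _ (hC.image Subtype.val continuous_subtype_val.continuousOn)
    rw [image_image] at this ⊢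
    exact this
  have hsurj := surjective_of_isPreconnected_compl_singleton hkcut hcharts hk hkdar
  have hcont := continuous_of_isPreconnected_compl_singleton hkcut hcharts ⟨hk, hsurj⟩ hkdar
  refine ⟨Subset.antisymm hKS.image_subset fun y hy => ?_, ?_⟩
  · obtain ⟨x, hx⟩ := hsurj ⟨y, hy⟩
    exact ⟨x, x.2, congrArg Subtype.val hx⟩
  · rw [continuousOn_iff_continuous_domRestrict]
    exact continuous_subtype_val.comp hcont

theorem exists_continuum_of_isPreconnected_diff {X Y : Type*} [TopologicalSpace X] [CompactSpace X]
    [TopologicalSpace.MetrizableSpace X] [ConnectedSpace X] [TopologicalSpace Y]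
    (hX : ∀ x : X, ∃ φ : ℂ → X, IsOpenEmbedding φ ∧ φ 0 = x) {f : X → Y}
    (hdar : ∀ C : Set X, IsPreconnected C → IsPreconnected (f '' C)) {S : Set Y}
    (hsep : ¬ IsPreconnected (range f \ S)) :
    ∃ K : Set X, MapsTo f K S ∧ IsClosed K ∧ IsConnected K ∧ K.Nontrivial ∧
      ∀ x ∈ K, IsPreconnected (K \ {x}) := by
  let := TopologicalSpace.metrizableSpaceMetric X
  have hW : ¬ IsPreconnected (f ⁻¹' S)ᶜ := fun h => hsep (by
    have := hdar _ h
    rwa [← preimage_compl, image_preimage_eq_inter_range, inter_comm, ← sdiff_eq] at this)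
  simp only [IsPreconnected, not_forall] at hW
  obtain ⟨U₀, V₀, hU₀, hV₀, hUV₀, hWU, hWV, hne⟩ := hW
  set W := (f ⁻¹' S)ᶜ
  have hdis₁ : Disjoint (closure (W ∩ U₀)) (W ∩ V₀) := by
    rw [disjoint_left]
    intro x hx hx'
    obtain ⟨y, hyV, hyW, hyU⟩ := mem_closure_iff.1 hx V₀ hV₀ hx'.2
    exact hne ⟨y, hyW, hyU, hyV⟩
  have hdis₂ : Disjoint (W ∩ U₀) (closure (W ∩ V₀)) := by
    rw [disjoint_right]
    intro x hx hx'
    obtain ⟨y, hyU, hyW, hyV⟩ := mem_closure_iff.1 hx U₀ hU₀ hx'.2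
    exact hne ⟨y, hyW, hyU, hyV⟩
  obtain ⟨U₁, V₁, hU₁, hV₁, hAU, hBV, hd⟩ :=
    separatedNhds_iff_disjoint.2 (completely_normal hdis₁ hdis₂)
  set V := (closure U₁)ᶜ
  set U := (closure V)ᶜ
  have hV : IsOpen V := isClosed_closure.isOpen_compl
  have hU : IsOpen U := isClosed_closure.isOpen_compl
  have hV₁V : V₁ ⊆ V := fun x hx hx' => disjoint_left.1 (hd.closure_left hV₁) hx' hx
  have hU₁U : U₁ ⊆ U := fun x hx hx' => by
    obtain ⟨y, hyU, hyV⟩ := mem_closure_iff.1 hx' U₁ hU₁ hx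
    exact hyV (subset_closure hyU)
  have hUV : Disjoint U V := disjoint_left.2 fun x hx hx' => hx (subset_closure hx')
  have hLU : ∀ e ∈ (U ∪ V)ᶜ, e ∈ closure U := fun e he =>
    closure_mono hU₁U (not_not.1 fun h => he (Or.inr h))
  have hLV : ∀ e ∈ (U ∪ V)ᶜ, e ∈ closure V := fun e he => not_not.1 fun h => he (Or.inl h)
  have hLS : (U ∪ V)ᶜ ⊆ f ⁻¹' S := by
    intro x hx
    by_contra hxS
    rcases hUV₀ hxS with h | h
    · exact hx (Or.inl (hU₁U (hAU ⟨hxS, h⟩)))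
    · exact hx (Or.inr (hV₁V (hBV ⟨hxS, h⟩)))
  have hLne : ((U ∪ V)ᶜ).Nonempty := by
    rw [nonempty_compl]
    intro h
    obtain ⟨x, -, hx⟩ := isPreconnected_univ (α := X) U V hU hV h.ge
      (by obtain ⟨x, hx⟩ := hWU; exact ⟨x, trivial, hU₁U (hAU hx)⟩)
      (by obtain ⟨x, hx⟩ := hWV; exact ⟨x, trivial, hV₁V (hBV hx)⟩)
    exact disjoint_left.1 hUV hx.1 hx.2
  have hLc : IsClosed (U ∪ V)ᶜ := (hU.union hV).isClosed_compl
  suffices h : ∃ e ∈ (U ∪ V)ᶜ, ∃ K ⊆ connectedComponentIn (U ∪ V)ᶜ e, IsClosed K ∧ IsConnected K ∧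
      K.Nontrivial ∧ ∀ x ∈ K, IsPreconnected (K \ {x}) by
    obtain ⟨e, -, K, hK, h⟩ := h
    exact ⟨K, fun x hx => hLS (connectedComponentIn_subset _ _ (hK hx)), h⟩
  by_cases hlog : ∀ h : X → ℂ, ContinuousOn h (U ∪ V)ᶜ → (∀ x ∈ (U ∪ V)ᶜ, h x ≠ 0) →
      HasContLogOn h (U ∪ V)ᶜ
  · obtain ⟨e, he⟩ := hLne
    refine ⟨e, he, exists_minimal_continuum (Q := LocResidueFree)
      (isClosed_connectedComponentIn hLc e) (isConnected_connectedComponentIn_iff.2 he) ?_ ?_ ?_ ?_⟩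
    · intro hres
      obtain ⟨φ, hφ, rfl⟩ := hX e
      exact false_of_mem_closure_of_mem_closure hφ hU hV hUV he (hLU _ he) (hLV _ he) hres hlog
    · intro x _
      obtain ⟨φ, hφ, rfl⟩ := hX x
      exact locResidueFree_singleton hφ
    · intro K₁ K₂ p _ _ hK₁ hK₂ hp h₁ h₂
      obtain ⟨φ, hφ, rfl⟩ := hX p
      exact h₁.union hK₁ hK₂ hφ hp h₂
    · rintro K - - ⟨O, hO, hKO, hres⟩
      exact ⟨O, hO, hKO, fun K' _ hK' => ⟨O, hO, hK', hres⟩⟩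
  · push Not at hlog
    obtain ⟨h, hh, hh0, hnlog⟩ := hlog
    obtain ⟨e, he, henlog⟩ : ∃ e ∈ (U ∪ V)ᶜ, ¬ HasContLogOn h (connectedComponentIn (U ∪ V)ᶜ e) := by
      by_contra! hall
      exact hnlog (hasContLogOn_of_connectedComponentIn hLc.isCompact hh hall)
    have hsubL := connectedComponentIn_subset (U ∪ V)ᶜ e
    refine ⟨e, he, exists_minimal_continuum (Q := HasContLogOn h)
      (isClosed_connectedComponentIn hLc e) (isConnected_connectedComponentIn_iff.2 he) henlog
      (fun x hx => hasContLogOn_singleton (hh0 x (hsubL hx))) ?_ ?_⟩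
    · intro K₁ K₂ p _ _ hK₁ hK₂ hp h₁ h₂
      exact h₁.union hK₁ hK₂ (hp ▸ subsingleton_singleton) h₂
    · intro K hK hKc hKlog
      obtain ⟨O, hO, hKO, hOlog⟩ := hKlog.exists_isOpen hKc hh
      rw [inter_eq_left.2 (hK.trans hsubL)] at hKO
      exact ⟨O, hO, hKO, fun K' hK' hK'O => hOlog.mono (subset_inter hK'O (hK'.trans hsubL))⟩

theorem IsTwoVariety.isOpenMap_and_isClosed_range {X Y : Type*} [TopologicalSpace X]
    [CompactSpace X] [TopologicalSpace.MetrizableSpace X] [ConnectedSpace X] [TopologicalSpace Y]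
    (hX : ∀ x : X, ∃ φ : ℂ → X, IsOpenEmbedding φ ∧ φ 0 = x) (hY : IsTwoVariety Y) {f : X → Y}
    (hinj : Function.Injective f)
    (hdar : ∀ C : Set X, IsPreconnected C → IsPreconnected (f '' C)) :
    IsOpenMap f ∧ IsClosed (range f) := by
  obtain ⟨_, _, -, hcurve⟩ := hY
  have hpre : IsPreconnected (range f) := by
    rw [← image_univ]
    exact hdar _ isPreconnected_univ
  have hnt : (range f).Nontrivial := by
    obtain ⟨φ, hφ, -⟩ := hX (Classical.arbitrary X)
    refine ⟨f (φ 0), mem_range_self _, f (φ 1), mem_range_self _, fun h => ?_⟩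
    exact zero_ne_one (hφ.injective (hinj h))
  have key : ∀ (u : ℕ → Y) (y : Y), y ∈ closure (range f) → Tendsto u atTop (𝓝 y) →
      ∃ K : Set X, IsClosed K ∧ ContinuousOn f K ∧ {n | u n ∈ f '' K}.Infinite := by
    intro u y hy hu
    obtain ⟨S, -, hS, hS1, hsep, hinf⟩ := hcurve _ hpre hnt u y hy hu
    obtain ⟨K, hKS, hKc, hK, hKn, hcut⟩ := exists_continuum_of_isPreconnected_diff hX hdar hsep
    obtain ⟨himg, hcont⟩ := image_eq_and_continuousOn_of_mapsTo hinj hdar hS hS1 hK hKn hcut hKS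
    exact ⟨K, hKc, hcont, himg ▸ hinf⟩
  constructor
  · intro U hU
    rw [isOpen_iff_mem_nhds]
    rintro _ ⟨x, hx, rfl⟩
    by_contra hnb
    have hcl : f x ∈ closure (f '' U)ᶜ := by
      rwa [closure_compl, mem_compl_iff, mem_interior_iff_mem_nhds]
    obtain ⟨u, huU, hu⟩ := mem_closure_iff_seq_limit.1 hcl
    obtain ⟨K, hK, hcont, hinf⟩ := key u (f x) (subset_closure (mem_range_self x)) hu
    have hclosed : IsClosed (f '' (K \ U)) :=
      ((hK.sdiff hU).isCompact.image_of_continuousOn (hcont.mono sdiff_subset)).isClosed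
    have hfr : ∃ᶠ n in atTop, u n ∈ f '' (K \ U) := by
      refine (Nat.frequently_atTop_iff_infinite.2 hinf).mono ?_
      rintro n ⟨z, hz, hzn⟩
      exact ⟨z, ⟨hz, fun hzU => huU n ⟨z, hzU, hzn⟩⟩, hzn⟩
    obtain ⟨z, hz, hzx⟩ := hclosed.mem_of_frequently_of_tendsto hfr hu
    exact hz.2 (hinj hzx ▸ hx)
  · refine isClosed_of_closure_subset fun y hy => ?_
    obtain ⟨K, -, -, hinf⟩ := key (fun _ => y) y hy tendsto_const_nhds
    obtain ⟨n, z, -, hz⟩ := hinf.nonempty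
    exact ⟨z, hz⟩

/-- An open Darboux bijection onto a componnected Hausdorff space is continuous. -/
theorem continuous_of_componnected {X Z : Type*} [TopologicalSpace X] [T2Space X]
    [TopologicalSpace Z] [T2Space Z] (hZ : Componnected Z) {k : X → Z} (hk : Function.Bijective k)
    (hopen : IsOpenMap k) (hdar : ∀ C : Set X, IsPreconnected C → IsPreconnected (k '' C)) :
    Continuous k := by
  obtain ⟨B, hB, hC⟩ := hZ
  let e := Equiv.ofBijective k hk
  have he : Continuous e.symm := by
    rw [continuous_def]
    intro U hU
    convert hopen U hU using 1
    exact (e.image_eq_preimage_symm U).symm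
  refine hB.continuous_iff.2 fun b hb => ?_
  obtain ⟨m, C, hbC, hCi⟩ := hC b hb
  rw [← isClosed_compl_iff, ← preimage_compl]
  refine isClosed_of_closure_subset ?_
  nth_rewrite 1 [hbC]
  rw [preimage_iUnion, closure_iUnion_of_finite]
  refine iUnion_subset fun i => ?_
  have hib : C i ⊆ bᶜ := hbC ▸ subset_iUnion C i
  have hpi : k ⁻¹' C i = e.symm '' C i := (e.symm.image_eq_preimage_symm (C i)).symm
  rcases hCi i with hi | hi
  · rw [hpi, (hi.image he).isClosed.closure_eq, ← hpi]
    exact preimage_mono hib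
  · intro x hx hxb
    have hpre : IsPreconnected (insert x (k ⁻¹' C i)) :=
      IsPreconnected.subset_closure (hpi ▸ hi.isPreconnected.image _ he.continuousOn)
        (subset_insert _ _) (insert_subset hx subset_closure)
    have himg := hdar _ hpre
    rw [image_insert_eq, image_preimage_eq _ hk.surjective] at himg
    obtain ⟨c, hc⟩ := hi.nonempty
    obtain ⟨z, hz, hzb, hzx⟩ := himg b {k x}ᶜ (hB.isOpen hb) isOpen_compl_singleton
      (by
        rintro z (rfl | hz)
        · exact Or.inl hxb
        · exact Or.inr fun h => hib hz (h ▸ hxb))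
      ⟨k x, mem_insert _ _, hxb⟩
      ⟨c, mem_insert_of_mem _ hc, fun h => hib hc (h ▸ hxb)⟩
    rcases hz with hz | hz
    · exact hzx hz
    · exact hib hz hzb

theorem IsTwoVariety.isOpenEmbedding_of_surface {X Y : Type*} [TopologicalSpace X]
    [CompactSpace X] [TopologicalSpace.MetrizableSpace X] [ConnectedSpace X] [TopologicalSpace Y]
    (hX : ∀ x : X, ∃ φ : ℂ → X, IsOpenEmbedding φ ∧ φ 0 = x) (hY : IsTwoVariety Y) {f : X → Y}
    (hinj : Function.Injective f)
    (hdar : ∀ C : Set X, IsPreconnected C → IsPreconnected (f '' C)) :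
    IsOpenEmbedding f := by
  obtain ⟨hopen, hclosed⟩ := hY.isOpenMap_and_isClosed_range hX hinj hdar
  obtain ⟨_, -, hcomp, -⟩ := hY
  refine IsOpenEmbedding.of_continuous_injective_isOpenMap ?_ hinj hopen
  have hpre : IsPreconnected (range f) := by
    rw [← image_univ]
    exact hdar _ isPreconnected_univ
  let y := f (Classical.arbitrary X)
  have hrange : range f = connectedComponent y :=
    Subset.antisymm (hpre.subset_connectedComponent (mem_range_self _))
      (IsClopen.connectedComponent_subset ⟨hclosed, hopen.isOpen_range⟩ (mem_range_self _))
  have hmem : ∀ x, f x ∈ connectedComponent y := fun x => hrange.subset (mem_range_self x)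
  let k : X → connectedComponent y := fun x => ⟨f x, hmem x⟩
  have hk : Function.Bijective k := by
    refine ⟨fun a b h => hinj (congrArg Subtype.val h), fun z => ?_⟩
    obtain ⟨x, hx⟩ : z.1 ∈ range f := hrange.superset z.2
    exact ⟨x, Subtype.ext hx⟩
  refine continuous_subtype_val.comp
    (continuous_of_componnected (hcomp y) hk (hopen.subtype_mk hmem) fun C hC => ?_)
  rw [← IsInducing.subtypeVal.isPreconnected_image, image_image]
  exact hdar C hC

theorem exists_isOpenEmbedding_complex_sphere (v : sphere (0 : EuclideanSpace ℝ (Fin 3)) 1) :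
    ∃ φ : ℂ → sphere (0 : EuclideanSpace ℝ (Fin 3)) 1, IsOpenEmbedding φ ∧ φ 0 = v := by
  have : Fact (Module.finrank ℝ (EuclideanSpace ℝ (Fin 3)) = 2 + 1) :=
    ⟨by rw [finrank_euclideanSpace_fin]⟩
  let s := stereographic' 2 (-v)
  have hs : s.target = univ := stereographic'_target _
  have hv : v ∈ s.source := by
    simp only [s, stereographic'_source, mem_compl_iff, mem_singleton_iff]
    exact ne_neg_of_mem_unit_sphere ℝ v
  let e : s.source ≃ₜ EuclideanSpace ℝ (Fin 2) :=
    s.toHomeomorphSourceTarget.trans ((Homeomorph.setCongr hs).trans (Homeomorph.Set.univ _))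
  exact exists_isOpenEmbedding_of_homeomorph (s.open_source.mem_nhds hv)
    (e.trans Complex.orthonormalBasisOneI.repr.symm.toHomeomorph)

theorem exists_continuous_injective_sphere {n : ℕ} (hn : 3 ≤ n) :
    ∃ i : sphere (0 : EuclideanSpace ℝ (Fin 3)) 1 → EuclideanSpace ℝ (Fin n),
      Continuous i ∧ Function.Injective i := by
  refine ⟨fun v => WithLp.toLp 2 fun j => if h : (j : ℕ) < 3 then v.1 ⟨j, h⟩ else 0, ?_, ?_⟩
  · refine (PiLp.continuous_toLp 2 _).comp (continuous_pi fun j => ?_)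
    split_ifs
    · fun_prop
    · exact continuous_const
  · intro v w h
    ext j
    have := congrFun (congrArg WithLp.ofLp h) ⟨j, j.2.trans_le hn⟩
    simpa using this

theorem IsTwoVariety.le_two_of_darboux_injection {X Y : Type*}
    [TopologicalSpace X] [ConnectedSpace X] [TopologicalSpace Y]
    (hY : IsTwoVariety Y) {n : ℕ} {ψ : EuclideanSpace ℝ (Fin n) → X} (hψ : IsOpenEmbedding ψ)
    {f : X → Y} (hinj : Function.Injective f)
    (hdar : ∀ C : Set X, IsPreconnected C → IsPreconnected (f '' C)) :
    n ≤ 2 := by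
  by_contra! hn
  obtain ⟨i, hi, hii⟩ := exists_continuous_injective_sphere hn
  have hc : Continuous (ψ ∘ i) := hψ.continuous.comp hi
  have hinj' : Function.Injective (f ∘ ψ ∘ i) := hinj.comp (hψ.injective.comp hii)
  have hrank : 1 < Module.rank ℝ (EuclideanSpace ℝ (Fin 3)) := by
    rw [← Module.finrank_eq_rank, finrank_euclideanSpace_fin]
    norm_num
  have : ConnectedSpace (sphere (0 : EuclideanSpace ℝ (Fin 3)) 1) :=
    isConnected_iff_connectedSpace.1 (isConnected_sphere hrank 0 zero_le_one)
  obtain ⟨hopen, hclosed⟩ := hY.isOpenMap_and_isClosed_range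
    exists_isOpenEmbedding_complex_sphere hinj' fun C hC => by
      rw [image_comp]
      exact hdar _ (hC.image _ hc.continuousOn)
  have hsub : range f ⊆ range (f ∘ ψ ∘ i) := by
    have hpre : IsPreconnected (range f) := by
      rw [← image_univ]
      exact hdar _ isPreconnected_univ
    obtain ⟨v⟩ := (inferInstance : Nonempty (sphere (0 : EuclideanSpace ℝ (Fin 3)) 1))
    exact hpre.subset_isClopen ⟨hclosed, hopen.isOpen_range⟩
      ⟨f ((ψ ∘ i) v), mem_range_self _, mem_range_self v⟩
  have hi_surj : range i = univ := by
    refine eq_univ_of_forall fun z => ?_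
    obtain ⟨v, hv⟩ := hsub (mem_range_self (ψ z))
    exact ⟨v, hψ.injective (hinj hv)⟩
  have hcpt : IsCompact (univ : Set (EuclideanSpace ℝ (Fin n))) :=
    hi_surj ▸ isCompact_range hi
  have : Nonempty (Fin n) := ⟨⟨0, by omega⟩⟩
  have : NoncompactSpace (EuclideanSpace ℝ (Fin n)) := NormedSpace.noncompactSpace ℝ _
  exact noncompact_univ _ hcpt

end

/-- Every Darboux injection `f : X → Y` from a connected closed `n`-manifold `X` of
dimension `n ≥ 2` (a compact metrizable space each of whose points has an open
neighborhood homeomorphic to `ℝⁿ`) to a 2-variety `Y` is an open topological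
embedding. -/
theorem darboux_injection_closed_manifold_to_two_variety_isOpenEmbedding {X Y : Type*}
    [TopologicalSpace X] [CompactSpace X] [TopologicalSpace.MetrizableSpace X]
    [ConnectedSpace X] [TopologicalSpace Y]
    (n : ℕ) (hn : 2 ≤ n)
    (hX : ∀ x : X, ∃ U : Set X, IsOpen U ∧ x ∈ U ∧
      Nonempty (U ≃ₜ EuclideanSpace ℝ (Fin n)))
    (hY : IsTwoVariety Y)
    (f : X → Y) (hinj : Function.Injective f)
    (hdarboux : ∀ C : Set X, IsPreconnected C → IsPreconnected (f '' C)) :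
    Topology.IsOpenEmbedding f := by
  rcases hn.eq_or_lt with rfl | hn
  · refine hY.isOpenEmbedding_of_surface (fun x => ?_) hinj hdarboux
    obtain ⟨U, hU, hxU, ⟨e⟩⟩ := hX x
    exact exists_isOpenEmbedding_of_homeomorph (hU.mem_nhds hxU)
      (e.trans Complex.orthonormalBasisOneI.repr.symm.toHomeomorph)
  · obtain ⟨U, hU, hxU, ⟨e⟩⟩ := hX (Classical.arbitrary X)
    obtain ⟨ψ, hψ, -⟩ := exists_isOpenEmbedding_of_homeomorph (hU.mem_nhds hxU) e
    exact absurd hn (hY.le_two_of_darboux_injection hψ hinj hdarboux).not_gt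
end

section
/- Every Darboux injection f : X → Y from a connected closed n-manifold X of dimension n ≥ 2 to a 2-manifold Y is an open topological embedding: f is a homeomorphism onto its image and f(X) is open in Y. -/
open Set Filter Topology unitInterval

/-- A circle-valued map on the complement of an open ball that vanishes near infinity lifts to a
real-valued map vanishing near infinity; the lift is extended arbitrarily over a larger ball. -/
theorem exists_lift_off_ball {E : Type*} [NormedAddCommGroup E] [NormedSpace ℝ E]
    {G : E → UnitAddCircle} {r r' R : ℝ} (hr : 0 < r) (hr' : r < r')
    (hG : ContinuousOn G {x | r ≤ ‖x‖}) (hR : ∀ x, R ≤ ‖x‖ → G x = 0) :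
    ∃ h : E → ℝ, Continuous h ∧ (∀ x, r' ≤ ‖x‖ → (h x : UnitAddCircle) = G x) ∧
      ∀ x, R ≤ ‖x‖ → h x = 0 := by
  obtain ⟨M, hM0, hM⟩ : ∃ M : ℝ, 0 ≤ M ∧ R ≤ (1 + M) * r := by
    refine ⟨max 0 (R / r), le_max_left _ _, ?_⟩
    have : R / r ≤ max 0 (R / r) := le_max_right _ _
    rw [div_le_iff₀ hr] at this
    linarith
  let A := {x : E | r ≤ ‖x‖}
  have hmem : ∀ (t : I) (x : A), (1 + (1 - (t : ℝ)) * M) • (x : E) ∈ A := by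
    intro t x
    have h1 : 0 ≤ (1 - (t : ℝ)) * M := mul_nonneg (by linarith [t.2.2]) hM0
    have h2 : r ≤ ‖(x : E)‖ := x.2
    change r ≤ ‖_‖
    rw [norm_smul, Real.norm_of_nonneg (by linarith)]
    nlinarith
  let H : C(I × A, UnitAddCircle) :=
    ⟨fun p => G ((1 + (1 - (p.1 : ℝ)) * M) • (p.2 : E)), by
      refine hG.comp_continuous (by fun_prop) fun p => hmem p.1 p.2⟩
  let cov := AddCircle.isCoveringMap_coe (1 : ℝ)
  have H0 : ∀ a : A, H (0, a) = ((ContinuousMap.const A (0 : ℝ)) a : UnitAddCircle) := by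
    intro a
    have h2 : r ≤ ‖(a : E)‖ := a.2
    change G _ = ((0 : ℝ) : UnitAddCircle)
    rw [AddCircle.coe_zero]
    apply hR
    simp only [Icc.coe_zero, sub_zero, one_mul]
    rw [norm_smul, Real.norm_of_nonneg (by linarith)]
    nlinarith
  let L := cov.liftHomotopy H (ContinuousMap.const A (0 : ℝ)) H0
  have hL : ∀ t a, ((L (t, a) : ℝ) : UnitAddCircle) = H (t, a) := fun t a =>
    congrFun (cov.liftHomotopy_lifts H _ H0) (t, a)
  have hLR : ∀ a : A, R ≤ ‖(a : E)‖ → L (1, a) = 0 := by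
    intro a ha
    have hz : cov.liftPath (.const I (0 : UnitAddCircle)) (0 : ℝ) (by simp) =
        ContinuousMap.const I (0 : ℝ) := cov.liftPath_const (by simp)
    have : ∀ t, H (t, a) = 0 := by
      intro t
      apply hR
      have h1 : 0 ≤ (1 - (t : ℝ)) * M := mul_nonneg (by linarith [t.2.2]) hM0
      rw [norm_smul, Real.norm_of_nonneg (by linarith)]
      nlinarith [norm_nonneg (a : E)]
    have e : (fun t => L (t, a)) = ContinuousMap.const I (0 : ℝ) := by
      refine cov.eq_of_comp_eq (by fun_prop) (by fun_prop) ?_ 0 ?_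
      · ext t
        simp only [Function.comp, hL, this]
        simp
      · exact cov.liftHomotopy_zero H _ H0 a
    exact congrFun e 1
  classical
  let h0 : E → ℝ := fun x => if hx : x ∈ A then L (1, ⟨x, hx⟩) else 0
  have h0c : ContinuousOn h0 A := by
    rw [continuousOn_iff_continuous_domRestrict]
    have : A.domRestrict h0 = fun a => L (1, a) := by
      ext a
      simp [h0]
    rw [this]
    fun_prop
  let lam : E → ℝ := fun x => max 0 (min 1 ((‖x‖ - r) / (r' - r)))
  have hlam : Continuous lam := by fun_prop
  have hlam0 : ∀ x, ‖x‖ ≤ r → lam x = 0 := by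
    intro x hx
    apply max_eq_left
    exact (min_le_right _ _).trans (div_nonpos_of_nonpos_of_nonneg (by linarith) (by linarith))
  have hlam1 : ∀ x, r' ≤ ‖x‖ → lam x = 1 := by
    intro x hx
    have : 1 ≤ (‖x‖ - r) / (r' - r) := by
      rw [le_div_iff₀ (by linarith)]; linarith
    simp [lam, min_eq_left this]
  refine ⟨fun x => lam x * h0 x, ?_, ?_, ?_⟩
  · have hu : {x : E | ‖x‖ ≤ r} ∪ A = univ := by
      ext x; simpa [A] using le_total ‖x‖ r
    rw [← continuousOn_univ, ← hu]
    refine ContinuousOn.union_of_isClosed ?_ (hlam.continuousOn.mul h0c)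
      (isClosed_le (by fun_prop) (by fun_prop)) (isClosed_le (by fun_prop) (by fun_prop))
    refine (continuousOn_const (c := (0 : ℝ))).congr fun x hx => ?_
    simp [hlam0 x hx]
  · intro x hx
    have hxA : x ∈ A := hr'.le.trans hx
    have := hL 1 ⟨x, hxA⟩
    simp only [hlam1 x hx, one_mul, h0, dif_pos hxA, this]
    change G _ = G x
    simp
  · intro x hx
    by_cases hxA : x ∈ A
    · simp [h0, hxA, hLR ⟨x, hxA⟩ hx]
    · simp [h0, hxA]

theorem eq_of_isPreconnected_of_coe_eq_zero {A : Type*} [TopologicalSpace A] {s : Set A}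
    (hs : IsPreconnected s) {h : A → ℝ} (hc : ContinuousOn h s)
    (h0 : ∀ x ∈ s, (h x : UnitAddCircle) = 0) {x y : A} (hx : x ∈ s) (hy : y ∈ s) :
    h x = h y := by
  have hd : (range ((↑) : ℤ → ℝ)).Countable := countable_range _
  refine hd.isTotallyDisconnected (h '' s) ?_ (hs.image h hc) (mem_image_of_mem h hx)
    (mem_image_of_mem h hy)
  rintro _ ⟨z, hz, rfl⟩
  obtain ⟨n, hn⟩ := (AddCircle.coe_eq_zero_iff 1).1 (h0 z hz)
  exact ⟨n, by simpa using hn⟩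

theorem exists_lift_of_hasCompactSupport {E : Type*} [NormedAddCommGroup E] [NormedSpace ℝ E]
    (hE : 1 < Module.rank ℝ E)
    {G : E → UnitAddCircle} {R : ℝ} (hR0 : 0 < R)
    (hG : Continuous G) (hR : ∀ x, R ≤ ‖x‖ → G x = 0) :
    ∃ h : E → ℝ, Continuous h ∧ (∀ x, (h x : UnitAddCircle) = G x) ∧
      ∀ x, R ≤ ‖x‖ → h x = 0 := by
  let H : C(I × E, UnitAddCircle) := ⟨fun p => G ((p.1 : ℝ) • p.2), by fun_prop⟩
  obtain ⟨e, he⟩ := QuotientAddGroup.mk_surjective (G 0)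
  let cov := AddCircle.isCoveringMap_coe (1 : ℝ)
  have H0 : ∀ a : E, H (0, a) = ((ContinuousMap.const E e) a : UnitAddCircle) := by
    intro a
    change G _ = (e : UnitAddCircle)
    rw [← he.symm]
    simp
  let L := cov.liftHomotopy H (ContinuousMap.const E e) H0
  have hL : ∀ a, ((L (1, a) : ℝ) : UnitAddCircle) = G a := fun a => by
    have := congrFun (cov.liftHomotopy_lifts H _ H0) (1, a)
    exact this.trans (congrArg G (one_smul ℝ a))
  have hpre : IsPreconnected {x : E | R ≤ ‖x‖} := by
    have : {x : E | R ≤ ‖x‖} =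
        (fun p : ℝ × E => p.1 • p.2) '' (Ici (1 : ℝ) ×ˢ Metric.sphere (0 : E) R) := by
      ext x
      simp only [mem_ofPred_eq, mem_image, mem_prod, mem_Ici, mem_sphere_iff_norm, sub_zero]
      constructor
      · intro hx
        refine ⟨(‖x‖ / R, (R / ‖x‖) • x), ⟨by rwa [le_div_iff₀ hR0, one_mul], ?_⟩, ?_⟩
        · rw [norm_smul, Real.norm_of_nonneg (by positivity)]
          field_simp [(hR0.trans_le hx).ne']
        · simp only [smul_smul]
          rw [div_mul_div_cancel₀ hR0.ne', div_self (hR0.trans_le hx).ne', one_smul]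
      · rintro ⟨⟨t, y⟩, ⟨ht, hy⟩, rfl⟩
        simp only at ht hy ⊢
        rw [norm_smul, Real.norm_of_nonneg (by linarith), hy]
        nlinarith
    rw [this]
    exact (isPreconnected_Ici.prod (isPreconnected_sphere hE 0 R)).image _ (by fun_prop)
  have : Nontrivial E := by
    by_contra hn
    rw [not_nontrivial_iff_subsingleton] at hn
    simp at hE
  obtain ⟨x0, hx0⟩ := exists_norm_eq E hR0.le
  have hz : ∀ x, R ≤ ‖x‖ → ((L (1, x) : ℝ) : UnitAddCircle) = 0 := fun x hx => by
    rw [hL, hR x hx]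
  refine ⟨fun x => L (1, x) - L (1, x0), by fun_prop, fun x => ?_, fun x hx => ?_⟩
  · simp [hL, hR x0 hx0.ge]
  · exact sub_eq_zero.2 (eq_of_isPreconnected_of_coe_eq_zero hpre
      (h := fun x => L (1, x)) (by fun_prop) hz hx hx0.ge)

theorem continuous_extend_zero_of_isOpenEmbedding {E X : Type*} [NormedAddCommGroup E]
    [ProperSpace E] [TopologicalSpace X] [T2Space X] {j : E → X} (hj : IsOpenEmbedding j)
    {h : E → ℝ} (hh : Continuous h) {R : ℝ} (hR : ∀ x, R ≤ ‖x‖ → h x = 0) :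
    Continuous (Function.extend j h 0) := by
  rw [continuous_iff_continuousAt]
  intro x
  by_cases hx : x ∈ range j
  · obtain ⟨e, rfl⟩ := hx
    rw [← hj.continuousAt_iff, Function.extend_comp hj.injective]
    exact hh.continuousAt
  · have hK : IsClosed (j '' Metric.closedBall 0 R) :=
      ((isCompact_closedBall 0 R).image hj.continuous).isClosed
    have : Function.extend j h 0 =ᶠ[𝓝 x] fun _ => (0 : ℝ) := by
      filter_upwards [hK.isOpen_compl.mem_nhds fun hx' => hx (image_subset_range _ _ hx')]
        with y hy
      by_cases hyj : y ∈ range j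
      · obtain ⟨e, rfl⟩ := hyj
        rw [hj.injective.extend_apply]
        apply hR
        by_contra hlt
        exact hy ⟨e, by simpa using (not_le.1 hlt).le, rfl⟩
      · exact Function.extend_apply' _ _ _ hyj
    exact continuousAt_const.congr this.symm

/-- In a chart domain `range j`, a circle-valued map that is continuous off a small neighbourhood
of at most one point and has compact support in the chart lifts to a real-valued function off a
slightly larger neighbourhood. -/
theorem exists_isOpen_forall_exists_lift {E X : Type*} [NormedAddCommGroup E] [NormedSpace ℝ E]
    [ProperSpace E] (hE : 1 < Module.rank ℝ E) [TopologicalSpace X] [T2Space X] {j : E → X}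
    (hj : IsOpenEmbedding j) {P O : Set X} (hP : P.Subsingleton) (hPj : P ⊆ range j)
    (hO : IsOpen O) (hPO : P ⊆ O) :
    ∃ B, IsOpen B ∧ P ⊆ B ∧ B ⊆ O ∧ ∀ K, IsCompact K → K ⊆ range j →
      ∀ F : X → UnitAddCircle, (∀ x ∉ B, ContinuousAt F x) → (∀ x ∉ K, F x = 0) →
        ∃ h : X → ℝ, Continuous h ∧ (∀ x ∉ range j, h x = 0) ∧
          ∀ x ∉ O, (h x : UnitAddCircle) = F x := by
  have hbdd : ∀ {i : E → X}, IsOpenEmbedding i → ∀ K, IsCompact K → K ⊆ range i →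
      ∀ F : X → UnitAddCircle, (∀ x ∉ K, F x = 0) →
      ∃ R, 0 < R ∧ ∀ e, R ≤ ‖e‖ → F (i e) = 0 := by
    intro i hi K hK hKi F hF
    obtain ⟨R, hR, hKR⟩ := (hi.isInducing.isCompact_iff.2
      (by rwa [image_preimage_eq_of_subset hKi])).isBounded.exists_pos_norm_lt
    refine ⟨R, hR, fun e he => hF _ fun hmem => ?_⟩
    exact (hKR e hmem).not_ge he
  have hout : ∀ {i : E → X} (_ : IsOpenEmbedding i) (h : E → ℝ) (F : X → UnitAddCircle) (K : Set X)
      (_ : ∀ x ∉ K, F x = 0) (_ : K ⊆ range i) (S : Set X)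
      (_ : ∀ e, i e ∉ S → (h e : UnitAddCircle) = F (i e)) (x : X) (_ : x ∉ S),
      ((Function.extend i h 0 x : ℝ) : UnitAddCircle) = F x := by
    intro i hi h F K hF hKi S hS x hx
    by_cases hxi : x ∈ range i
    · obtain ⟨e, rfl⟩ := hxi
      rw [hi.injective.extend_apply, hS e hx]
    · rw [Function.extend_apply' _ _ _ hxi, hF x fun hxK => hxi (hKi hxK)]
      simp
  rcases hP.eq_empty_or_singleton with rfl | ⟨p, rfl⟩
  · refine ⟨∅, isOpen_empty, Subset.rfl, empty_subset _, fun K hK hKj F hFc hF => ?_⟩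
    have hFc' : Continuous F := continuous_iff_continuousAt.2 fun x => hFc x (notMem_empty x)
    obtain ⟨R, hR0, hR⟩ := hbdd hj K hK hKj F hF
    obtain ⟨h, hc, hl, hz⟩ := exists_lift_of_hasCompactSupport hE hR0
      (hFc'.comp hj.continuous) hR
    exact ⟨Function.extend j h 0, continuous_extend_zero_of_isOpenEmbedding hj hc hz,
      fun x hx => Function.extend_apply' _ _ _ hx,
      hout hj h F K hF hKj O fun e _ => hl e⟩
  · obtain ⟨c, hc⟩ := hPj rfl
    have hpO : p ∈ O := hPO rfl
    let i : E → X := fun e => j (e + c)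
    have hi : IsOpenEmbedding i := hj.comp (Homeomorph.addRight c).isOpenEmbedding
    have hri : range i = range j := (Homeomorph.addRight c).surjective.range_comp j
    have hi0 : i 0 = p := by simpa [i] using hc
    obtain ⟨δ, hδ, hδO⟩ := Metric.isOpen_iff.1 (hO.preimage hi.continuous) 0 (by simpa [hi0])
    refine ⟨i '' Metric.ball 0 (δ / 4), hi.isOpenMap _ Metric.isOpen_ball, ?_, ?_, ?_⟩
    · rw [singleton_subset_iff, ← hi0]
      exact mem_image_of_mem i (by simpa using by positivity)
    · rw [image_subset_iff]
      exact (Metric.ball_subset_ball (by linarith)).trans hδO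
    · intro K hK hKj F hFc hF
      rw [← hri] at hKj
      obtain ⟨R, hR0, hR⟩ := hbdd hi K hK hKj F hF
      have hG : ContinuousOn (F ∘ i) {e | δ / 4 ≤ ‖e‖} := by
        intro e he
        refine (ContinuousAt.comp (hFc _ ?_) hi.continuous.continuousAt).continuousWithinAt
        rintro ⟨e', he', heq⟩
        rw [hi.injective heq] at he'
        rw [mem_ball_zero_iff] at he'
        exact he'.not_ge he
      obtain ⟨h, hcont, hl, hz⟩ := exists_lift_off_ball (r' := δ / 2) (by positivity)
        (by linarith) hG hR
      refine ⟨Function.extend i h 0, continuous_extend_zero_of_isOpenEmbedding hi hcont hz,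
        fun x hx => Function.extend_apply' _ _ _ (by rwa [← hri] at hx), ?_⟩
      refine hout hi h F K hF hKj O fun e he => hl e ?_
      by_contra hlt
      refine he (hδO ?_)
      rw [mem_ball_zero_iff]
      linarith [not_le.1 hlt]

/-- Circle-valued maps vanishing off a thin neighbourhood of the part of `C` where `t ≤ ρ` can be
lifted there by a function supported in `W`, up to a given neighbourhood `O` of `C ∩ ρ ⁻¹' {t}`. -/
def LiftableAbove {X : Type*} [TopologicalSpace X] (C W : Set X) (ρ : X → ℝ) (t : ℝ) : Prop :=
  ∀ O : Set X, IsOpen O → C ∩ ρ ⁻¹' {t} ⊆ O →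
    ∃ N : Set X, IsOpen N ∧ C ∩ ρ ⁻¹' Ici t ⊆ N ∧ ∀ F : X → UnitAddCircle, Continuous F →
      (∀ x, t ≤ ρ x → x ∉ N → F x = 0) →
        ∃ h : X → ℝ, Continuous h ∧ (∀ x ∉ W, h x = 0) ∧
          (∀ x, t ≤ ρ x → x ∉ O → (h x : UnitAddCircle) = F x) ∧
          ∀ x, ρ x ≤ t → x ∉ O → (h x : UnitAddCircle) = 0

theorem LiftableAbove.of_lt {E X : Type*} [NormedAddCommGroup E] [NormedSpace ℝ E]
    [ProperSpace E] (hE : 1 < Module.rank ℝ E) [TopologicalSpace X] [T2Space X]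
    [LocallyCompactSpace X] {j : E → X}
    (hj : IsOpenEmbedding j) {C W : Set X} (hC : IsCompact C) {ρ : X → ℝ} (hρ : Continuous ρ)
    (hinj : InjOn ρ C) (hjW : range j ⊆ W) {s t : ℝ} (hst : s < t)
    (hCj : C ∩ ρ ⁻¹' Icc s t ⊆ range j) (ht : LiftableAbove C W ρ t) :
    LiftableAbove C W ρ s := by
  intro O hO hCO
  obtain ⟨B, hBo, hPB, hBO, hB⟩ := exists_isOpen_forall_exists_lift hE hj
    (P := C ∩ ρ ⁻¹' {s}) (O := O ∩ ρ ⁻¹' Iio t)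
    (fun x hx y hy => hinj hx.1 hy.1 (hx.2.trans hy.2.symm))
    (fun x hx => hCj ⟨hx.1, by rw [mem_preimage, show ρ x = s from hx.2]; exact ⟨le_rfl, hst.le⟩⟩)
    (hO.inter (isOpen_Iio.preimage hρ))
    (fun x hx => ⟨hCO hx, by rw [mem_preimage, show ρ x = s from hx.2]; exact hst⟩)
  obtain ⟨Kt, hKt, hCKt, hKtj⟩ := exists_compact_between
    (hC.inter_right ((isClosed_singleton (x := t)).preimage hρ))
    (hj.isOpen_range.inter (isOpen_Ioi (a := s) |>.preimage hρ))
    (fun x hx => ⟨hCj ⟨hx.1, by rw [mem_preimage, show ρ x = t from hx.2]; exact ⟨hst.le, le_rfl⟩⟩,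
      by rw [mem_preimage, show ρ x = t from hx.2]; exact hst⟩)
  obtain ⟨K1, hK1, hCK1, hK1j⟩ := exists_compact_between
    (hC.inter_right ((isClosed_Icc (a := s) (b := t)).preimage hρ)) hj.isOpen_range hCj
  obtain ⟨Nt, hNto, hCNt, hNt⟩ := ht (interior Kt) isOpen_interior hCKt
  let bad : Set X := (ρ ⁻¹' Ici t \ Nt) ∪ (ρ ⁻¹' Icc s t \ interior K1) ∪ (ρ ⁻¹' {s} \ B)
  have hbad : IsClosed bad :=
    (((isClosed_Ici.preimage hρ).sdiff hNto).union
      ((isClosed_Icc.preimage hρ).sdiff isOpen_interior)).union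
      ((isClosed_singleton.preimage hρ).sdiff hBo)
  refine ⟨badᶜ, hbad.isOpen_compl, ?_, fun F hF hF0 => ?_⟩
  · rintro x ⟨hxC, hxs⟩ ((⟨h1, h2⟩ | ⟨h1, h2⟩) | ⟨h1, h2⟩)
    exacts [h2 (hCNt ⟨hxC, h1⟩), h2 (hCK1 ⟨hxC, h1⟩), h2 (hPB ⟨hxC, h1⟩)]
  have hFbad : ∀ x ∈ bad, s ≤ ρ x → F x = 0 := fun x hx hsx => hF0 x hsx fun h => h hx
  obtain ⟨ht', htc, htW, htF, ht0⟩ := hNt F hF fun x hx hxN =>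
    hFbad x (.inl (.inl ⟨hx, hxN⟩)) (hst.le.trans hx)
  have hKts : ∀ x, ρ x ≤ s → x ∉ interior Kt := fun x hx hxK =>
    (hKtj (interior_subset hxK)).2.not_ge hx
  let F1 : X → UnitAddCircle := fun x => F x - ht' x
  have hF1 : Continuous F1 := hF.sub ((AddCircle.continuous_mk' 1).comp htc)
  have hF1s : ∀ x, ρ x = s → x ∉ B → F1 x = 0 := by
    intro x hx hxB
    simp only [F1]
    rw [hFbad x (.inr ⟨hx, hxB⟩) hx.ge, ht0 x (hx.le.trans hst.le) (hKts x hx.le), sub_zero]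
  classical
  let F2 : X → UnitAddCircle := fun x => if s ≤ ρ x then F1 x else 0
  have hF2c : ∀ x ∉ B, ContinuousAt F2 x := by
    intro x hxB
    rcases lt_trichotomy (ρ x) s with hx | hx | hx
    · refine continuousAt_const (y := (0 : UnitAddCircle)) |>.congr ?_
      filter_upwards [(isOpen_Iio.preimage hρ).mem_nhds hx] with y hy
      exact (if_neg (not_le.2 hy)).symm
    · have h0 : F1 x = 0 := hF1s x hx hxB
      have h2 : F2 x = 0 := by simp [F2, h0]
      rw [ContinuousAt, h2]
      have h1 : Tendsto F1 (𝓝 x) (𝓝 0) := h0 ▸ hF1.continuousAt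
      exact h1.if' tendsto_const_nhds
    · refine hF1.continuousAt.congr ?_
      filter_upwards [(isOpen_Ioi.preimage hρ).mem_nhds hx] with y hy
      exact (if_pos (le_of_lt hy)).symm
  have hF20 : ∀ x ∉ K1 ∪ Kt, F2 x = 0 := by
    intro x hx
    have hx1 : x ∉ interior K1 := fun h => hx (.inl (interior_subset h))
    have hx2 : x ∉ interior Kt := fun h => hx (.inr (interior_subset h))
    simp only [F2, ite_eq_right_iff]
    intro hsx
    rcases le_total t (ρ x) with htx | htx
    · simp [F1, htF x htx hx2]
    · simp [F1, ht0 x htx hx2, hFbad x (.inl (.inr ⟨⟨hsx, htx⟩, hx1⟩)) hsx]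
  obtain ⟨h2, h2c, h2j, h2F⟩ := hB (K1 ∪ Kt) (hK1.union hKt)
    (union_subset hK1j (hKtj.trans inter_subset_left)) F2 hF2c hF20
  refine ⟨fun x => ht' x + h2 x, htc.add h2c, fun x hx => ?_, fun x hsx hxO => ?_,
    fun x hxs hxO => ?_⟩
  · change ht' x + h2 x = 0
    rw [htW x hx, h2j x fun h => hx (hjW h), add_zero]
  · rw [AddCircle.coe_add, h2F x fun h => hxO h.1]
    simp [F2, F1, hsx]
  · rw [AddCircle.coe_add, h2F x fun h => hxO h.1, ht0 x (hxs.trans hst.le) (hKts x hxs), zero_add]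
    simp only [F2, ite_eq_right_iff]
    exact fun hsx => hF1s x (le_antisymm hxs hsx) fun h => hxO (hBO h).1

/-- A circle-valued map supported in a thin enough neighbourhood of an arc in a manifold of
dimension at least two lifts to a real-valued map supported near the arc. -/
theorem exists_isOpen_forall_lift_of_injOn {E X : Type*} [NormedAddCommGroup E] [NormedSpace ℝ E]
    [ProperSpace E] (hE : 1 < Module.rank ℝ E) [TopologicalSpace X] [T2Space X]
    [LocallyCompactSpace X] {C W : Set X} (hC : IsCompact C) (hCne : C.Nonempty)
    (hchart : ∀ x ∈ C, ∃ j : E → X, IsOpenEmbedding j ∧ x ∈ range j ∧ range j ⊆ W)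
    {ρ : X → ℝ} (hρ : Continuous ρ) (hinj : InjOn ρ C) :
    ∃ N, IsOpen N ∧ C ⊆ N ∧ ∀ F : X → UnitAddCircle, Continuous F → (∀ x ∉ N, F x = 0) →
      ∃ h : X → ℝ, Continuous h ∧ (∀ x ∉ W, h x = 0) ∧ ∀ x, (h x : UnitAddCircle) = F x := by
  have hloc : ∀ t : ℝ, ∃ ε > 0, ∀ s s', t - ε < s → s < s' → s' < t + ε →
      LiftableAbove C W ρ s' → LiftableAbove C W ρ s := by
    intro t
    obtain ⟨j, hj, hjW, hCj⟩ : ∃ j : E → X, IsOpenEmbedding j ∧ range j ⊆ W ∧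
        C ∩ ρ ⁻¹' {t} ⊆ range j := by
      by_cases hne : (C ∩ ρ ⁻¹' {t}).Nonempty
      · obtain ⟨x, hx⟩ := hne
        obtain ⟨j, hj, hxj, hjW⟩ := hchart x hx.1
        refine ⟨j, hj, hjW, fun y hy => ?_⟩
        rwa [hinj hy.1 hx.1 (hy.2.trans hx.2.symm)]
      · obtain ⟨x, hx⟩ := hCne
        obtain ⟨j, hj, hxj, hjW⟩ := hchart x hx
        exact ⟨j, hj, hjW, fun y hy => absurd ⟨y, hy⟩ hne⟩
    have hcl : IsClosed (ρ '' (C \ range j)) :=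
      ((hC.diff hj.isOpen_range).image hρ).isClosed
    have htn : t ∉ ρ '' (C \ range j) := by
      rintro ⟨x, hx, hxt⟩
      exact hx.2 (hCj ⟨hx.1, hxt⟩)
    obtain ⟨ε, hε, hεs⟩ := Metric.isOpen_iff.1 hcl.isOpen_compl t htn
    refine ⟨ε, hε, fun s s' h1 h2 h3 => LiftableAbove.of_lt hE hj hC hρ hinj hjW h2 ?_⟩
    rintro x ⟨hxC, hxs⟩
    by_contra hxj
    refine hεs (?_ : ρ x ∈ _) ⟨x, ⟨hxC, hxj⟩, rfl⟩
    rw [Real.ball_eq_Ioo]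
    exact ⟨h1.trans_le hxs.1, hxs.2.trans_lt h3⟩
  obtain ⟨a, ha⟩ := (hC.image hρ).bddBelow
  obtain ⟨b, hb⟩ := (hC.image hρ).bddAbove
  have hb' : LiftableAbove C W ρ (b + 1) := by
    intro O _ _
    refine ⟨∅, isOpen_empty, ?_, fun F _ hF => ⟨0, continuous_zero, fun _ _ => rfl, ?_, ?_⟩⟩
    · rintro x ⟨hxC, hx⟩
      have := hb (mem_image_of_mem ρ hxC)
      have hx' : b + 1 ≤ ρ x := hx
      linarith
    · intro x hx _
      simp [hF x hx (notMem_empty x)]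
    · simp
  have hab : a ≤ b := by
    obtain ⟨x, hx⟩ := hCne
    exact (ha (mem_image_of_mem ρ hx)).trans (hb (mem_image_of_mem ρ hx))
  have hmain : LiftableAbove C W ρ (a - 1) := by
    by_contra hna
    let S := {s | a - 1 ≤ s ∧ LiftableAbove C W ρ s}
    have hSne : S.Nonempty := ⟨b + 1, by linarith, hb'⟩
    have hbd : BddBelow S := ⟨a - 1, fun s hs => hs.1⟩
    obtain ⟨ε, hε, hstep⟩ := hloc (sInf S)
    obtain ⟨s', hs'S, hs'⟩ := exists_lt_of_csInf_lt hSne (show sInf S < sInf S + ε by linarith)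
    have hle : sInf S ≤ s' := csInf_le hbd hs'S
    have hs'a : a - 1 < s' := lt_of_le_of_ne hs'S.1 fun h => hna (h ▸ hs'S.2)
    have hlt : max (a - 1) (sInf S - ε / 2) < s' := max_lt hs'a (by linarith)
    have hLA := hstep _ s' ((by linarith : sInf S - ε < sInf S - ε / 2).trans_le
      (le_max_right (a - 1) _)) hlt hs' hs'S.2
    have hge : sInf S ≤ _ := csInf_le hbd ⟨le_max_left _ _, hLA⟩
    rcases max_cases (a - 1) (sInf S - ε / 2) with h | h
    · exact hna (h.1 ▸ hLA)
    · linarith [h.1]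
  obtain ⟨N, hNo, hCN, hN⟩ := hmain ∅ isOpen_empty fun x hx => by
    have := ha (mem_image_of_mem ρ hx.1)
    have hx' : ρ x = a - 1 := hx.2
    linarith
  refine ⟨N ∩ ρ ⁻¹' Ioi (a - 1), hNo.inter (isOpen_Ioi.preimage hρ), fun x hx => ?_,
    fun F hF hF0 => ?_⟩
  · have := ha (mem_image_of_mem ρ hx)
    have h1 : a - 1 < ρ x := by linarith
    exact ⟨hCN ⟨hx, h1.le⟩, h1⟩
  · obtain ⟨h, hc, hW, h1, h2⟩ := hN F hF fun x _ hx => hF0 x fun h => hx h.1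
    refine ⟨h, hc, hW, fun x => ?_⟩
    rcases le_total (a - 1) (ρ x) with hx | hx
    · exact h1 x hx (notMem_empty x)
    · rw [h2 x hx (notMem_empty x), hF0 x fun h => h.2.not_ge hx]

theorem IsClosed.connectedComponentIn_of_isClosed {X : Type*} [TopologicalSpace X] {T : Set X}
    (hT : IsClosed T) (x : X) : IsClosed (connectedComponentIn T x) := by
  by_cases hx : x ∈ T
  · rw [connectedComponentIn_eq_image hx]
    exact hT.isClosedEmbedding_subtypeVal.isClosedMap _ isClosed_connectedComponent
  · rw [connectedComponentIn_eq_empty hx]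
    exact isClosed_empty

/-- A component of a closed subset of a compact Hausdorff space has arbitrarily small relatively
clopen neighbourhoods. -/
theorem exists_isClosed_diff_of_connectedComponentIn_subset {X : Type*} [TopologicalSpace X]
    [CompactSpace X] [T2Space X] {T N : Set X} (hT : IsClosed T) (hN : IsOpen N) {x : X}
    (hx : x ∈ T) (hxN : connectedComponentIn T x ⊆ N) :
    ∃ A ⊆ N, x ∈ A ∧ IsClosed A ∧ IsClosed (T \ A) := by
  have : CompactSpace T := isCompact_iff_compactSpace.1 hT.isCompact
  let x' : T := ⟨x, hx⟩
  have hne : Nonempty {s : Set T // IsClopen s ∧ x' ∈ s} := ⟨⟨univ, isClopen_univ, mem_univ _⟩⟩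
  obtain ⟨⟨A, hA, hxA⟩, hAN⟩ := exists_subset_nhds_of_isCompact
    (V := fun s : {s : Set T // IsClopen s ∧ x' ∈ s} => (s : Set T)) (U := (↑) ⁻¹' N)
    (fun s t => ⟨⟨s ∩ t, s.2.1.inter t.2.1, s.2.2, t.2.2⟩, inter_subset_left, inter_subset_right⟩)
    (fun s => s.2.1.isClosed.isCompact) (by
      intro y hy
      rw [← connectedComponent_eq_iInter_isClopen x'] at hy
      refine (hN.preimage continuous_subtype_val).mem_nhds (hxN ?_)
      rw [connectedComponentIn_eq_image hx]
      exact mem_image_of_mem _ hy)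
  have hcl := hT.isClosedEmbedding_subtypeVal.isClosedMap
  refine ⟨(↑) '' A, image_subset_iff.2 hAN, ⟨x', hxA, rfl⟩, hcl _ hA.isClosed, ?_⟩
  convert hcl _ hA.compl.isClosed using 1
  ext y
  simp

/-- If circle-valued maps supported near `A` lift to real-valued maps supported in `W`, then an
integer-valued function can be modified inside `W` to become continuous along `A`. -/
theorem exists_continuousAt_of_forall_lift {X : Type*} [TopologicalSpace X] [CompactSpace X]
    [T2Space X] {A S N W : Set X} (hA : IsClosed A) (hS : IsClosed S) (hN : IsOpen N)
    (hAN : A ⊆ N) (hNW : N ⊆ W) (hAS : Disjoint A S)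
    (hlift : ∀ F : X → UnitAddCircle, Continuous F → (∀ x ∉ N, F x = 0) →
      ∃ h : X → ℝ, Continuous h ∧ (∀ x ∉ W, h x = 0) ∧ ∀ x, (h x : UnitAddCircle) = F x)
    {u : X → ℤ} (hu : ∀ x, x ∉ A → x ∉ S → ContinuousAt u x) :
    ∃ v : X → ℤ, (∀ x ∉ S, ContinuousAt v x) ∧ ∀ x ∉ W, v x = u x := by
  obtain ⟨O, hO, hAO, hON⟩ := normal_exists_closure_subset hA (hN.sdiff hS)
    fun x hx => ⟨hAN hx, disjoint_left.1 hAS hx⟩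
  obtain ⟨κ, hκs, hκ1, -⟩ := exists_tsupport_one_of_isOpen_isClosed (hN.sdiff hS)
    isClosed_closure.isCompact isClosed_closure hON
  have hκA : ∀ x ∈ A, ∀ᶠ y in 𝓝 x, κ y = 1 := fun x hx =>
    eventually_of_mem (hO.mem_nhds (hAO hx)) fun y hy => hκ1 (subset_closure hy)
  have hκ0 : ∀ x, x ∉ N \ S → κ x = 0 := fun x hx => image_eq_zero_of_notMem_tsupport
    fun h => hx (hκs h)
  have hu' : ∀ x, x ∉ A → x ∉ S → ContinuousAt (fun y => (u y : ℝ)) x := fun x h1 h2 =>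
    continuous_of_discreteTopology.continuousAt.comp (hu x h1 h2)
  have hcoe : ∀ m : ℤ, ((m : ℝ) : UnitAddCircle) = 0 := fun m =>
    (AddCircle.coe_eq_zero_iff 1).2 ⟨m, by simp⟩
  let F : X → UnitAddCircle := fun x => ((κ x * u x : ℝ) : UnitAddCircle)
  have hF : Continuous F := by
    rw [continuous_iff_continuousAt]
    intro x
    by_cases hxA : x ∈ A
    · refine continuousAt_const (y := (0 : UnitAddCircle)) |>.congr ?_
      filter_upwards [hκA x hxA] with y hy
      simp only [F]
      rw [hy, one_mul, hcoe]
    by_cases hxS : x ∈ S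
    · refine continuousAt_const (y := (0 : UnitAddCircle)) |>.congr ?_
      filter_upwards [(isClosed_tsupport κ).isOpen_compl.mem_nhds fun h => (hκs h).2 hxS] with y hy
      simp only [F]
      rw [image_eq_zero_of_notMem_tsupport hy]
      simp
    · exact (AddCircle.continuous_mk' 1).continuousAt.comp
        (κ.continuous.continuousAt.mul (hu' x hxA hxS))
  obtain ⟨h, hc, hW, hl⟩ := hlift F hF fun x hx => by
    simp only [F]
    rw [hκ0 x fun h => hx h.1]
    simp
  have hv : ∀ x, ∃ m : ℤ, (m : ℝ) = (1 - κ x) * u x + h x := by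
    intro x
    have : (((1 - κ x) * u x + h x : ℝ) : UnitAddCircle) = 0 := by
      rw [AddCircle.coe_add, hl x, ← AddCircle.coe_add, ← hcoe (u x)]
      congr 1
      ring
    obtain ⟨m, hm⟩ := (AddCircle.coe_eq_zero_iff 1).1 this
    exact ⟨m, by simpa using hm⟩
  choose v hv using hv
  refine ⟨v, fun x hxS => ?_, fun x hx => ?_⟩
  · rw [Int.isClosedEmbedding_coe_real.isInducing.continuousAt_iff]
    have : ((↑) ∘ v : X → ℝ) = fun x => (1 - κ x) * u x + h x := funext hv
    rw [this]
    by_cases hxA : x ∈ A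
    · refine hc.continuousAt.congr ?_
      filter_upwards [hκA x hxA] with y hy
      simp [hy]
    · exact ((continuousAt_const.sub κ.continuous.continuousAt).mul (hu' x hxA hxS)).add
        hc.continuousAt
  · have := hv x
    rw [hκ0 x fun h => hx (hNW h.1), hW x hx] at this
    simpa using this

/-- A closed subset of a connected closed manifold of dimension at least two, each of whose
components injects continuously into the real line, does not separate the manifold. -/
theorem isPreconnected_compl_of_forall_connectedComponentIn_injOn {E X : Type*}
    [NormedAddCommGroup E] [NormedSpace ℝ E] [ProperSpace E] (hE : 1 < Module.rank ℝ E)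
    [TopologicalSpace X] [CompactSpace X] [T2Space X] [ConnectedSpace X]
    (hchart : ∀ x : X, ∀ W, IsOpen W → x ∈ W →
      ∃ j : E → X, IsOpenEmbedding j ∧ x ∈ range j ∧ range j ⊆ W)
    {T : Set X} (hT : IsClosed T)
    (hcomp : ∀ x ∈ T, ∃ g : X → ℝ, ContinuousOn g (connectedComponentIn T x) ∧
      InjOn g (connectedComponentIn T x)) : IsPreconnected Tᶜ := by
  intro U V hU hV hTUV ⟨a, haT, haU⟩ ⟨b, hbT, hbV⟩
  by_contra hne
  rw [not_nonempty_iff_eq_empty] at hne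
  let W : Set X := {a, b}ᶜ
  have hW : IsOpen W := (toFinite {a, b}).isClosed.isOpen_compl
  have hTW : T ⊆ W := by
    rintro x hx (rfl | rfl)
    exacts [haT hx, hbT hx]
  have hlocal : ∀ x ∈ T, ∃ A : Set X, x ∈ A ∧ IsClosed A ∧ IsClosed (T \ A) ∧
      ∃ N, IsOpen N ∧ A ⊆ N ∧ N ⊆ W ∧ ∀ F : X → UnitAddCircle, Continuous F →
        (∀ x ∉ N, F x = 0) → ∃ h : X → ℝ, Continuous h ∧ (∀ x ∉ W, h x = 0) ∧
          ∀ x, (h x : UnitAddCircle) = F x := by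
    intro x hx
    obtain ⟨g, hgc, hgi⟩ := hcomp x hx
    have hCc : IsClosed (connectedComponentIn T x) := hT.connectedComponentIn_of_isClosed x
    obtain ⟨ρ, hρ⟩ := ContinuousMap.exists_restrict_eq hCc
      ⟨_, continuousOn_iff_continuous_domRestrict.1 hgc⟩
    have hρg : ∀ y ∈ connectedComponentIn T x, ρ y = g y := fun y hy =>
      congrArg (fun φ => φ ⟨y, hy⟩) hρ
    obtain ⟨N, hN, hCN, hlift⟩ := exists_isOpen_forall_lift_of_injOn (W := W) hE hCc.isCompact
      ⟨x, mem_connectedComponentIn hx⟩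
      (fun y hy => hchart y W hW (hTW (connectedComponentIn_subset T x hy))) ρ.continuous
      (fun y hy z hz hyz => hgi hy hz (by rw [← hρg y hy, ← hρg z hz, hyz]))
    obtain ⟨A, hAN, hxA, hAc, hTA⟩ := exists_isClosed_diff_of_connectedComponentIn_subset hT
      (hN.inter hW) hx
      (subset_inter hCN ((connectedComponentIn_subset T x).trans hTW))
    exact ⟨A, hxA, hAc, hTA, N ∩ W, hN.inter hW, hAN, inter_subset_right,
      fun F hF hF0 => hlift F hF fun y hy => hF0 y fun h => hy h.1⟩
  choose! A hxA hAc hTA N hN hAN hNW hlift using hlocal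
  obtain ⟨t, ht⟩ := hT.isCompact.elim_nhds_subcover' (fun x _ => (T \ A x)ᶜ)
    fun x hx => (hTA x hx).isOpen_compl.mem_nhds fun h => h.2 (hxA x hx)
  classical
  let u : X → ℤ := fun x => if x ∈ U then 1 else 0
  have hu : ∀ x ∉ T, ContinuousAt u x := by
    intro x hx
    rcases hTUV hx with hxU | hxV
    · refine continuousAt_const (y := (1 : ℤ)) |>.congr ?_
      filter_upwards [hU.mem_nhds hxU] with y hy
      exact (if_pos hy).symm
    · refine continuousAt_const (y := (0 : ℤ)) |>.congr ?_
      filter_upwards [hV.mem_nhds hxV, hT.isOpen_compl.mem_nhds hx] with y hy hyT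
      refine (if_neg fun hyU => ?_).symm
      exact (hne.subset ⟨hyT, hyU, hy⟩ : y ∈ (∅ : Set X))
  have hind : ∀ s : Finset T, ∃ v : X → ℤ, (∀ x, (x ∈ T → ∃ i ∈ s, x ∈ A i) → ContinuousAt v x) ∧
      ∀ x ∉ W, v x = u x := by
    intro s
    induction s using Finset.induction_on with
    | empty => exact ⟨u, fun x hx => hu x fun h => by simpa using hx h, fun _ _ => rfl⟩
    | insert i s _ ih =>
      obtain ⟨v, hv, hvu⟩ := ih
      let S : Set X := ⋂ k ∈ insert i s, T \ A k
      have hS : ∀ x, x ∈ S ↔ ∀ k ∈ insert i s, x ∈ T \ A k := fun x => mem_iInter₂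
      have hSc : IsClosed S := isClosed_biInter fun k _ => hTA k k.2
      obtain ⟨w, hw, hwv⟩ := exists_continuousAt_of_forall_lift (u := v) (hAc i i.2) hSc (hN i i.2)
        (hAN i i.2) (hNW i i.2)
        (disjoint_left.2 fun x hx hxS => ((hS x).1 hxS i (Finset.mem_insert_self i s)).2 hx)
        (hlift i i.2) (fun x hxA hxS => hv x fun hxT => by
          by_contra! hno
          refine hxS ((hS x).2 fun k hk => ⟨hxT, ?_⟩)
          rcases Finset.mem_insert.1 hk with rfl | hk
          exacts [hxA, hno k hk])
      refine ⟨w, fun x hx => hw x fun hxS => ?_, fun x hx => (hwv x hx).trans (hvu x hx)⟩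
      obtain ⟨k, hk, hxk⟩ := hx ((hS x).1 hxS i (Finset.mem_insert_self i s)).1
      exact ((hS x).1 hxS k hk).2 hxk
  obtain ⟨v, hv, hvu⟩ := hind t
  have hvc : Continuous v := continuous_iff_continuousAt.2 fun x => hv x fun hx => by
    obtain ⟨i, hi, hxi⟩ := mem_iUnion₂.1 (ht hx)
    exact ⟨i, hi, by_contra fun h => hxi ⟨hx, h⟩⟩
  have hab : v a = v b := PreconnectedSpace.constant inferInstance hvc
  have hbU : b ∉ U := fun h => (hne.subset ⟨hbT, h, hbV⟩ : b ∈ (∅ : Set X))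
  rw [hvu a (by simp [W]), hvu b (by simp [W])] at hab
  simp [u, haU, hbU] at hab

/-- A point with a neighbourhood homeomorphic to a normed space has arbitrarily small such
neighbourhoods. -/
theorem exists_isOpenEmbedding_range_subset {E X : Type*} [NormedAddCommGroup E]
    [NormedSpace ℝ E] [TopologicalSpace X] {x : X} {U W : Set X} (hU : IsOpen U) (hxU : x ∈ U)
    (e : U ≃ₜ E) (hW : IsOpen W) (hxW : x ∈ W) :
    ∃ j : E → X, IsOpenEmbedding j ∧ x ∈ range j ∧ range j ⊆ W := by
  let i : E → X := fun y => (e.symm y : X)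
  have hi : IsOpenEmbedding i := hU.isOpenEmbedding_subtypeVal.comp e.symm.isOpenEmbedding
  let c : E := e ⟨x, hxU⟩
  have hic : i c = x := by simp [i, c]
  obtain ⟨δ, hδ, hδW⟩ := Metric.isOpen_iff.1 (hW.preimage hi.continuous) c
    (by rwa [mem_preimage, hic])
  let φ := OpenPartialHomeomorph.univBall c δ
  have hφ : IsOpenEmbedding φ := φ.isOpenEmbedding (OpenPartialHomeomorph.univBall_source c δ)
  refine ⟨i ∘ φ, hi.comp hφ, ⟨0, ?_⟩, ?_⟩
  · simp [φ, hic]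
  · rintro _ ⟨y, rfl⟩
    apply hδW
    rw [← OpenPartialHomeomorph.univBall_target c hδ]
    exact φ.map_source (by simp [φ])

/-- If removing a point splits a connected space into two disjoint open sets, then the complement
of either of them is connected. -/
theorem isPreconnected_compl_of_isOpen_of_insert {X : Type*} [TopologicalSpace X]
    [PreconnectedSpace X] {A B : Set X} {x : X} (hA : IsOpen A) (hB : IsOpen B)
    (hAB : Disjoint A B) (hx : insert x (A ∪ B) = univ) (hxA : x ∉ A) (hxB : x ∉ B) :
    IsPreconnected Bᶜ := by
  have key : ∀ P Q : Set X, IsOpen P → IsOpen Q → Bᶜ ⊆ P ∪ Q → x ∈ P → (Bᶜ ∩ Q).Nonempty →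
      (Bᶜ ∩ (P ∩ Q)).Nonempty := by
    intro P Q hP hQ hPQ hxP ⟨z, hzB, hzQ⟩
    by_contra hne
    have hdisj : ∀ w, w ∉ B → w ∈ P → w ∉ Q := fun w h1 h2 h3 => hne ⟨w, h1, h2, h3⟩
    have hcompl : (A ∩ Q)ᶜ = B ∪ P := by
      ext w
      have hw : w = x ∨ w ∈ A ∨ w ∈ B := by simpa using hx.symm.subset (mem_univ w)
      have h1 : w ∈ A → w ∉ B := fun h => disjoint_left.1 hAB h
      have h2 := hdisj w
      have h3 : w ∉ B → w ∈ P ∨ w ∈ Q := fun h => hPQ h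
      have h4 : w = x → w ∈ P ∧ w ∉ A := by rintro rfl; exact ⟨hxP, hxA⟩
      simp only [mem_compl_iff, mem_inter_iff, mem_union]
      tauto
    have hclopen : IsClopen (A ∩ Q) :=
      ⟨⟨hcompl ▸ hB.union hP⟩, hA.inter hQ⟩
    have hzA : z ∈ A := by
      have hz : z = x ∨ z ∈ A ∨ z ∈ B := by simpa using hx.symm.subset (mem_univ z)
      rcases hz with rfl | h | h
      exacts [absurd hzQ (hdisj _ hzB hxP), h, absurd h hzB]
    have huniv := hclopen.eq_univ ⟨z, hzA, hzQ⟩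
    exact hxA (huniv.symm.subset (mem_univ x)).1
  intro P Q hP hQ hPQ hPne hQne
  rcases hPQ hxB with hxP | hxQ
  · exact key P Q hP hQ hPQ hxP hQne
  · rw [inter_comm P Q]
    exact key Q P hQ hP (union_comm P Q ▸ hPQ) hxQ hPne

/-- An injective real-valued function on a connected `T₁` space that preserves connectedness is
continuous. -/
theorem continuous_of_injective_of_forall_isPreconnected_image {X : Type*} [TopologicalSpace X]
    [PreconnectedSpace X] [T1Space X] {g : X → ℝ} (hg : Function.Injective g)
    (hd : ∀ S, IsPreconnected S → IsPreconnected (g '' S)) : Continuous g := by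
  have hrange : OrdConnected (range g) := by
    rw [← image_univ]
    exact (hd univ isPreconnected_univ).ordConnected
  have key : ∀ (A B : Set X) (x : X), IsOpen A → IsOpen B → Disjoint A B →
      A ∪ B = {x}ᶜ → B.Nonempty → (∃ p ∈ A, g p < g x) →
      IsOpen (g ⁻¹' Ioi (g x)) ∧ IsOpen (g ⁻¹' Iio (g x)) := by
    intro A B x hA hB hAB hx ⟨q, hq⟩ ⟨p, hp, hpx⟩
    have hxA : x ∉ A := fun h => (hx.subset (.inl h) : x ∈ ({x} : Set X)ᶜ) rfl
    have hxB : x ∉ B := fun h => (hx.subset (.inr h) : x ∈ ({x} : Set X)ᶜ) rfl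
    have hun : insert x (A ∪ B) = univ := by
      rw [hx]
      ext z
      simpa using em (z = x)
    have hcA : OrdConnected (g '' Bᶜ) :=
      (hd _ (isPreconnected_compl_of_isOpen_of_insert hA hB hAB hun hxA hxB)).ordConnected
    have hcB : OrdConnected (g '' Aᶜ) :=
      (hd _ (isPreconnected_compl_of_isOpen_of_insert hB hA hAB.symm (union_comm A B ▸ hun)
        hxB hxA)).ordConnected
    have hxA' := mem_image_of_mem g (show x ∈ Aᶜ from hxA)
    have hxB' := mem_image_of_mem g (show x ∈ Bᶜ from hxB)
    have hA' : ∀ z ∈ A, g z ∈ g '' Bᶜ ∧ g z ∉ g '' Aᶜ := fun z hz =>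
      ⟨⟨z, disjoint_left.1 hAB hz, rfl⟩, fun ⟨w, hw, hwz⟩ => hw (hg hwz ▸ hz)⟩
    have hB' : ∀ z ∈ B, g z ∈ g '' Aᶜ ∧ g z ∉ g '' Bᶜ := fun z hz =>
      ⟨⟨z, disjoint_right.1 hAB hz, rfl⟩, fun ⟨w, hw, hwz⟩ => hw (hg hwz ▸ hz)⟩
    have hBx : ∀ z ∈ B, g x < g z := by
      intro z hz
      by_contra! hle
      rcases le_total (g p) (g z) with h | h
      · exact (hB' z hz).2 (hcA.out (hA' p hp).1 hxB' ⟨h, hle⟩)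
      · exact (hA' p hp).2 (hcB.out (hB' z hz).1 hxA' ⟨h, hpx.le⟩)
    have hAx : ∀ z ∈ A, g z < g x := by
      intro z hz
      by_contra! hle
      rcases le_total (g q) (g z) with h | h
      · exact (hB' q hq).2 (hcA.out hxB' (hA' z hz).1 ⟨(hBx q hq).le, h⟩)
      · exact (hA' z hz).2 (hcB.out hxA' (hB' q hq).1 ⟨hle, h⟩)
    have hmem : ∀ z, z ≠ x → z ∈ A ∨ z ∈ B := fun z hz => hx.symm.subset hz
    constructor
    · convert hB using 1
      ext z
      refine ⟨fun h => (hmem z ?_).resolve_left fun hz => lt_asymm h (hAx z hz), hBx z⟩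
      rintro rfl
      exact lt_irrefl (g z) h
    · convert hA using 1
      ext z
      refine ⟨fun h => (hmem z ?_).resolve_right fun hz => lt_asymm h (hBx z hz), hAx z⟩
      rintro rfl
      exact lt_irrefl (g z) h
  rw [OrderTopology.continuous_iff]
  intro y
  by_cases hlow : ∃ c, g c < y
  swap
  · push Not at hlow
    constructor
    · by_cases hy : ∃ x, g x = y
      · obtain ⟨x, rfl⟩ := hy
        convert (isOpen_compl_singleton (x := x)) using 1
        ext z
        exact ⟨fun h hz => lt_irrefl (g x) (by rw [hz] at h; exact h),
          fun h => lt_of_le_of_ne (hlow z) fun h' => h (hg h'.symm)⟩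
      · convert isOpen_univ using 1
        exact eq_univ_of_forall fun z => lt_of_le_of_ne (hlow z) fun h => hy ⟨z, h.symm⟩
    · convert isOpen_empty using 1
      exact eq_empty_of_forall_notMem fun z hz => (hlow z).not_gt hz
  by_cases hup : ∃ c, y < g c
  swap
  · push Not at hup
    constructor
    · convert isOpen_empty using 1
      exact eq_empty_of_forall_notMem fun z hz => (hup z).not_gt hz
    · by_cases hy : ∃ x, g x = y
      · obtain ⟨x, rfl⟩ := hy
        convert (isOpen_compl_singleton (x := x)) using 1
        ext z
        exact ⟨fun h hz => lt_irrefl (g x) (by rw [hz] at h; exact h),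
          fun h => lt_of_le_of_ne (hup z) fun h' => h (hg h')⟩
      · convert isOpen_univ using 1
        exact eq_univ_of_forall fun z => lt_of_le_of_ne (hup z) fun h => hy ⟨z, h⟩
  obtain ⟨c, hc⟩ := hlow
  obtain ⟨d, hdy⟩ := hup
  obtain ⟨x, rfl⟩ := hrange.out (mem_range_self c) (mem_range_self d) ⟨hc.le, hdy.le⟩
  have hnot : ¬ IsPreconnected ({x}ᶜ : Set X) := by
    intro h
    obtain ⟨z, hz, hzx⟩ := (hd _ h).ordConnected.out
      (mem_image_of_mem g (show c ∈ ({x}ᶜ : Set X) from fun h => hc.ne (congrArg g h)))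
      (mem_image_of_mem g (show d ∈ ({x}ᶜ : Set X) from fun h => hdy.ne' (congrArg g h)))
      ⟨hc.le, hdy.le⟩
    exact hz (hg hzx)
  simp only [IsPreconnected, not_forall] at hnot
  obtain ⟨U, V, hU, hV, hUV, ⟨p, hpx, hpU⟩, ⟨q, hqx, hqV⟩, hne⟩ := hnot
  have hdisj : Disjoint (U \ {x}) (V \ {x}) :=
    disjoint_left.2 fun z hz hz' => hne ⟨z, hz.2, hz.1, hz'.1⟩
  have hU' : IsOpen (U \ {x}) := hU.sdiff isClosed_singleton
  have hV' : IsOpen (V \ {x}) := hV.sdiff isClosed_singleton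
  have hun : U \ {x} ∪ V \ {x} = {x}ᶜ := by
    rw [← union_sdiff_distrib]
    exact subset_antisymm (fun z hz => hz.2) fun z hz => ⟨hUV hz, hz⟩
  rcases hun.symm.subset (show c ∈ ({x}ᶜ : Set X) from fun h => hc.ne (congrArg g h)) with h | h
  · exact key _ _ x hU' hV' hdisj hun ⟨q, hqV, hqx⟩ ⟨c, h, hc⟩
  · exact key _ _ x hV' hU' hdisj.symm (union_comm _ _ ▸ hun) ⟨p, hpU, hpx⟩ ⟨c, h, hc⟩

/-- Every point of a surface, possibly with boundary, has small circular neighbourhoods: the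
sublevel sets of a continuous function `M` which near the point is the squared Euclidean norm of a
planar chart `q`. -/
theorem exists_circular_neighbourhoods {Y : Type*} [TopologicalSpace Y] [T2Space Y] {y : Y}
    {U : Set Y} (hU : IsOpen U) (hyU : y ∈ U) {V : Set ({p : ℝ × ℝ | 0 ≤ p.1})} (hV : IsOpen V)
    (e : U ≃ₜ V) :
    ∃ (M : Y → ℝ) (q : Y → ℝ × ℝ) (r : ℝ), 0 < r ∧ Continuous M ∧ (∀ p, 0 ≤ M p) ∧
      (∀ p, M p = 0 ↔ p = y) ∧ ContinuousOn q {p | M p < r} ∧ InjOn q {p | M p < r} ∧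
      (∀ p, M p < r → M p = (q p).1 ^ 2 + (q p).2 ^ 2) ∧
      ∀ O ∈ 𝓝 y, ∃ s > 0, {p | M p < s} ⊆ O := by
  classical
  let H := {p : ℝ × ℝ | 0 ≤ p.1}
  let c : V := e ⟨y, hyU⟩
  let N : ℝ × ℝ → ℝ := fun p => (p.1 - c.1.1.1) ^ 2 + (p.2 - c.1.1.2) ^ 2
  have hN : Continuous N := by fun_prop
  have hdist : ∀ p δ, 0 ≤ δ → N p ≤ δ ^ 2 → dist p c.1.1 ≤ δ := by
    intro p δ hδ hp
    rw [Prod.dist_eq, Real.dist_eq, Real.dist_eq]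
    exact max_le (abs_le_of_sq_le_sq (by nlinarith [sq_nonneg (p.2 - c.1.1.2)]) hδ)
      (abs_le_of_sq_le_sq (by nlinarith [sq_nonneg (p.1 - c.1.1.1)]) hδ)
  have hN0 : ∀ p, N p = 0 → p = c.1.1 := fun p hp =>
    dist_le_zero.1 (hdist p 0 le_rfl (by simp [hp]))
  obtain ⟨δ, hδ, hδV⟩ := Metric.isOpen_iff.1 hV c.1 c.2
  let r : ℝ := (δ / 2) ^ 2
  have hr : 0 < r := by positivity
  have hHV : ∀ p : H, N p ≤ r → p ∈ V := fun p hp => hδV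
    (lt_of_le_of_lt (hdist p (δ / 2) (by positivity) hp) (by linarith))
  have hcpt : IsCompact {v : V | N v.1.1 ≤ r} := by
    rw [IsInducing.subtypeVal.isCompact_iff, IsInducing.subtypeVal.isCompact_iff]
    refine (isCompact_closedBall c.1.1 (δ / 2)).of_isClosed_subset ?_ ?_
    · have : (Subtype.val '' (Subtype.val '' {v : V | N v.1.1 ≤ r}) : Set (ℝ × ℝ)) =
          {p | 0 ≤ p.1} ∩ {p | N p ≤ r} := by
        ext p
        constructor
        · rintro ⟨_, ⟨v, hv, rfl⟩, rfl⟩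
          exact ⟨v.1.2, hv⟩
        · rintro ⟨hp, hpN⟩
          exact ⟨⟨p, hp⟩, ⟨⟨⟨p, hp⟩, hHV ⟨p, hp⟩ hpN⟩, hpN, rfl⟩, rfl⟩
      rw [this]
      exact (isClosed_le continuous_const continuous_fst).inter (isClosed_le hN continuous_const)
    · rintro _ ⟨_, ⟨v, hv, rfl⟩, rfl⟩
      exact hdist _ _ (by positivity) hv
  let φ : U → ℝ × ℝ := fun p => (e p).1.1
  have hφ : Continuous φ := continuous_subtype_val.comp (continuous_subtype_val.comp e.continuous)
  have hφi : Function.Injective φ :=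
    Subtype.val_injective.comp (Subtype.val_injective.comp e.injective)
  let i : V → Y := fun v => (e.symm v : Y)
  have hi : Continuous i := continuous_subtype_val.comp e.symm.continuous
  have hie : ∀ p : U, i (e p) = p := fun p => by simp [i]
  let M : Y → ℝ := fun p => if h : p ∈ U then min (N (φ ⟨p, h⟩)) r else r
  let q : Y → ℝ × ℝ := fun p => if h : p ∈ U then φ ⟨p, h⟩ - c.1.1 else 0
  have hMU : ∀ p : U, M p = min (N (φ p)) r := fun p => dif_pos p.2
  have hqU : ∀ p : U, q p = φ p - c.1.1 := fun p => dif_pos p.2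
  have hMlt : ∀ p, M p < r → ∃ p' : U, p = p' ∧ M p = N (φ p') := by
    intro p hp
    by_cases h : p ∈ U
    · refine ⟨⟨p, h⟩, rfl, ?_⟩
      have h1 := hMU ⟨p, h⟩
      change M p = _ at h1
      rw [h1] at hp ⊢
      exact min_eq_left (le_of_not_ge fun h' => by rw [min_eq_right h'] at hp; exact hp.false)
    · exact absurd ((dif_neg h : M p = r) ▸ hp) (lt_irrefl r)
  have hNφ : ∀ p : U, N (φ p) = (q p).1 ^ 2 + (q p).2 ^ 2 := fun p => by rw [hqU]; rfl
  refine ⟨M, q, r, hr, ?_, ?_, ?_, ?_, ?_, ?_, ?_⟩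
  · rw [continuous_iff_continuousAt]
    intro p
    by_cases h : p ∈ U
    · have hUe := hU.isOpenEmbedding_subtypeVal
      rw [show p = ((⟨p, h⟩ : U) : Y) from rfl, ← hUe.continuousAt_iff]
      have : (M ∘ Subtype.val : U → ℝ) = fun p => min (N (φ p)) r := funext hMU
      rw [this]
      exact ((hN.comp hφ).min continuous_const).continuousAt
    · refine continuousAt_const (y := r) |>.congr ?_
      filter_upwards [(hcpt.image hi).isClosed.isOpen_compl.mem_nhds
        (by rintro ⟨v, _, rfl⟩; exact h (e.symm v).2)] with z hz
      by_contra hne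
      have hzr : M z < r := by
        refine lt_of_le_of_ne ?_ (Ne.symm hne)
        by_cases h' : z ∈ U
        · exact (hMU ⟨z, h'⟩).trans_le (min_le_right _ _)
        · exact (dif_neg h' : M z = r).le
      obtain ⟨z', rfl, hz'⟩ := hMlt z hzr
      exact hz ⟨e z', hz'.symm.trans_le hzr.le, hie z'⟩
  · intro p
    by_contra! hlt
    obtain ⟨p', rfl, hp'⟩ := hMlt p (hlt.trans hr)
    rw [hp', hNφ] at hlt
    exact hlt.not_ge (by positivity)
  · intro p
    constructor
    · intro hp
      obtain ⟨p', rfl, hp'⟩ := hMlt p (hp ▸ hr)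
      have h1 : φ p' = φ ⟨y, hyU⟩ := hN0 _ (hp' ▸ hp)
      exact congrArg Subtype.val (hφi h1)
    · rintro rfl
      rw [show p = ((⟨p, hyU⟩ : U) : Y) from rfl, hMU]
      simp [N, φ, c, hr.le]
  · intro p hp
    obtain ⟨p', rfl, -⟩ := hMlt p hp
    refine ContinuousAt.continuousWithinAt ?_
    rw [← hU.isOpenEmbedding_subtypeVal.continuousAt_iff]
    have : (q ∘ Subtype.val : U → ℝ × ℝ) = fun p => φ p - c.1.1 := funext hqU
    rw [this]
    exact (hφ.sub continuous_const).continuousAt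
  · intro p hp p₂ hp₂ heq
    obtain ⟨p', rfl, -⟩ := hMlt p hp
    obtain ⟨p₂', rfl, -⟩ := hMlt p₂ hp₂
    rw [hqU, hqU] at heq
    rw [hφi (sub_left_injective heq)]
  · intro p hp
    obtain ⟨p', rfl, hp'⟩ := hMlt p hp
    rw [hp', hNφ]
  · intro O hO
    have hic : i c = y := hie ⟨y, hyU⟩
    obtain ⟨ε, hε, hεO⟩ := Metric.mem_nhds_iff.1 (hi.continuousAt.preimage_mem_nhds (hic ▸ hO))
    refine ⟨min r ((ε / 2) ^ 2), lt_min hr (by positivity), fun p hp => ?_⟩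
    obtain ⟨p', rfl, hp'⟩ := hMlt p (hp.trans_le (min_le_left _ _))
    rw [← hie p']
    refine hεO (lt_of_le_of_lt (hdist _ (ε / 2) (by positivity) ?_) (by linarith) : dist _ _ < ε)
    exact hp' ▸ (hp.trans_le (min_le_right _ _)).le

/-- Stereographic projection of a circle centred at the origin is injective. -/
theorem eq_of_stereographic_eq {a b s u v u' v' : ℝ} (hs : 0 < s) (hab : a ^ 2 + b ^ 2 = s)
    (huv : u ^ 2 + v ^ 2 = s) (huv' : u' ^ 2 + v' ^ 2 = s) (h : s - (a * u + b * v) ≠ 0)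
    (h' : s - (a * u' + b * v') ≠ 0)
    (heq : (a * v - b * u) / (s - (a * u + b * v)) = (a * v' - b * u') / (s - (a * u' + b * v'))) :
    u = u' ∧ v = v' := by
  have key : ∀ {u v τ : ℝ}, u ^ 2 + v ^ 2 = s → s - (a * u + b * v) ≠ 0 →
      (a * v - b * u) / (s - (a * u + b * v)) = τ →
      a * v - b * u = τ * (s - (a * u + b * v)) ∧
        (a * u + b * v) * (1 + τ ^ 2) = s * (τ ^ 2 - 1) := by
    intro u v τ huv h hτ
    have hd := (div_eq_iff h).1 hτ
    refine ⟨hd, mul_left_cancel₀ h ?_⟩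
    have hsq : (a * u + b * v) ^ 2 + (a * v - b * u) ^ 2 = s ^ 2 := by
      rw [show s ^ 2 = (a ^ 2 + b ^ 2) * (u ^ 2 + v ^ 2) by rw [hab, huv, sq]]
      ring
    rw [hd] at hsq
    linear_combination -hsq
  obtain ⟨hd, hc⟩ := key huv h heq
  obtain ⟨hd', hc'⟩ := key huv' h' rfl
  have hτ : (1 + ((a * v' - b * u') / (s - (a * u' + b * v'))) ^ 2) ≠ 0 := by positivity
  have hcc : a * u + b * v = a * u' + b * v' := mul_right_cancel₀ hτ (hc.trans hc'.symm)
  have hdd : a * v - b * u = a * v' - b * u' := by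
    rw [hcc] at hd
    exact hd.trans hd'.symm
  constructor
  · refine mul_left_cancel₀ hs.ne' ?_
    rw [← hab]
    linear_combination a * hcc - b * hdd
  · refine mul_left_cancel₀ hs.ne' ?_
    rw [← hab]
    linear_combination b * hcc + a * hdd

/-- A circle without a point has a continuous injection into the real line. -/
theorem exists_continuousOn_injOn_of_circle {Y : Type*} [TopologicalSpace Y] {q : Y → ℝ × ℝ}
    {Z : Set Y} {s : ℝ} (hs : 0 < s) (hq : ContinuousOn q Z) (hqi : InjOn q Z)
    (hqs : ∀ p ∈ Z, (q p).1 ^ 2 + (q p).2 ^ 2 = s) {p₀ : Y} (hp₀ : p₀ ∈ Z) :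
    ∃ θ : Y → ℝ, ContinuousOn θ (Z \ {p₀}) ∧ InjOn θ (Z \ {p₀}) := by
  have hne : ∀ p ∈ Z \ {p₀},
      s - ((q p₀).1 * (q p).1 + (q p₀).2 * (q p).2) ≠ 0 := by
    rintro p ⟨hp, hpp⟩ h0
    refine hpp (hqi hp hp₀ ?_)
    have h1 := hqs p hp
    have h2 := hqs p₀ hp₀
    have h3 : ((q p).1 - (q p₀).1) ^ 2 + ((q p).2 - (q p₀).2) ^ 2 = 0 := by
      linear_combination h1 + h2 + 2 * h0
    have h4 : (q p).1 - (q p₀).1 = 0 := by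
      nlinarith only [h3, sq_nonneg ((q p).1 - (q p₀).1), sq_nonneg ((q p).2 - (q p₀).2)]
    have h5 : (q p).2 - (q p₀).2 = 0 := by
      nlinarith only [h3, sq_nonneg ((q p).1 - (q p₀).1), sq_nonneg ((q p).2 - (q p₀).2)]
    exact Prod.ext (sub_eq_zero.1 h4) (sub_eq_zero.1 h5)
  have hq' : ContinuousOn q (Z \ {p₀}) := hq.mono sdiff_subset
  refine ⟨fun p => ((q p₀).1 * (q p).2 - (q p₀).2 * (q p).1) /
    (s - ((q p₀).1 * (q p).1 + (q p₀).2 * (q p).2)), ?_, ?_⟩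
  · exact ContinuousOn.div (by fun_prop) (by fun_prop) hne
  · intro p hp p' hp' heq
    obtain ⟨h1, h2⟩ := eq_of_stereographic_eq hs (hqs p₀ hp₀) (hqs p hp.1) (hqs p' hp'.1)
      (hne p hp) (hne p' hp') heq
    exact hqi hp.1 hp'.1 (Prod.ext h1 h2)

/-- If closed sets whose components inject into the line do not separate `X`, then the preimage
under a Darboux injection of a separating circle is closed, and the circle lies in the range. -/
theorem isClosed_preimage_and_subset_range_of_circle {X Y : Type*} [TopologicalSpace X]
    [T1Space X] [CompletelyNormalSpace X] [TopologicalSpace Y]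
    (hsep : ∀ T : Set X, IsClosed T → (∀ x ∈ T, ∃ g : X → ℝ,
      ContinuousOn g (connectedComponentIn T x) ∧ InjOn g (connectedComponentIn T x)) →
        IsPreconnected Tᶜ)
    {f : X → Y} (hinj : Function.Injective f)
    (hd : ∀ C : Set X, IsPreconnected C → IsPreconnected (f '' C))
    {M : Y → ℝ} (hM : Continuous M) {q : Y → ℝ × ℝ} {s : ℝ} (hs : 0 < s)
    (hq : ContinuousOn q {p | M p = s}) (hqi : InjOn q {p | M p = s})
    (hqs : ∀ p ∈ {p | M p = s}, (q p).1 ^ 2 + (q p).2 ^ 2 = s)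
    {x x' : X} (hx : M (f x) < s) (hx' : s < M (f x')) :
    IsClosed (f ⁻¹' {p | M p = s}) ∧ {p | M p = s} ⊆ range f := by
  set Z := f ⁻¹' {p | M p = s}
  have hnot : ¬ IsPreconnected Zᶜ := by
    intro h
    obtain ⟨_, ⟨z, hz, rfl⟩, hzs⟩ := ((hd _ h).image M hM.continuousOn).ordConnected.out
      (mem_image_of_mem M (mem_image_of_mem f (show x ∈ Zᶜ from hx.ne)))
      (mem_image_of_mem M (mem_image_of_mem f (show x' ∈ Zᶜ from hx'.ne'))) ⟨hx.le, hx'.le⟩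
    exact hz hzs
  simp only [IsPreconnected, not_forall] at hnot
  obtain ⟨U, V, hU, hV, hUV, ⟨a, haZ, haU⟩, ⟨b, hbZ, hbV⟩, hne⟩ := hnot
  have hdis := CompletelyNormalSpace.completely_normal (s := Zᶜ ∩ U) (t := Zᶜ ∩ V)
    (disjoint_left.2 fun z hz hzV => by
      obtain ⟨w, hwV, hwZ, hwU⟩ := mem_closure_iff.1 hz V hV hzV.2
      exact hne ⟨w, hwZ, hwU, hwV⟩)
    (disjoint_left.2 fun z hzU hz => by
      obtain ⟨w, hwU, hwZ, hwV⟩ := mem_closure_iff.1 hz U hU hzU.2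
      exact hne ⟨w, hwZ, hwU, hwV⟩)
  obtain ⟨U', V', hU', hV', hUU', hVV', hdisj⟩ := separatedNhds_iff_disjoint.2 hdis
  have hT : IsClosed (U' ∪ V')ᶜ := (hU'.union hV').isClosed_compl
  have hTZ : (U' ∪ V')ᶜ ⊆ Z := by
    intro z hz
    by_contra hzZ
    rcases hUV hzZ with h | h
    exacts [hz (.inl (hUU' ⟨hzZ, h⟩)), hz (.inr (hVV' ⟨hzZ, h⟩))]
  have hTs : ¬ IsPreconnected (U' ∪ V')ᶜᶜ := by
    rw [compl_compl]
    intro h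
    obtain ⟨z, -, hzU, hzV⟩ := h U' V' hU' hV' Subset.rfl ⟨a, .inl (hUU' ⟨haZ, haU⟩), hUU' ⟨haZ, haU⟩⟩
      ⟨b, .inr (hVV' ⟨hbZ, hbV⟩), hVV' ⟨hbZ, hbV⟩⟩
    exact disjoint_left.1 hdisj hzU hzV
  have hcover : {p | M p = s} ⊆ f '' (U' ∪ V')ᶜ := by
    intro p₀ hp₀
    by_contra hp₀T
    obtain ⟨θ, hθ, hθi⟩ := exists_continuousOn_injOn_of_circle hs hq hqi hqs hp₀
    refine hTs (hsep _ hT fun z _ => ⟨θ ∘ f, ?_, ?_⟩)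
    all_goals
      have hmaps : ∀ w ∈ connectedComponentIn (U' ∪ V')ᶜ z, f w ∈ {p | M p = s} \ {p₀} :=
        fun w hw => ⟨hTZ (connectedComponentIn_subset _ _ hw), fun h =>
          hp₀T ⟨w, connectedComponentIn_subset _ _ hw, h⟩⟩
    · rw [continuousOn_iff_continuous_domRestrict]
      have : PreconnectedSpace (connectedComponentIn (U' ∪ V')ᶜ z) :=
        isPreconnected_iff_preconnectedSpace.1 isPreconnected_connectedComponentIn
      refine continuous_of_injective_of_forall_isPreconnected_image (fun w w' h => ?_)
        fun S hS => ?_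
      · exact Subtype.ext (hinj (hθi (hmaps w w.2) (hmaps w' w'.2) h))
      · have h1 := (hd _ (hS.image _ continuous_subtype_val.continuousOn)).image θ
          (hθ.mono (by
            rintro _ ⟨_, ⟨w, _, rfl⟩, rfl⟩
            exact hmaps w w.2))
        rw [image_image, image_image] at h1
        exact h1
    · exact fun w hw w' hw' h => hinj (hθi (hmaps w hw) (hmaps w' hw') h)
  refine ⟨?_, hcover.trans (image_subset_range _ _)⟩
  have : Z = (U' ∪ V')ᶜ := by
    refine subset_antisymm (fun z hz => ?_) hTZ
    obtain ⟨w, hw, hwz⟩ := hcover hz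
    exact hinj hwz ▸ hw
  rwa [this]

/-- Every Darboux injection `f : X → Y` from a connected closed `n`-manifold `X` of
dimension `n ≥ 2` (a compact metrizable space each of whose points has an open
neighborhood homeomorphic to `ℝⁿ`) to a 2-manifold `Y` (a metrizable space each of
whose points has an open neighborhood homeomorphic to an open subset of the
half-plane `[0, ∞) × ℝ`) is an open topological embedding. -/
theorem darboux_injection_closed_manifold_to_two_manifold_isOpenEmbedding {X Y : Type*}
    [TopologicalSpace X] [CompactSpace X] [TopologicalSpace.MetrizableSpace X]
    [ConnectedSpace X] [TopologicalSpace Y] [TopologicalSpace.MetrizableSpace Y]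
    (n : ℕ) (hn : 2 ≤ n)
    (hX : ∀ x : X, ∃ U : Set X, IsOpen U ∧ x ∈ U ∧
      Nonempty (U ≃ₜ EuclideanSpace ℝ (Fin n)))
    (hY : ∀ y : Y, ∃ U : Set Y, IsOpen U ∧ y ∈ U ∧
      ∃ V : Set ({p : ℝ × ℝ | 0 ≤ p.1}), IsOpen V ∧ Nonempty (U ≃ₜ V))
    (f : X → Y) (hinj : Function.Injective f)
    (hdarboux : ∀ C : Set X, IsPreconnected C → IsPreconnected (f '' C)) :
    Topology.IsOpenEmbedding f := by
  have hE : 1 < Module.rank ℝ (EuclideanSpace ℝ (Fin n)) := by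
    rw [← Module.finrank_eq_rank, finrank_euclideanSpace_fin]
    exact_mod_cast hn
  have hchart : ∀ x : X, ∀ W, IsOpen W → x ∈ W →
      ∃ j : EuclideanSpace ℝ (Fin n) → X, IsOpenEmbedding j ∧ x ∈ range j ∧ range j ⊆ W := by
    intro x W hW hxW
    obtain ⟨U, hU, hxU, ⟨e⟩⟩ := hX x
    exact exists_isOpenEmbedding_range_subset hU hxU e hW hxW
  have hnontriv : ∀ x : X, ∃ x', x' ≠ x := by
    intro x
    obtain ⟨j, hj, -⟩ := hchart x univ isOpen_univ (mem_univ x)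
    have : Nontrivial (EuclideanSpace ℝ (Fin n)) :=
      rank_pos_iff_nontrivial.1 (zero_lt_one.trans hE)
    have := hj.injective.nontrivial
    exact exists_ne x
  have hlocal : ∀ x : X, ContinuousAt f x ∧ range f ∈ 𝓝 (f x) := by
    intro x
    obtain ⟨U, hU, hxU, V, hV, ⟨e⟩⟩ := hY (f x)
    obtain ⟨M, q, r, hr, hM, hM0, hMx, hq, hqi, hqM, hbasis⟩ :=
      exists_circular_neighbourhoods hU hxU hV e
    obtain ⟨x', hx'⟩ := hnontriv x
    have hMf : M (f x) = 0 := (hMx _).2 rfl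
    have hpos : 0 < M (f x') := lt_of_le_of_ne (hM0 _) fun h =>
      hx' (hinj ((hMx _).1 h.symm))
    have hcirc : ∀ s, 0 < s → s < r → s < M (f x') →
        IsClosed (f ⁻¹' {p | M p = s}) ∧ {p | M p = s} ⊆ range f := by
      intro s hs hsr hsx
      have hsub : {p | M p = s} ⊆ {p | M p < r} := fun p hp => (show M p = s from hp).trans_lt hsr
      exact isClosed_preimage_and_subset_range_of_circle
        (fun T hT h => isPreconnected_compl_of_forall_connectedComponentIn_injOn hE hchart hT h)
        hinj hdarboux hM hs (hq.mono hsub) (hqi.mono hsub)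
        (fun p hp => (hqM p (hsub hp)).symm.trans hp) (hMf.trans_lt hs) hsx
    constructor
    · rw [ContinuousAt, tendsto_def]
      intro O hO
      obtain ⟨s₀, hs₀, hs₀O⟩ := hbasis O hO
      obtain ⟨s, hs, hsm⟩ := exists_between (lt_min hs₀ (lt_min hr hpos))
      rw [lt_min_iff, lt_min_iff] at hsm
      obtain ⟨hcl, -⟩ := hcirc s hs hsm.2.1 hsm.2.2
      obtain ⟨j, hj, hxj, hjs⟩ := hchart x _ hcl.isOpen_compl
        (fun h => hs.ne (hMf.symm.trans h))
      refine mem_of_superset (hj.isOpen_range.mem_nhds hxj) fun z hz => hs₀O ?_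
      refine lt_trans ?_ hsm.1
      by_contra! hle
      obtain ⟨_, ⟨w, hw, rfl⟩, hws⟩ := ((hdarboux _
        (isPreconnected_range hj.continuous)).image M hM.continuousOn).ordConnected.out
        (mem_image_of_mem M (mem_image_of_mem f hxj)) (mem_image_of_mem M (mem_image_of_mem f hz))
        ⟨hMf.trans_le hs.le, hle⟩
      exact hjs hw hws
    · have hopen : IsOpen {p | M p < min r (M (f x'))} := isOpen_lt hM continuous_const
      refine mem_of_superset (hopen.mem_nhds (hMf.trans_lt (lt_min hr hpos))) fun p hp => ?_
      rcases (hM0 p).eq_or_lt with h | h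
      · exact ⟨x, ((hMx p).1 h.symm).symm⟩
      · have hp' := lt_min_iff.1 (show M p < _ from hp)
        exact (hcirc (M p) h hp'.1 hp'.2).2 rfl
  have hcont : Continuous f := continuous_iff_continuousAt.2 fun x => (hlocal x).1
  refine ⟨(hcont.isClosedEmbedding hinj).isEmbedding, isOpen_iff_mem_nhds.2 ?_⟩
  rintro _ ⟨x, rfl⟩
  exact (hlocal x).2
end
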